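/- Fix an integer n ≥ 2. If Γ is an n-clique tree-graded graph and Λ is a finite simplicial graph such that A(Λ) is quasi-isometric to A(Γ), then Λ is itself an n-clique tree-graded graph. -/

import Mathlib

noncomputable section

universe u v

/-- Word metric (distance function) on a group with respect to a generating set `S`. -/
def wordDist {G : Type*} [Group G] (S : Set G) (g h : G) : ℝ :=
  sInf ((fun l : List G => (l.length : ℝ)) ''
    {l : List G | (∀ x ∈ l, x ∈ S ∨ x⁻¹ ∈ S) ∧ g * l.prod = h})

/-- `f` is `(K, A)`-coarse Lipschitz. -/
def CoarseLipschitzWith {X Y : Type*} (K A : ℝ) (dX : X → X → ℝ) (dY : Y → Y → ℝ)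
    (f : X → Y) : Prop :=
  ∀ x x', dY (f x) (f x') ≤ K * dX x x' + A

/-- `f` is a `(K, A)`-quasi-isometry. -/
def IsQIWith {X Y : Type*} (K A : ℝ) (dX : X → X → ℝ) (dY : Y → Y → ℝ) (f : X → Y) : Prop :=
  1 ≤ K ∧ 0 ≤ A ∧
  (∀ x x', dX x x' / K - A ≤ dY (f x) (f x') ∧ dY (f x) (f x') ≤ K * dX x x' + A) ∧
  (∀ y, ∃ x, dY (f x) y ≤ A)

/-- `f` is a quasi-isometry. -/
def IsQI {X Y : Type*} (dX : X → X → ℝ) (dY : Y → Y → ℝ) (f : X → Y) : Prop :=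
  ∃ K A : ℝ, IsQIWith K A dX dY f

/-- The Hausdorff distance between `S` and `T` (w.r.t. the distance `d`) is at most `r`. -/
def HausLE {X : Type*} (d : X → X → ℝ) (S T : Set X) (r : ℝ) : Prop :=
  (∀ s ∈ S, ∃ t ∈ T, d s t ≤ r) ∧ (∀ t ∈ T, ∃ s ∈ S, d s t ≤ r)

/-- `S` and `T` are at finite Hausdorff distance. -/
def FinHaus {X : Type*} (d : X → X → ℝ) (S T : Set X) : Prop :=
  ∃ r : ℝ, 0 ≤ r ∧ HausLE d S T r

/-- The commutator relations of a right-angled Artin group. -/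
def raagRels {V : Type} (Γ : SimpleGraph V) : Set (FreeGroup V) :=
  {r | ∃ x y : V, Γ.Adj x y ∧
    r = FreeGroup.of x * FreeGroup.of y * (FreeGroup.of x)⁻¹ * (FreeGroup.of y)⁻¹}

/-- The right-angled Artin group `A(Γ)` of a simplicial graph `Γ`. -/
abbrev Raag {V : Type} (Γ : SimpleGraph V) : Type := PresentedGroup (raagRels Γ)

/-- The generator of `Raag Γ` corresponding to a vertex. -/
def raagGen {V : Type} (Γ : SimpleGraph V) (x : V) : Raag Γ :=
  PresentedGroup.of (rels := raagRels Γ) x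

/-- The word metric on `Raag Γ` with respect to the vertex generators. -/
def raagDist {V : Type} (Γ : SimpleGraph V) : Raag Γ → Raag Γ → ℝ :=
  wordDist (Set.range (raagGen Γ))

/-- `A(Γ)` and `A(Λ)` are quasi-isometric (w.r.t. the vertex word metrics). -/
def RaagQI {V W : Type} (Γ : SimpleGraph V) (Λ : SimpleGraph W) : Prop :=
  ∃ f : Raag Γ → Raag Λ, IsQI (raagDist Γ) (raagDist Λ) f

/-- A standard geodesic: the coset `g⟨v⟩`, recorded by a basepoint `g` and a label `v`. -/
structure StdGeod {V : Type} (Γ : SimpleGraph V) where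
  base : Raag Γ
  label : V

/-- The parametrization `n ↦ g vⁿ` of a standard geodesic, identifying it with `ℤ`. -/
def StdGeod.param {V : Type} {Γ : SimpleGraph V} (l : StdGeod Γ) : ℤ → Raag Γ :=
  fun n => l.base * raagGen Γ l.label ^ n

/-- The underlying subset of a standard geodesic. -/
def StdGeod.carrier {V : Type} {Γ : SimpleGraph V} (l : StdGeod Γ) : Set (Raag Γ) :=
  Set.range l.param

/-- Two standard geodesics are parallel if they are at finite Hausdorff distance. -/
def Parallel {V : Type} {Γ : SimpleGraph V} (l k : StdGeod Γ) : Prop :=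
  FinHaus (raagDist Γ) l.carrier k.carrier

/-- A based quasi-isometry `(A(Γ), l) → (A(Λ), l')`. -/
def IsBasedQI {V W : Type} {Γ : SimpleGraph V} {Λ : SimpleGraph W}
    (f : Raag Γ → Raag Λ) (l : StdGeod Γ) (l' : StdGeod Λ) : Prop :=
  IsQI (raagDist Γ) (raagDist Λ) f ∧ FinHaus (raagDist Λ) (f '' l.carrier) l'.carrier

/-- `str(f, l, C) = r`: on `l`, the map `f` is `C`-close to `n ↦ ±⌊r n⌋ + b`
(read through the identifications of `l` and `l'` with `ℤ`). -/
def StrWith {V W : Type} {Γ : SimpleGraph V} {Λ : SimpleGraph W}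
    (f : Raag Γ → Raag Λ) (l : StdGeod Γ) (l' : StdGeod Λ) (C : ℝ) (r : ℚ) : Prop :=
  ∃ ε : ℤ, (ε = 1 ∨ ε = -1) ∧ ∃ b : ℤ,
    ∀ n : ℤ, raagDist Λ (f (l.param n)) (l'.param (ε * ⌊r * (n : ℚ)⌋ + b)) ≤ C

/-- The stretch factor `str(f, l)` (computed with respect to `l'`) is well-defined
and equals `r`. -/
def HasStr {V W : Type} {Γ : SimpleGraph V} {Λ : SimpleGraph W}
    (f : Raag Γ → Raag Λ) (l : StdGeod Γ) (l' : StdGeod Λ) (r : ℚ) : Prop :=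
  ∃ C : ℝ, 0 ≤ C ∧ StrWith f l l' C r

/-- `l` is an `𝓡`-geodesic. -/
def IsRGeod {V : Type} {Γ : SimpleGraph V} (l : StdGeod Γ) : Prop :=
  ∀ (W : Type) [Fintype W] (Λ : SimpleGraph W) (l' : StdGeod Λ)
    (f g : Raag Γ → Raag Λ),
    IsBasedQI f l l' → IsBasedQI g l l' →
    ∃ r : ℚ, HasStr f l l' r ∧ HasStr g l l' r

/-- The parallelism class `𝒮_l` of a standard geodesic (as a family of subsets). -/
def parClass {V : Type} {Γ : SimpleGraph V} (l : StdGeod Γ) : Set (Set (Raag Γ)) :=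
  {S | ∃ k : StdGeod Γ, S = k.carrier ∧ Parallel l k}

/-- The peripheral structure `𝒫_B` on `Raag Γ` determined by a set `B` of vertices. -/
def periph {V : Type} (Γ : SimpleGraph V) (B : Set V) : Set (Set (Set (Raag Γ))) :=
  {F | ∃ l : StdGeod Γ, l.label ∈ B ∧ F = parClass l}

/-- A `(K, A)`-relative quasi-isometry between spaces with peripheral structures. -/
def IsRelQIWith {X Y : Type*} (K A : ℝ) (dX : X → X → ℝ) (dY : Y → Y → ℝ)
    (PX : Set (Set (Set X))) (PY : Set (Set (Set Y)))
    (f : X → Y) (fs : Set (Set X) → Set (Set Y)) : Prop :=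
  IsQIWith K A dX dY f ∧
  Set.BijOn fs PX PY ∧
  ∀ F ∈ PX, (∀ a ∈ F, ∃ b ∈ fs F, HausLE dY (f '' a) b A) ∧
            (∀ b ∈ fs F, ∃ a ∈ F, HausLE dY (f '' a) b A)

/-- The two spaces with peripheral structures are relatively quasi-isometric. -/
def IsRelQI {X Y : Type*} (dX : X → X → ℝ) (dY : Y → Y → ℝ)
    (PX : Set (Set (Set X))) (PY : Set (Set (Set Y))) : Prop :=
  ∃ (K A : ℝ) (f : X → Y) (fs : Set (Set X) → Set (Set Y)),
    IsRelQIWith K A dX dY PX PY f fs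

/-- Left translation of a family of subsets of `Raag Γ`. -/
def translateFam {V : Type} {Γ : SimpleGraph V} (g : Raag Γ) (F : Set (Set (Raag Γ))) :
    Set (Set (Raag Γ)) :=
  (fun a => (fun x => g * x) '' a) '' F

/-- A decoration on `𝒫_B` that is invariant under the left translation action. -/
def DecorInvariant {V : Type} (Γ : SimpleGraph V) (B : Set V) {O : Type}
    (δ : Set (Set (Raag Γ)) → O) : Prop :=
  ∀ g : Raag Γ, ∀ F ∈ periph Γ B, δ (translateFam g F) = δ F

/-- A decoration-preserving based relative quasi-isometry
`(A(Γ), 𝒫_{BΓ}, δΓ, l) → (A(Λ), 𝒫_{BΛ}, δΛ, l')`. -/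
def IsDecorBasedRelQI {V W : Type} (Γ : SimpleGraph V) (Λ : SimpleGraph W)
    (BΓ : Set V) (BΛ : Set W) {O : Type}
    (δΓ : Set (Set (Raag Γ)) → O) (δΛ : Set (Set (Raag Λ)) → O)
    (l : StdGeod Γ) (l' : StdGeod Λ)
    (f : Raag Γ → Raag Λ) (fs : Set (Set (Raag Γ)) → Set (Set (Raag Λ))) : Prop :=
  (∃ K A : ℝ, IsRelQIWith K A (raagDist Γ) (raagDist Λ) (periph Γ BΓ) (periph Λ BΛ) f fs) ∧
  (∀ F ∈ periph Γ BΓ, δΛ (fs F) = δΓ F) ∧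
  FinHaus (raagDist Λ) (f '' l.carrier) l'.carrier

/-- `A(Γ)` is a dovetail RAAG. -/
def Dovetail {V : Type} (Γ : SimpleGraph V) : Prop :=
  ∀ (W : Type) [Fintype W] (Λ : SimpleGraph W) (BΓ : Set V) (BΛ : Set W)
    (O : Type) (δΓ : Set (Set (Raag Γ)) → O) (δΛ : Set (Set (Raag Λ)) → O),
    DecorInvariant Γ BΓ δΓ → DecorInvariant Λ BΛ δΛ →
    ∀ (l : StdGeod Γ) (l' : StdGeod Λ) (f : Raag Γ → Raag Λ)
      (fs : Set (Set (Raag Γ)) → Set (Set (Raag Λ))),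
      IsDecorBasedRelQI Γ Λ BΓ BΛ δΓ δΛ l l' f fs →
      ∀ lam : Set (Set (Raag Γ)) → ℚ,
        (∀ F ∈ periph Γ BΓ, 0 < lam F) →
        (∃ M : ℚ, 1 ≤ M ∧ ∀ F ∈ periph Γ BΓ, 1 / M ≤ lam F ∧ lam F ≤ M) →
        (∀ F ∈ periph Γ BΓ, ∀ F' ∈ periph Γ BΓ, δΓ F = δΓ F' → lam F = lam F') →
        ∃ C : ℝ, 0 ≤ C ∧
          ∃ (g : Raag Γ → Raag Λ) (gs : Set (Set (Raag Γ)) → Set (Set (Raag Λ))),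
            IsDecorBasedRelQI Γ Λ BΓ BΛ δΓ δΛ l l' g gs ∧
            (∀ l2 : StdGeod Γ, l2.label ∈ BΓ → ¬ IsRGeod l2 →
              ∀ l3 : StdGeod Λ, FinHaus (raagDist Λ) (g '' l2.carrier) l3.carrier →
                StrWith g l2 l3 C (lam (parClass l2))) ∧
            (∀ l2 : StdGeod Γ, l2.label ∈ BΓ → IsRGeod l2 →
              ∀ l3 : StdGeod Λ, FinHaus (raagDist Λ) (g '' l2.carrier) l3.carrier →
                ∃ r : ℚ, StrWith g l2 l3 C r)

/-- The closed star of a vertex, as a vertex set. -/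
def starSet {V : Type} (Γ : SimpleGraph V) (x : V) : Set V :=
  insert x {u | Γ.Adj x u}

/-- The link of a vertex, as a vertex set. -/
def lkSet {V : Type} (Γ : SimpleGraph V) (x : V) : Set V := {u | Γ.Adj x u}

/-- The link of `x` inside the induced subgraph on `S`. -/
def lkIn {V : Type} (Γ : SimpleGraph V) (S : Set V) (x : V) : Set V :=
  {u | u ∈ S ∧ Γ.Adj x u}

/-- `x` is a cut vertex: deleting it (and incident edges) disconnects the graph. -/
def CutVertex {V : Type} (Γ : SimpleGraph V) (x : V) : Prop :=
  ¬ (Γ.induce {u : V | u ≠ x}).Preconnected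

/-- The vertex set `S` spans a biconnected subgraph: connected with no cut vertex. -/
def Biconn {V : Type} (Γ : SimpleGraph V) (S : Set V) : Prop :=
  (Γ.induce S).Connected ∧ ∀ x ∈ S, (Γ.induce (S \ {x})).Preconnected

/-- `S` spans a maximal biconnected subgraph. -/
def MaxBiconn {V : Type} (Γ : SimpleGraph V) (S : Set V) : Prop :=
  Biconn Γ S ∧ ∀ T : Set V, Biconn Γ T → S ⊆ T → S = T

/-- The collection `C₁` of maximal biconnected subgraphs: those containing at least
two cut vertices, or not contained in the star of any cut vertex. -/
def C1 {V : Type} (Γ : SimpleGraph V) : Set (Set V) :=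
  {S | MaxBiconn Γ S ∧
    ((∃ x ∈ S, ∃ y ∈ S, x ≠ y ∧ CutVertex Γ x ∧ CutVertex Γ y) ∨
     (∀ x : V, CutVertex Γ x → ¬ S ⊆ starSet Γ x))}

/-- `Γ` is an `n`-clique tree-graded graph. -/
def NCliqueTreeGraded {V : Type} (Γ : SimpleGraph V) (n : ℕ) : Prop :=
  Γ.Connected ∧
  (∀ x : V, CutVertex Γ x ∨ (∃! u : V, Γ.Adj x u)) ∧
  (∃ x y : V, 3 ≤ Γ.dist x y) ∧
  (∀ S : Set V, MaxBiconn Γ S →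
    ((Γ.IsClique S ∧ S.ncard = n ∧ ∀ x ∈ S, CutVertex Γ x) ∨
     (Γ.IsClique S ∧ S.ncard = 2 ∧ ∃! x : V, x ∈ S ∧ CutVertex Γ x)))

/-- The subgroup of `Raag Γ` generated by the vertices in `T`. -/
def subRaag {V : Type} (Γ : SimpleGraph V) (T : Set V) : Subgroup (Raag Γ) :=
  Subgroup.closure (raagGen Γ '' T)

/-- The word metric on the subgroup generated by `T`, w.r.t. the generators from `T`. -/
def subDist {V : Type} (Γ : SimpleGraph V) (T : Set V) :
    ↥(subRaag Γ T) → ↥(subRaag Γ T) → ℝ :=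
  wordDist {x : ↥(subRaag Γ T) | ∃ u ∈ T, (x : Raag Γ) = raagGen Γ u}

/-- The cylinder group `A(star(x))`. -/
def cylGroup {V : Type} (Γ : SimpleGraph V) (x : V) : Subgroup (Raag Γ) :=
  subRaag Γ (starSet Γ x)

/-- The word metric on the cylinder `A(star(x))` w.r.t. the vertices of `star(x)`. -/
def cylDist {V : Type} (Γ : SimpleGraph V) (x : V) :
    ↥(cylGroup Γ x) → ↥(cylGroup Γ x) → ℝ :=
  subDist Γ (starSet Γ x)

/-- The coset `a⟨x⟩`, as a subset of the cylinder `A(star(x))`. -/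
def cylCoset {V : Type} (Γ : SimpleGraph V) (x : V) (a : Raag Γ) :
    Set ↥(cylGroup Γ x) :=
  {g | ∃ n : ℤ, (g : Raag Γ) = a * raagGen Γ x ^ n}

/-- The peripheral structure `𝒫_x` on the cylinder `A(star(x))`: one element for each
coset `g·A(star_{Γ'}(x))` with `Γ' ∈ C₁` containing `x`, namely the family of cosets
`{g·h·⟨x⟩ : h ∈ A(lk_{Γ'}(x))}`. -/
def cylPeriph {V : Type} (Γ : SimpleGraph V) (x : V) :
    Set (Set (Set ↥(cylGroup Γ x))) :=
  {F | ∃ S ∈ C1 Γ, x ∈ S ∧ ∃ g : Raag Γ, g ∈ cylGroup Γ x ∧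
    F = {c | ∃ h ∈ subRaag Γ (lkIn Γ S x), c = cylCoset Γ x (g * h)}}

/-- The factors `A(T) ≤ A(Γ)` and `A(T') ≤ A(Λ)` are quasi-isometric. -/
def FactorQI {V W : Type} (Γ : SimpleGraph V) (Λ : SimpleGraph W)
    (T : Set V) (T' : Set W) : Prop :=
  ∃ φ : ↥(subRaag Γ T) → ↥(subRaag Λ T'), IsQI (subDist Γ T) (subDist Λ T') φ

namespace CliqueTree

/-! ### The word metric -/

section Metric

variable {V : Type} {Γ : SimpleGraph V}

/-- The group element spelled by a word in the vertex generators and their inverses. -/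
def ev (Γ : SimpleGraph V) (l : List (V × Bool)) : Raag Γ :=
  (l.map fun x => cond x.2 (raagGen Γ x.1) (raagGen Γ x.1)⁻¹).prod

@[simp] theorem ev_nil : ev Γ [] = 1 := rfl

theorem ev_cons (s : V × Bool) (l : List (V × Bool)) : ev Γ (s :: l) = ev Γ [s] * ev Γ l := by
  simp [ev]

theorem ev_append (l l' : List (V × Bool)) : ev Γ (l ++ l') = ev Γ l * ev Γ l' := by
  simp [ev]

theorem ev_true (s : V) : ev Γ [(s, true)] = raagGen Γ s := by simp [ev]

theorem ev_false (s : V) : ev Γ [(s, false)] = (raagGen Γ s)⁻¹ := by simp [ev]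

theorem ev_surjective (x : Raag Γ) : ∃ l, ev Γ l = x := by
  classical
  obtain ⟨w, rfl⟩ := PresentedGroup.mk_surjective _ x
  refine ⟨w.toWord, ?_⟩
  have h : PresentedGroup.mk (raagRels Γ) = FreeGroup.lift (raagGen Γ) := by
    ext v
    simp [raagGen, PresentedGroup.of]
  rw [h]
  conv_rhs => rw [← FreeGroup.mk_toWord (x := w)]
  rw [FreeGroup.lift_mk]
  rfl

theorem ev_inv (l : List (V × Bool)) : ∃ l', l'.length = l.length ∧ ev Γ l' = (ev Γ l)⁻¹ := by
  induction l with
  | nil => exact ⟨[], rfl, by simp⟩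
  | cons s l ih =>
    obtain ⟨l', h1, h2⟩ := ih
    refine ⟨l' ++ [(s.1, !s.2)], by simp [h1], ?_⟩
    rw [ev_append, ev_cons s l, mul_inv_rev, h2]
    rcases s with ⟨s, _ | _⟩ <;> simp [ev]

/-- The word metric, as a natural number. -/
def nd (x y : Raag Γ) : ℕ := sInf {n | ∃ l : List (V × Bool), l.length = n ∧ x * ev Γ l = y}

theorem nd_spec (x y : Raag Γ) : ∃ l : List (V × Bool), l.length = nd x y ∧ x * ev Γ l = y := by
  have : {n | ∃ l : List (V × Bool), l.length = n ∧ x * ev Γ l = y}.Nonempty := by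
    obtain ⟨l, hl⟩ := ev_surjective (x⁻¹ * y)
    exact ⟨l.length, l, rfl, by simp [hl]⟩
  exact Nat.sInf_mem this

theorem nd_le_length (x : Raag Γ) (l : List (V × Bool)) : nd x (x * ev Γ l) ≤ l.length :=
  Nat.sInf_le ⟨l, rfl, rfl⟩

theorem raagDist_eq_nd (x y : Raag Γ) : raagDist Γ x y = nd x y := by
  apply le_antisymm
  · obtain ⟨l, h1, h2⟩ := nd_spec x y
    refine csInf_le ⟨0, ?_⟩ ⟨l.map fun x : V × Bool => cond x.2 (raagGen Γ x.1) (raagGen Γ x.1)⁻¹,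
      ⟨?_, h2⟩, ?_⟩
    · rintro _ ⟨l, -, rfl⟩
      positivity
    · intro z hz
      obtain ⟨⟨s, _ | _⟩, -, rfl⟩ := List.mem_map.1 hz <;> simp
    · simp [h1]
  · obtain ⟨l, h1, h2⟩ := nd_spec x y
    refine le_csInf ⟨_, l.map fun x : V × Bool => cond x.2 (raagGen Γ x.1) (raagGen Γ x.1)⁻¹,
      ⟨?_, h2⟩, rfl⟩ ?_
    · intro z hz
      obtain ⟨⟨s, _ | _⟩, -, rfl⟩ := List.mem_map.1 hz <;> simp
    · rintro _ ⟨m, ⟨hm, rfl⟩, rfl⟩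
      have : ∃ l' : List (V × Bool), l'.length = m.length ∧ ev Γ l' = m.prod := by
        clear h2 h1
        induction m with
        | nil => exact ⟨[], rfl, rfl⟩
        | cons z m ih =>
          obtain ⟨l', h3, h4⟩ := ih (fun x hx => hm x (List.mem_cons_of_mem _ hx))
          rcases hm z (by simp) with ⟨s, rfl⟩ | ⟨s, hs⟩
          · exact ⟨(s, true) :: l', by simp [h3], by simp [ev_cons _ l', ev_true, h4]⟩
          · exact ⟨(s, false) :: l', by simp [h3], by simp [ev_cons _ l', ev_false, h4, hs]⟩
      obtain ⟨l', h3, h4⟩ := this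
      have := nd_le_length x l'
      rw [h4, h3] at this
      exact Nat.cast_le.2 this

@[simp] theorem nd_self (x : Raag Γ) : nd x x = 0 := by
  have := nd_le_length x []
  simpa using this

theorem nd_triangle (x y z : Raag Γ) : nd x z ≤ nd x y + nd y z := by
  obtain ⟨l, h1, h2⟩ := nd_spec x y
  obtain ⟨l', h3, h4⟩ := nd_spec y z
  have := nd_le_length x (l ++ l')
  rw [ev_append, ← mul_assoc, h2, h4, List.length_append] at this
  omega

theorem nd_comm_le (x y : Raag Γ) : nd y x ≤ nd x y := by
  obtain ⟨l, h1, h2⟩ := nd_spec x y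
  obtain ⟨l', h3, h4⟩ := ev_inv (Γ := Γ) l
  have := nd_le_length y l'
  rw [h4, ← h2, mul_inv_cancel_right, h2] at this
  omega

theorem nd_comm (x y : Raag Γ) : nd x y = nd y x := le_antisymm (nd_comm_le _ _) (nd_comm_le _ _)

@[simp] theorem nd_mul_left (g x y : Raag Γ) : nd (g * x) (g * y) = nd x y := by
  simp only [nd, mul_assoc, mul_right_inj]

theorem nd_mul_gen (x : Raag Γ) (s : V) : nd x (x * raagGen Γ s) ≤ 1 := by
  rw [← ev_true]; exact nd_le_length x _

theorem nd_gen_pow (x : Raag Γ) (s : V) (k : ℕ) : nd x (x * raagGen Γ s ^ k) ≤ k := by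
  induction k with
  | zero => simp
  | succ k ih =>
    have := nd_triangle x (x * raagGen Γ s ^ k) (x * raagGen Γ s ^ (k + 1))
    have h := nd_mul_gen (x * raagGen Γ s ^ k) s
    rw [pow_succ, ← mul_assoc] at *
    omega

theorem nd_gen_zpow (x : Raag Γ) (s : V) (k : ℤ) : nd x (x * raagGen Γ s ^ k) ≤ k.natAbs := by
  rcases Int.natAbs_eq k with h | h
  · conv_lhs => rw [h, zpow_natCast]
    exact nd_gen_pow x s k.natAbs
  · conv_lhs => rw [h]
    have := nd_gen_pow (x * raagGen Γ s ^ (-(k.natAbs : ℤ))) s k.natAbs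
    rw [mul_assoc, ← zpow_natCast, ← zpow_add, neg_add_cancel, zpow_zero, mul_one, nd_comm] at this
    exact this

theorem nd_gen_zpow_zpow (x : Raag Γ) (s : V) (j k : ℤ) :
    nd (x * raagGen Γ s ^ j) (x * raagGen Γ s ^ k) ≤ (k - j).natAbs := by
  have := nd_gen_zpow (x * raagGen Γ s ^ j) s (k - j)
  rwa [mul_assoc, ← zpow_add, add_sub_cancel] at this

/-- Exponent sum of the letter `v`. -/
def exHom (Γ : SimpleGraph V) (v : V) : Raag Γ →* Multiplicative ℤ := by
  classical
  exact PresentedGroup.toGroup (f := fun u => Multiplicative.ofAdd (if u = v then 1 else 0)) (by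
    rintro _ ⟨x, y, -, rfl⟩
    simp)

/-- Exponent sum of the letter `v`. -/
def ex (v : V) (x : Raag Γ) : ℤ := (exHom Γ v x).toAdd

@[simp] theorem ex_one (v : V) : ex v (1 : Raag Γ) = 0 := by simp [ex]

@[simp] theorem ex_mul (v : V) (x y : Raag Γ) : ex v (x * y) = ex v x + ex v y := by simp [ex]

@[simp] theorem ex_inv (v : V) (x : Raag Γ) : ex v x⁻¹ = - ex v x := by simp [ex]

@[simp] theorem ex_zpow (v : V) (x : Raag Γ) (k : ℤ) : ex v (x ^ k) = k * ex v x := by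
  simp [ex]

@[simp] theorem ex_pow (v : V) (x : Raag Γ) (k : ℕ) : ex v (x ^ k) = k * ex v x := by
  simp [ex]

theorem ex_gen [DecidableEq V] (u v : V) : ex v (raagGen Γ u) = if u = v then 1 else 0 := by
  simp [ex, exHom, raagGen]

@[simp] theorem ex_gen_self (v : V) : ex v (raagGen Γ v) = 1 := by
  classical simp [ex_gen]

theorem ex_gen_ne {u v : V} (h : u ≠ v) : ex v (raagGen Γ u) = 0 := by
  classical simp [ex_gen, h]

theorem ex_ev_le (v : V) (l : List (V × Bool)) : (ex v (ev Γ l)).natAbs ≤ l.length := by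
  classical
  induction l with
  | nil => simp
  | cons s l ih =>
    have : (ex v (ev Γ [s])).natAbs ≤ 1 := by
      rcases s with ⟨s, _ | _⟩ <;> simp [ev_true, ev_false, ex_gen] <;> split_ifs <;> simp
    rw [ev_cons, ex_mul, List.length_cons]
    omega

theorem ex_sub_le (v : V) (x y : Raag Γ) : (ex v y - ex v x).natAbs ≤ nd x y := by
  obtain ⟨l, h1, h2⟩ := nd_spec x y
  rw [← h1, ← h2, ex_mul, add_sub_cancel_left]
  exact ex_ev_le v l

theorem ball_finite [Finite V] (r : ℕ) : {x : Raag Γ | nd 1 x ≤ r}.Finite := by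
  refine ((List.finite_length_le (α := V × Bool) (n := r)).image (ev Γ)).subset ?_
  intro x hx
  obtain ⟨l, h1, h2⟩ := nd_spec 1 x
  exact ⟨l, by simpa [h1] using hx, by simpa using h2⟩

theorem ball_finite' [Finite V] (p : Raag Γ) (r : ℕ) : {x : Raag Γ | nd p x ≤ r}.Finite := by
  refine ((ball_finite (Γ := Γ) r).image (p * ·)).subset ?_
  intro x hx
  refine ⟨p⁻¹ * x, ?_, by simp⟩
  rw [Set.mem_ofPred_eq, ← nd_mul_left p]
  simpa using hx

theorem ball_card [Finite V] (r : ℕ) : ∃ N : ℕ, ∀ (p : Raag Γ) (F : Finset (Raag Γ)),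
    (∀ x ∈ F, nd p x ≤ r) → F.card ≤ N := by
  classical
  refine ⟨(ball_finite (Γ := Γ) r).toFinset.card, fun p F hF => ?_⟩
  refine Finset.card_le_card_of_injOn (fun x => p⁻¹ * x) ?_ (fun x _ y _ h => by simpa using h)
  intro x hx
  have := hF x hx
  rw [← nd_mul_left p⁻¹] at this
  simpa using this

theorem gen_comm {u v : V} (h : Γ.Adj u v) : Commute (raagGen Γ u) (raagGen Γ v) := by
  have : PresentedGroup.mk (raagRels Γ) (FreeGroup.of u * FreeGroup.of v * (FreeGroup.of u)⁻¹ *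
      (FreeGroup.of v)⁻¹) = 1 := PresentedGroup.one_of_mem ⟨u, v, h, rfl⟩
  simp only [map_mul, map_inv] at this
  have := mul_inv_eq_one.1 this
  exact mul_inv_eq_iff_eq_mul.1 this

end Metric

/-! ### Cosets of standard subgroups, neighbourhoods and growth -/

section Cosets

variable {V W : Type} {Γ : SimpleGraph V} {Λ : SimpleGraph W}

/-- The coset `h A(T)`. -/
def cs (Γ : SimpleGraph V) (h : Raag Γ) (T : Set V) : Set (Raag Γ) := {x | h⁻¹ * x ∈ subRaag Γ T}

/-- The closed `r`-neighbourhood of a set in `A(Γ)`. -/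
def nb (r : ℕ) (S : Set (Raag Γ)) : Set (Raag Γ) := {x | ∃ q ∈ S, nd x q ≤ r}

/-- A quasi-isometric embedding with a single natural constant. -/
def QE (K : ℕ) (f : Raag Λ → Raag Γ) : Prop :=
  ∀ x y, nd (f x) (f y) ≤ K * nd x y + K ∧ nd x y ≤ K * nd (f x) (f y) + K

theorem mem_cs {h x : Raag Γ} {T : Set V} : x ∈ cs Γ h T ↔ h⁻¹ * x ∈ subRaag Γ T := Iff.rfl

theorem self_mem_cs (h : Raag Γ) (T : Set V) : h ∈ cs Γ h T := by
  simp [cs, one_mem]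

theorem mul_mem_cs {h x a : Raag Γ} {T : Set V} (hx : x ∈ cs Γ h T) (ha : a ∈ subRaag Γ T) :
    x * a ∈ cs Γ h T := by
  rw [mem_cs, ← mul_assoc]; exact mul_mem hx ha

theorem gen_mem {T : Set V} {s : V} (hs : s ∈ T) : raagGen Γ s ∈ subRaag Γ T :=
  Subgroup.subset_closure ⟨s, hs, rfl⟩

theorem gen_zpow_mem {T : Set V} {s : V} (hs : s ∈ T) (k : ℤ) : raagGen Γ s ^ k ∈ subRaag Γ T :=
  zpow_mem (gen_mem hs) k

theorem gen_pow_mem {T : Set V} {s : V} (hs : s ∈ T) (k : ℕ) : raagGen Γ s ^ k ∈ subRaag Γ T :=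
  pow_mem (gen_mem hs) k

theorem ev_mem {T : Set V} {l : List (V × Bool)} (h : ∀ s ∈ l, s.1 ∈ T) : ev Γ l ∈ subRaag Γ T := by
  induction l with
  | nil => simp [one_mem]
  | cons s l ih =>
    rw [ev_cons]
    refine mul_mem ?_ (ih fun x hx => h x (List.mem_cons_of_mem _ hx))
    have := gen_mem (Γ := Γ) (h s (by simp))
    rcases s with ⟨s, _ | _⟩
    · rw [ev_false]; exact inv_mem this
    · rw [ev_true]; exact this

theorem subRaag_mono {S T : Set V} (h : S ⊆ T) : subRaag Γ S ≤ subRaag Γ T :=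
  Subgroup.closure_mono (Set.image_mono h)

theorem cs_mono {S T : Set V} (h : S ⊆ T) (x : Raag Γ) : cs Γ x S ⊆ cs Γ x T :=
  fun _ hy => subRaag_mono h hy

theorem cs_eq_of_mem {h x : Raag Γ} {T : Set V} (hx : x ∈ cs Γ h T) : cs Γ x T = cs Γ h T := by
  ext y
  simp only [mem_cs]
  have : h⁻¹ * y = (h⁻¹ * x) * (x⁻¹ * y) := by group
  rw [this, Subgroup.mul_mem_cancel_left _ (mem_cs.1 hx)]

theorem mem_cs_symm {h x : Raag Γ} {T : Set V} (hx : x ∈ cs Γ h T) : h ∈ cs Γ x T := by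
  rw [cs_eq_of_mem hx]; exact self_mem_cs _ _

theorem nb_mono_set {r : ℕ} {S T : Set (Raag Γ)} (h : S ⊆ T) : nb r S ⊆ nb r T :=
  fun _ ⟨q, hq, hd⟩ => ⟨q, h hq, hd⟩

theorem subset_nb (r : ℕ) (S : Set (Raag Γ)) : S ⊆ nb r S := fun q hq => ⟨q, hq, by simp⟩

theorem mem_nb_of_nd {r s : ℕ} {S : Set (Raag Γ)} {x y : Raag Γ} (hx : x ∈ nb r S)
    (h : nd x y ≤ s) : y ∈ nb (r + s) S := by
  obtain ⟨q, hq, hd⟩ := hx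
  refine ⟨q, hq, (nd_triangle y x q).trans ?_⟩
  rw [nd_comm] at h
  omega

theorem gen_comm_subRaag {T : Set V} {s : V} (h : ∀ t ∈ T, t ≠ s → Γ.Adj s t) {a : Raag Γ}
    (ha : a ∈ subRaag Γ T) : Commute (raagGen Γ s) a := by
  induction ha using Subgroup.closure_induction with
  | mem x hx =>
    obtain ⟨t, ht, rfl⟩ := hx
    by_cases e : t = s
    · rw [e]
    · exact gen_comm (h t ht e)
  | one => exact Commute.one_right _
  | mul x y _ _ hx hy => exact hx.mul_right hy
  | inv x _ hx => exact hx.inv_right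

theorem mem_subRaag_insert {B : Set V} {b : V} (hb : ∀ t ∈ B, t ≠ b → Γ.Adj b t)
    {a : Raag Γ} (ha : a ∈ subRaag Γ (insert b B)) :
    ∃ k : ℤ, ∃ a' ∈ subRaag Γ B, a = a' * raagGen Γ b ^ k := by
  induction ha using Subgroup.closure_induction with
  | mem x hx =>
    obtain ⟨t, ht, rfl⟩ := hx
    rcases ht with rfl | ht
    · exact ⟨1, 1, one_mem _, by simp⟩
    · exact ⟨0, _, gen_mem ht, by simp⟩
  | one => exact ⟨0, 1, one_mem _, by simp⟩
  | mul x y _ _ hx hy =>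
    obtain ⟨k, a, ha, rfl⟩ := hx
    obtain ⟨k', a', ha', rfl⟩ := hy
    refine ⟨k + k', a * a', mul_mem ha ha', ?_⟩
    have := ((gen_comm_subRaag hb ha').zpow_left k).eq
    rw [zpow_add, mul_assoc, ← mul_assoc _ a', this]
    group
  | inv x _ hx =>
    obtain ⟨k, a, ha, rfl⟩ := hx
    refine ⟨-k, a⁻¹, inv_mem ha, ?_⟩
    have := ((gen_comm_subRaag hb (inv_mem ha)).zpow_left (-k)).eq
    rw [mul_inv_rev, ← zpow_neg, this]

theorem mem_subRaag_empty {a : Raag Γ} (ha : a ∈ subRaag Γ ∅) : a = 1 := by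
  simpa [subRaag] using ha

theorem mem_subRaag_singleton {v : V} {a : Raag Γ} (ha : a ∈ subRaag Γ {v}) :
    ∃ k : ℤ, a = raagGen Γ v ^ k := by
  have : a ∈ subRaag Γ (insert v ∅) := by simpa using ha
  obtain ⟨k, a', ha', rfl⟩ := mem_subRaag_insert (by simp) this
  exact ⟨k, by rw [mem_subRaag_empty ha', one_mul]⟩

theorem ex_eq_zero {T : Set V} {b : V} (hb : b ∉ T) {a : Raag Γ} (ha : a ∈ subRaag Γ T) :
    ex b a = 0 := by
  induction ha using Subgroup.closure_induction with
  | mem x hx =>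
    obtain ⟨t, ht, rfl⟩ := hx
    exact ex_gen_ne fun h => hb (h ▸ ht)
  | one => simp
  | mul x y _ _ hx hy => simp [hx, hy]
  | inv x _ hx => simp [hx]

theorem eq_one_of_ex (B : Finset V) (hB : Γ.IsClique (B : Set V)) {a : Raag Γ}
    (ha : a ∈ subRaag Γ B) (h : ∀ b ∈ B, ex b a = 0) : a = 1 := by
  classical
  induction B using Finset.induction_on generalizing a with
  | empty => exact mem_subRaag_empty (by simpa using ha)
  | insert b B hb ih =>
    rw [Finset.coe_insert] at ha hB
    obtain ⟨k, a', ha', rfl⟩ := mem_subRaag_insert (fun t ht hne => hB (by simp) (by simp [ht]) hne.symm) ha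
    have h1 := h b (by simp)
    rw [ex_mul, ex_eq_zero (by simpa using hb) ha'] at h1
    simp only [ex_zpow, ex_gen_self, mul_one, zero_add] at h1
    subst h1
    rw [zpow_zero, mul_one] at h ⊢
    exact ih (hB.subset (by simp)) ha' fun c hc => h c (by simp [hc])

theorem eq_of_ex [Finite V] {B : Set V} (hB : Γ.IsClique B) {h x y : Raag Γ} (hx : x ∈ cs Γ h B)
    (hy : y ∈ cs Γ h B) (he : ∀ b ∈ B, ex b x = ex b y) : x = y := by
  have hf := Set.toFinite B
  have : x⁻¹ * y = 1 := by
    apply eq_one_of_ex hf.toFinset (by simpa using hB)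
    · have := cs_eq_of_mem hx ▸ hy
      simpa [mem_cs] using this
    · intro b hb
      simp [he b (by simpa using hb)]
  exact inv_mul_eq_one.1 this

theorem card_le_of_near [Finite V] [Finite W] {φ : Raag Λ → Raag Γ} {K : ℕ} (hφ : QE K φ)
    {B : Set V} (hB : Γ.IsClique B) (r : ℕ) :
    ∃ C : ℕ, ∀ (h : Raag Γ) (p : Raag Λ) (ρ : ℕ) (F : Finset (Raag Λ)),
      (∀ y ∈ F, nd p y ≤ ρ ∧ φ y ∈ nb r (cs Γ h B)) → F.card ≤ C * (ρ + 1) ^ B.ncard := by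
  classical
  have := Fintype.ofFinite V
  obtain ⟨N, hN⟩ := ball_card (Γ := Λ) (K * (2 * r) + K)
  set c := 2 * (2 * r + 2 * K + K) + 1 with hc
  refine ⟨N * c ^ B.ncard, fun h p ρ F hF => ?_⟩
  rcases F.eq_empty_or_nonempty with rfl | ⟨y0, hy0⟩
  · simp
  have hq : ∀ y : Raag Λ, ∃ q : Raag Γ, y ∈ F → q ∈ cs Γ h B ∧ nd (φ y) q ≤ r := by
    intro y
    by_cases hy : y ∈ F
    · obtain ⟨-, q, h1, h2⟩ := hF y hy
      exact ⟨q, fun _ => ⟨h1, h2⟩⟩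
    · exact ⟨1, fun h => absurd h hy⟩
  choose q hq using hq
  set M : ℤ := 2 * r + (K * (2 * ρ) + K) with hM
  let g : Raag Λ → (V → ℤ) := fun y v => if v ∈ B then ex v (q y) else 0
  have hd : ∀ y ∈ F, ∀ z ∈ F, nd (φ y) (φ z) ≤ 2 * r + nd (q y) (q z) := by
    intro y hy z hz
    have h1 := (hq y hy).2
    have h2 := (hq z hz).2
    have h3 := nd_triangle (φ y) (q y) (φ z)
    have h4 := nd_triangle (q y) (q z) (φ z)
    rw [nd_comm (q z)] at h4
    omega
  have hd' : ∀ y ∈ F, ∀ z ∈ F, nd (q y) (q z) ≤ 2 * r + nd (φ y) (φ z) := by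
    intro y hy z hz
    have h1 := (hq y hy).2
    have h2 := (hq z hz).2
    have h3 := nd_triangle (q y) (φ y) (q z)
    have h4 := nd_triangle (φ y) (φ z) (q z)
    rw [nd_comm (q y) (φ y)] at h3
    clear_value c M
    omega
  have himg : F.image g ⊆ Fintype.piFinset fun v : V =>
      if v ∈ B then Finset.Icc (ex v (q y0) - M) (ex v (q y0) + M) else {0} := by
    intro e he
    obtain ⟨y, hy, rfl⟩ := Finset.mem_image.1 he
    rw [Fintype.mem_piFinset]
    intro v
    by_cases hv : v ∈ B
    · simp only [g, hv, if_true, Finset.mem_Icc]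
      have h1 := ex_sub_le v (q y0) (q y)
      have h2 := hd' y0 hy0 y hy
      have h3 := (hφ y0 y).1
      have h4 := nd_triangle y0 p y
      have h5 := (hF y hy).1
      have h6 := (hF y0 hy0).1
      rw [nd_comm y0 p] at h4
      have h7 : K * nd y0 y ≤ K * (2 * ρ) := Nat.mul_le_mul_left _ (by omega)
      have h8 : ((ex v (q y) - ex v (q y0)).natAbs : ℤ) ≤ M := by
        rw [hM]
        exact_mod_cast h1.trans (h2.trans (by omega))
      rw [Int.natCast_natAbs, abs_le] at h8
      constructor <;> linarith
    · simp [g, hv]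
  have hcard : (F.image g).card ≤ (c * (ρ + 1)) ^ B.ncard := by
    refine (Finset.card_le_card himg).trans ?_
    rw [Fintype.card_piFinset]
    have : ∀ v : V, (if v ∈ B then Finset.Icc (ex v (q y0) - M) (ex v (q y0) + M) else {0}).card
        = if v ∈ B then (2 * M + 1).toNat else 1 := by
      intro v
      split_ifs
      · rw [Int.card_Icc]
        congr 1
        ring
      · simp
    simp_rw [this]
    rw [Finset.prod_ite, Finset.prod_const, Finset.prod_const_one, mul_one]
    have h1 : (Finset.univ.filter fun v => v ∈ B).card = B.ncard := by
      rw [Set.ncard_eq_toFinset_card', ← Set.filter_mem_univ_eq_toFinset]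
    rw [h1]
    refine Nat.pow_le_pow_left ?_ _
    rw [hc, Int.toNat_le, hM]
    push_cast
    nlinarith [mul_nonneg (Int.natCast_nonneg r) (Int.natCast_nonneg ρ),
      mul_nonneg (Int.natCast_nonneg K) (Int.natCast_nonneg ρ)]
  have hfib : ∀ e ∈ F.image g, (F.filter fun x => g x = e).card ≤ N := by
    intro e he
    obtain ⟨y, hy, rfl⟩ := Finset.mem_image.1 he
    refine hN y _ fun z hz => ?_
    obtain ⟨hz, he⟩ := Finset.mem_filter.1 hz
    have : q y = q z := by
      refine eq_of_ex hB (hq y hy).1 (hq z hz).1 fun b hb => ?_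
      have := congrFun he b
      simpa [g, hb] using this.symm
    have h1 := hd y hy z hz
    rw [this, nd_self] at h1
    have h2 := (hφ y z).2
    exact h2.trans (by gcongr; omega)
  calc F.card ≤ N * (F.image g).card := Finset.card_le_mul_card_image _ _ hfib
    _ ≤ N * (c * (ρ + 1)) ^ B.ncard := Nat.mul_le_mul_left _ hcard
    _ = _ := by rw [mul_pow, mul_assoc]

/-- Positive words in two letters. -/
def pw (Γ : SimpleGraph V) (u u' : V) (l : List Bool) : Raag Γ :=
  (l.map fun b => cond b (raagGen Γ u) (raagGen Γ u')).prod

theorem pw_injective {u u' : V} (hne : u ≠ u') (hadj : ¬ Γ.Adj u u') :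
    Function.Injective (pw Γ u u') := by
  classical
  let f : V → FreeGroup Bool := fun v => if v = u then FreeGroup.of true else
    if v = u' then FreeGroup.of false else 1
  have hf : ∀ r ∈ raagRels Γ, FreeGroup.lift f r = 1 := by
    rintro _ ⟨x, y, hxy, rfl⟩
    have hne' := hxy.ne
    have h2 : ¬ Γ.Adj u' u := fun h => hadj h.symm
    simp only [map_mul, FreeGroup.lift_apply_of, map_inv, f]
    by_cases h1 : x = u <;> by_cases h2 : x = u' <;> by_cases h3 : y = u <;> by_cases h4 : y = u' <;>
      simp_all
  let θ : Raag Γ →* FreeGroup Bool := PresentedGroup.toGroup hf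
  have hθ : ∀ l, θ (pw Γ u u' l) = FreeGroup.mk (l.map fun b => (b, true)) := by
    intro l
    induction l with
    | nil => simp [pw, FreeGroup.one_eq_mk]
    | cons b l ih =>
      have : pw Γ u u' (b :: l) = cond b (raagGen Γ u) (raagGen Γ u') * pw Γ u u' l := by simp [pw]
      rw [this, map_mul, ih, List.map_cons, ← List.singleton_append, ← FreeGroup.mul_mk]
      congr 1
      have h3 : ∀ v, θ (raagGen Γ v) = f v := fun v => PresentedGroup.toGroup.of hf
      cases b
      · simp only [cond_false, h3, f, hne.symm, if_false, if_true]; rfl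
      · simp only [cond_true, h3, f, if_true]; rfl
  intro l l' h
  have h1 := congrArg (fun x => (θ x).toWord) h
  simp only [hθ, FreeGroup.toWord_mk] at h1
  have hred : ∀ l : List Bool, FreeGroup.reduce (l.map fun b => (b, true)) = l.map fun b => (b, true) := by
    intro l
    apply FreeGroup.IsReduced.reduce_eq
    unfold FreeGroup.IsReduced
    induction l with
    | nil => simp
    | cons a l ih =>
      cases l with
      | nil => simp
      | cons b l => rw [List.map_cons, List.map_cons, List.isChain_cons_cons]; exact ⟨by simp, ih⟩
  rw [hred, hred] at h1
  exact List.map_injective_iff.2 (fun a b h => by simpa using h) h1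

theorem pw_mem {u u' : V} {T : Set V} (hu : u ∈ T) (hu' : u' ∈ T) (l : List Bool) :
    pw Γ u u' l ∈ subRaag Γ T := by
  refine list_prod_mem fun x hx => ?_
  obtain ⟨b, -, rfl⟩ := List.mem_map.1 hx
  cases b
  · exact gen_mem hu'
  · exact gen_mem hu

theorem nd_pw (u u' : V) (x : Raag Γ) (l : List Bool) : nd x (x * pw Γ u u' l) ≤ l.length := by
  have : pw Γ u u' l = ev Γ (l.map fun b => (cond b u u', true)) := by
    unfold pw ev
    rw [List.map_map]
    congr 2
    ext b
    cases b <;> rfl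
  rw [this]
  simpa using nd_le_length x (l.map fun b => (cond b u u', true))

theorem exists_mul_pow_lt_two_pow (C b : ℕ) : ∃ k : ℕ, C * (k + 1) ^ b < 2 ^ k := by
  have h := (tendsto_pow_const_div_const_pow_of_one_lt b (r := 2) (by norm_num)).comp
    (Filter.tendsto_add_atTop_nat 1)
  have h2 := (h.eventually (gt_mem_nhds (show (0 : ℝ) < 1 / (2 * ((C : ℝ) + 1)) by positivity))).exists
  obtain ⟨k, hk⟩ := h2
  refine ⟨k, ?_⟩
  simp only [Function.comp_apply] at hk
  rw [div_lt_div_iff₀ (by positivity) (by positivity), pow_succ (2 : ℝ) k] at hk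
  have h3 : (0 : ℝ) < ((k + 1 : ℕ) : ℝ) ^ b := by positivity
  have : (C : ℝ) * ((k + 1 : ℕ) : ℝ) ^ b < 2 ^ k := by nlinarith
  exact_mod_cast this

theorem not_subset_of_not_clique [Finite V] [Finite W] {φ : Raag Λ → Raag Γ} {K : ℕ}
    (hφ : QE K φ) {B : Set V} (hB : Γ.IsClique B) {S : Set W} (hS : ¬ Λ.IsClique S)
    (r : ℕ) (h : Raag Γ) (x : Raag Λ) : ¬ φ '' cs Λ x S ⊆ nb r (cs Γ h B) := by
  classical
  intro hsub
  obtain ⟨C, hC⟩ := card_le_of_near hφ hB r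
  obtain ⟨k, hk⟩ := exists_mul_pow_lt_two_pow C B.ncard
  simp only [SimpleGraph.isClique_iff, Set.Pairwise, not_forall] at hS
  obtain ⟨u, hu, u', hu', hne, hadj⟩ := hS
  let F : Finset (Raag Λ) := (Finset.univ : Finset (List.Vector Bool k)).image
    fun l => x * pw Λ u u' l.1
  have h1 : F.card = 2 ^ k := by
    rw [Finset.card_image_of_injective]
    · simp
    · intro l l' e
      exact Subtype.ext (pw_injective hne hadj (mul_left_cancel e))
  have h2 := hC h x k F (by
    intro y hy
    obtain ⟨l, -, rfl⟩ := Finset.mem_image.1 hy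
    refine ⟨(nd_pw u u' x _).trans l.2.le, hsub ⟨_, ?_, rfl⟩⟩
    exact mul_mem_cs (self_mem_cs _ _) (pw_mem hu hu' _))
  omega

theorem exists_box (S : Finset W) (hS : Λ.IsClique (S : Set W)) (k : ℕ) :
    ∃ F : Finset (Raag Λ), F.card = (k + 1) ^ S.card ∧
      ∀ y ∈ F, y ∈ subRaag Λ S ∧ nd 1 y ≤ k * S.card := by
  classical
  induction S using Finset.induction_on with
  | empty => exact ⟨{1}, by simp, by simp [one_mem]⟩
  | insert b B hb ih =>
    rw [Finset.coe_insert] at hS ⊢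
    obtain ⟨F, h1, h2⟩ := ih (hS.subset (by simp))
    refine ⟨(F ×ˢ Finset.range (k + 1)).image fun p => p.1 * raagGen Λ b ^ p.2, ?_, ?_⟩
    · rw [Finset.card_image_of_injOn, Finset.card_product, h1, Finset.card_range,
        Finset.card_insert_of_notMem hb, pow_succ]
      rintro ⟨a, j⟩ hp ⟨a', j'⟩ hp' e
      simp only [Finset.coe_product, Set.mem_prod, Finset.mem_coe] at hp hp' e
      have h3 := congrArg (ex b) e
      rw [ex_mul, ex_mul, ex_eq_zero (by simpa using hb) (h2 a hp.1).1,
        ex_eq_zero (by simpa using hb) (h2 a' hp'.1).1] at h3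
      simp only [ex_pow, ex_gen_self, mul_one, zero_add, Nat.cast_inj] at h3
      subst h3
      rw [mul_left_inj] at e
      rw [e]
    · intro y hy
      obtain ⟨⟨a, j⟩, hp, rfl⟩ := Finset.mem_image.1 hy
      simp only [Finset.mem_product, Finset.mem_range] at hp
      obtain ⟨h3, h4⟩ := h2 a hp.1
      refine ⟨mul_mem (subRaag_mono (by simp) h3) (gen_pow_mem (by simp) _), ?_⟩
      have h5 := nd_triangle 1 a (a * raagGen Λ b ^ j)
      have h6 := nd_gen_pow a b j
      rw [Finset.card_insert_of_notMem hb, mul_add, mul_one]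
      dsimp only
      omega

theorem not_subset_of_card_lt [Finite V] [Finite W] {φ : Raag Λ → Raag Γ} {K : ℕ}
    (hφ : QE K φ) {B : Set V} (hB : Γ.IsClique B) {S : Set W} (hS : Λ.IsClique S)
    (hlt : B.ncard < S.ncard)
    (r : ℕ) (h : Raag Γ) (x : Raag Λ) : ¬ φ '' cs Λ x S ⊆ nb r (cs Γ h B) := by
  classical
  intro hsub
  obtain ⟨C, hC⟩ := card_le_of_near hφ hB r
  have hf := Set.toFinite S
  set s := S.ncard with hs
  set b := B.ncard with hb
  set k := C * (s + 1) ^ b with hk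
  obtain ⟨F, h1, h2⟩ := exists_box hf.toFinset (by simpa using hS) k
  rw [← Set.ncard_eq_toFinset_card S hf, ← hs] at h1 h2
  have h3 := hC h x (k * s) (F.image (x * ·)) (by
    intro y hy
    obtain ⟨a, ha, rfl⟩ := Finset.mem_image.1 hy
    obtain ⟨h4, h5⟩ := h2 a ha
    refine ⟨?_, hsub ⟨_, mul_mem_cs (self_mem_cs _ _) (by simpa using h4), rfl⟩⟩
    rw [← nd_mul_left x, mul_one] at h5
    exact h5)
  rw [Finset.card_image_of_injective _ (mul_right_injective x), h1] at h3
  have h4 : (k + 1) ^ (b + 1) ≤ (k + 1) ^ s := Nat.pow_le_pow_right (by omega) (by omega)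
  have h5 : C * (k * s + 1) ^ b ≤ C * ((s + 1) * (k + 1)) ^ b := by gcongr; nlinarith
  rw [mul_pow, ← mul_assoc, ← hk] at h5
  rw [pow_succ] at h4
  have h6 : 0 < (k + 1) ^ b := by positivity
  nlinarith

end Cosets

/-! ### Sides of a coset via amalgamated product normal forms -/

section Side

open Monoid Monoid.PushoutI

/-- In normal forms of an amalgamated product, the sequence of factor indices changes by at most
the insertion or deletion of a first entry under multiplication by an element of a factor. -/
theorem idx_of_smul {ι : Type*} {G : ι → Type*} {H : Type*} [∀ i, Group (G i)] [Group H]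
    {φ : ∀ i, H →* G i} {d : NormalWord.Transversal φ} [DecidableEq ι] [∀ i, DecidableEq (G i)]
    (w : NormalWord d) (i : ι) (g : G i) :
    (of (φ := φ) i g • w).toList.map Sigma.fst = w.toList.map Sigma.fst ∨
    (of (φ := φ) i g • w).toList.map Sigma.fst = i :: w.toList.map Sigma.fst ∨
    w.toList.map Sigma.fst = i :: (of (φ := φ) i g • w).toList.map Sigma.fst := by
  have key : ∀ (i : ι) (g : G i) (w : NormalWord d), w.fstIdx ≠ some i →
      (of (φ := φ) i g • w).toList.map Sigma.fst = w.toList.map Sigma.fst ∨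
      (of (φ := φ) i g • w).toList.map Sigma.fst = i :: w.toList.map Sigma.fst := by
    intro i g w hw
    by_cases hg : g ∈ (φ i).range
    · obtain ⟨h, rfl⟩ := hg
      left
      rw [of_apply_eq_base]
      rfl
    · right
      rw [← NormalWord.cons_eq_smul g w hw hg]
      simp
  induction w using NormalWord.consRecOn generalizing i g with
  | empty =>
    rcases key i g NormalWord.empty (by simp [CoprodI.Word.fstIdx, NormalWord.empty, CoprodI.Word.empty]) with h | h
    · exact Or.inl h
    · exact Or.inr (Or.inl h)
  | cons j g' w' hmw hgn hgr hw1 ih =>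
    by_cases hij : j = i
    · subst hij
      have h1 : of (φ := φ) j g • NormalWord.cons g' w' hmw hgr = of (φ := φ) j (g * g') • w' := by
        rw [NormalWord.cons_eq_smul, map_mul, mul_smul]
      have h2 : (NormalWord.cons g' w' hmw hgr).toList.map Sigma.fst
          = j :: w'.toList.map Sigma.fst := by simp
      rw [h1, h2]
      rcases key j (g * g') w' hmw with h | h
      · right; right; rw [h]
      · left; exact h
    · have h3 : (NormalWord.cons g' w' hmw hgr).fstIdx ≠ some i := by
        simp [CoprodI.Word.fstIdx, hij]
      rcases key i g _ h3 with h | h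
      · exact Or.inl h
      · exact Or.inr (Or.inl h)
  | base h w hw1 ih =>
    have h1 : of (φ := φ) i g • base φ h • w = of (φ := φ) i (g * φ i h) • w := by
      rw [map_mul, mul_smul, of_apply_eq_base]
    rw [h1]
    exact ih i (g * φ i h)

variable {V : Type} {Γ : SimpleGraph V} {T : Set V}

/-- Vertices are identified when they lie in one component of `Γ - T`. -/
def Cmp (Γ : SimpleGraph V) (T : Set V) : Type :=
  Quot fun a b => Γ.Adj a b ∧ a ∉ T ∧ b ∉ T

/-- The component of a vertex in `Γ - T`. -/
def cmp (Γ : SimpleGraph V) (T : Set V) (a : V) : Cmp Γ T := Quot.mk _ a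

theorem cmp_eq_of_adj {a b : V} (h : Γ.Adj a b) (ha : a ∉ T) (hb : b ∉ T) :
    cmp Γ T a = cmp Γ T b := Quot.sound ⟨h, ha, hb⟩

/-- The vertices of `T` together with one component of `Γ - T`. -/
def factor (T : Set V) (i : Cmp Γ T) : Set V := T ∪ {a | cmp Γ T a = i}

/-- The inclusion of the amalgamated subgroup in a factor. -/
def incl (Γ : SimpleGraph V) (T : Set V) (i : Cmp Γ T) :
    subRaag Γ T →* subRaag Γ (factor T i) :=
  Subgroup.inclusion (subRaag_mono Set.subset_union_left)

/-- The generators in the amalgamated product. -/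
def toPushoutGen (Γ : SimpleGraph V) (T : Set V) (s : V) : PushoutI (incl Γ T) :=
  of (cmp Γ T s) ⟨raagGen Γ s, gen_mem (Or.inr rfl)⟩

theorem toPushoutGen_eq {s : V} (i : Cmp Γ T) (h : s ∈ factor T i) :
    toPushoutGen Γ T s = of i ⟨raagGen Γ s, gen_mem h⟩ := by
  have hb : ∀ j (hs : s ∈ T) (hj : s ∈ factor T j), (of j ⟨raagGen Γ s, gen_mem hj⟩ :
      PushoutI (incl Γ T)) = base (incl Γ T) ⟨raagGen Γ s, gen_mem hs⟩ := by
    intro j hs hj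
    rw [← of_apply_eq_base (incl Γ T) j]
    rfl
  by_cases hs : s ∈ T
  · rw [hb i hs h, toPushoutGen, hb _ hs (Or.inl hs)]
  · rcases h with h | h
    · exact absurd h hs
    · obtain rfl : cmp Γ T s = i := h
      rfl

/-- The map from `A(Γ)` to the amalgamated product of its factors over `A(T)`. -/
def toPushout (Γ : SimpleGraph V) (T : Set V) : Raag Γ →* PushoutI (incl Γ T) :=
  PresentedGroup.toGroup (f := toPushoutGen Γ T) (by
    rintro _ ⟨x, y, hxy, rfl⟩
    have : ∃ i, x ∈ factor (Γ := Γ) T i ∧ y ∈ factor T i := by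
      by_cases hx : x ∈ T
      · exact ⟨cmp Γ T y, Or.inl hx, Or.inr rfl⟩
      · by_cases hy : y ∈ T
        · exact ⟨cmp Γ T x, Or.inr rfl, Or.inl hy⟩
        · exact ⟨cmp Γ T x, Or.inr rfl, Or.inr (cmp_eq_of_adj hxy hx hy).symm⟩
    obtain ⟨i, hx, hy⟩ := this
    simp only [map_mul, map_inv, FreeGroup.lift_apply_of]
    rw [toPushoutGen_eq i hx, toPushoutGen_eq i hy, ← map_mul, ← map_inv, ← map_mul, ← map_inv,
      ← map_mul]
    refine (congrArg (of i) (Subtype.ext ?_)).trans (map_one (of i))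
    simp [(gen_comm hxy).eq])

theorem toPushout_gen (s : V) : toPushout Γ T (raagGen Γ s) = toPushoutGen Γ T s :=
  PresentedGroup.toGroup.of _

theorem subtype_comp_incl (i : Cmp Γ T) :
    (subRaag Γ (factor T i)).subtype.comp (incl Γ T i) = (subRaag Γ T).subtype :=
  MonoidHom.ext fun _ => rfl

/-- The map back from the amalgamated product. -/
def fromPushout (Γ : SimpleGraph V) (T : Set V) : PushoutI (incl Γ T) →* Raag Γ :=
  lift (fun i => (subRaag Γ (factor T i)).subtype) (subRaag Γ T).subtype subtype_comp_incl

theorem fromPushout_toPushout (x : Raag Γ) : fromPushout Γ T (toPushout Γ T x) = x := by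
  have : (fromPushout Γ T).comp (toPushout Γ T) = MonoidHom.id _ := by
    apply PresentedGroup.ext
    intro s
    change fromPushout Γ T (toPushout Γ T (raagGen Γ s)) = raagGen Γ s
    rw [toPushout_gen, toPushoutGen, fromPushout, lift_of]
    rfl
  exact DFunLike.congr_fun this x

theorem toPushout_mem {x : Raag Γ} (hx : x ∈ subRaag Γ T) :
    toPushout Γ T x = base (incl Γ T) ⟨x, hx⟩ := by
  induction hx using Subgroup.closure_induction with
  | mem x h =>
    obtain ⟨t, ht, rfl⟩ := h
    rw [toPushout_gen, toPushoutGen_eq (cmp Γ T t) (Or.inl ht),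
      ← of_apply_eq_base (incl Γ T) (cmp Γ T t)]
    rfl
  | one => rw [map_one]; exact (map_one _).symm
  | mul x y hx hy h1 h2 => rw [map_mul, h1, h2, ← map_mul]; rfl
  | inv x hx h1 => rw [map_inv, h1, ← map_inv]; rfl

theorem incl_injective (i : Cmp Γ T) : Function.Injective (incl Γ T i) :=
  Subgroup.inclusion_injective _

/-- A choice of transversals. -/
def transv (Γ : SimpleGraph V) (T : Set V) : NormalWord.Transversal (incl Γ T) :=
  Classical.choice (NormalWord.transversal_nonempty _ incl_injective)

open Classical in
/-- The sequence of components visited by an element of `A(Γ)`. -/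
def idx (T : Set V) (x : Raag Γ) : List (Cmp Γ T) :=
  (toPushout Γ T x • (NormalWord.empty : NormalWord (transv Γ T))).toList.map Sigma.fst

theorem idx_eq_nil {x : Raag Γ} : idx T x = [] ↔ x ∈ subRaag Γ T := by
  classical
  constructor
  · intro h
    rw [idx, List.map_eq_nil_iff] at h
    set w := toPushout Γ T x • (NormalWord.empty : NormalWord (transv Γ T)) with hw
    have h1 : w.prod = toPushout Γ T x := by
      rw [hw, NormalWord.prod_smul, NormalWord.prod_empty, mul_one]
    have h2 : w.prod = base _ w.head := by
      have : w.toWord = CoprodI.Word.empty := CoprodI.Word.ext h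
      rw [NormalWord.prod, this]
      simp
    have h3 := fromPushout_toPushout (T := T) x
    rw [← h1, h2, fromPushout, lift_base] at h3
    rw [← h3]
    exact w.head.2
  · intro h
    rw [idx, toPushout_mem h]
    rfl

theorem idx_gen_mul (s : V) (x : Raag Γ) :
    idx T (raagGen Γ s * x) = idx T x ∨ idx T (raagGen Γ s * x) = cmp Γ T s :: idx T x ∨
      idx T x = cmp Γ T s :: idx T (raagGen Γ s * x) := by
  classical
  simp only [idx]
  rw [map_mul, mul_smul, toPushout_gen]
  exact idx_of_smul _ _ _

/-- The side of the coset `A(T)` on which `x` lies, or `none` if it lies in `A(T)`. -/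
def side (T : Set V) (x : Raag Γ) : Option (Cmp Γ T) := (idx T x⁻¹).getLast?

theorem side_eq_none {x : Raag Γ} : side T x = none ↔ x ∈ subRaag Γ T := by
  rw [side, List.getLast?_eq_none_iff, idx_eq_nil, inv_mem_iff]

theorem side_mul_gen {x : Raag Γ} {s : V} (h1 : side T x ≠ none)
    (h2 : side T (x * raagGen Γ s) ≠ none) : side T (x * raagGen Γ s) = side T x := by
  have h := idx_gen_mul (T := T) s (x * raagGen Γ s)⁻¹
  have e : raagGen Γ s * (x * raagGen Γ s)⁻¹ = x⁻¹ := by group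
  rw [e] at h
  simp only [side] at *
  rw [Ne, List.getLast?_eq_none_iff] at h1 h2
  rcases h with h | h | h
  · rw [h]
  · rw [h, List.getLast?_cons_of_ne_nil h2]
  · rw [h, List.getLast?_cons_of_ne_nil h1]

theorem side_mul_ev_singleton {x : Raag Γ} {s : V × Bool} (h1 : x ∉ subRaag Γ T)
    (h2 : x * ev Γ [s] ∉ subRaag Γ T) : side T (x * ev Γ [s]) = side T x := by
  rw [← side_eq_none] at h1 h2
  rcases s with ⟨s, _ | _⟩
  · rw [ev_false] at *
    have := side_mul_gen (s := s) h2 (by simpa using h1)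
    rw [← this]
    simp
  · rw [ev_true] at *
    exact side_mul_gen h1 h2

theorem side_exit_gen {t : Raag Γ} (ht : t ∈ subRaag Γ T) {s : V} (hs : s ∉ T) :
    side T (t * raagGen Γ s) = some (cmp Γ T s) ∧
      side T (t * (raagGen Γ s)⁻¹) = some (cmp Γ T s) := by
  have h0 : ∀ a : Raag Γ, a ∈ subRaag Γ T → idx T a = [] := fun a ha => idx_eq_nil.2 ha
  have hns : raagGen Γ s ∉ subRaag Γ T := fun h => by
    have := ex_eq_zero hs h
    simp at this
  constructor
  · have h := idx_gen_mul (T := T) s (t * raagGen Γ s)⁻¹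
    have e : raagGen Γ s * (t * raagGen Γ s)⁻¹ = t⁻¹ := by group
    rw [e, h0 _ (inv_mem ht)] at h
    rw [side]
    rcases h with h | h | h
    · have := idx_eq_nil.1 h.symm
      rw [inv_mem_iff, Subgroup.mul_mem_cancel_left _ ht] at this
      exact absurd this hns
    · simp at h
    · rw [h]; simp
  · have h := idx_gen_mul (T := T) s t⁻¹
    have e : (t * (raagGen Γ s)⁻¹)⁻¹ = raagGen Γ s * t⁻¹ := by group
    rw [h0 _ (inv_mem ht)] at h
    rw [side, e]
    rcases h with h | h | h
    · have := idx_eq_nil.1 h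
      rw [Subgroup.mul_mem_cancel_right _ (inv_mem ht)] at this
      exact absurd this hns
    · rw [h]; simp
    · simp at h

theorem side_exit {t : Raag Γ} (ht : t ∈ subRaag Γ T) {s : V × Bool} (hs : s.1 ∉ T) :
    side T (t * ev Γ [s]) = some (cmp Γ T s.1) := by
  rcases s with ⟨s, _ | _⟩
  · rw [ev_false]; exact (side_exit_gen ht hs).2
  · rw [ev_true]; exact (side_exit_gen ht hs).1

/-- The last exit of a path from the subgroup `A(T)`. -/
theorem exists_last_exit {x : Raag Γ} {l : List (V × Bool)} (hx : x ∈ subRaag Γ T)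
    (hl : x * ev Γ l ∉ subRaag Γ T) : ∃ l₁ s l₂, l = l₁ ++ s :: l₂ ∧ x * ev Γ l₁ ∈ subRaag Γ T ∧
      s.1 ∉ T ∧ side T (x * ev Γ l) = some (cmp Γ T s.1) ∧
      ∀ l', l' <+: l₂ → x * ev Γ (l₁ ++ s :: l') ∉ subRaag Γ T := by
  induction l using List.reverseRecOn with
  | nil => simp [hx] at hl
  | append_singleton l s ih =>
    rw [ev_append, ← mul_assoc] at hl
    by_cases h : x * ev Γ l ∈ subRaag Γ T
    · have hs : s.1 ∉ T := by
        intro hs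
        refine hl (mul_mem h (ev_mem ?_))
        simpa using hs
      refine ⟨l, s, [], rfl, h, hs, ?_, ?_⟩
      · rw [ev_append, ← mul_assoc]
        exact side_exit h hs
      · intro l' hl'
        rw [List.prefix_nil] at hl'
        subst hl'
        rwa [ev_append, ← mul_assoc]
    · obtain ⟨l₁, s', l₂, rfl, h2, h3, h4, h5⟩ := ih h
      refine ⟨l₁, s', l₂ ++ [s], by simp, h2, h3, ?_, ?_⟩
      · rw [← h4, ev_append, ← mul_assoc]
        exact side_mul_ev_singleton h hl
      · intro l' hl'
        rcases List.prefix_concat_iff.1 hl' with rfl | h6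
        · have : x * ev Γ (l₁ ++ s' :: l₂ ++ [s]) ∉ subRaag Γ T := by
            rwa [ev_append, ← mul_assoc]
          simpa using this
        · exact h5 l' h6

theorem side_path {x : Raag Γ} {l : List (V × Bool)}
    (h : ∀ l', l' <+: l → x * ev Γ l' ∉ subRaag Γ T) : side T (x * ev Γ l) = side T x := by
  induction l using List.reverseRecOn with
  | nil => simp
  | append_singleton l s ih =>
    have h1 := h (l ++ [s]) (List.prefix_refl _)
    have h2 := h l (List.prefix_append _ _)
    rw [← ih fun l' hl' => h l' (hl'.trans (List.prefix_append _ _))]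
    rw [ev_append, ← mul_assoc] at *
    exact side_mul_ev_singleton h2 h1

theorem side_mul_left {t : Raag Γ} (ht : t ∈ subRaag Γ T) (x : Raag Γ) :
    side T (t * x) = side T x := by
  by_cases hx : x ∈ subRaag Γ T
  · rw [side_eq_none.2 hx, side_eq_none.2 (mul_mem ht hx)]
  · obtain ⟨l, rfl⟩ := ev_surjective x
    obtain ⟨l₁, s, l₂, rfl, h2, h3, h4, h5⟩ := exists_last_exit (one_mem (subRaag Γ T))
      (l := l) (by rwa [one_mul])
    simp only [one_mul] at h2 h4 h5
    rw [h4]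
    have e : ∀ l', t * ev Γ (l₁ ++ s :: l') = t * ev Γ l₁ * ev Γ [s] * ev Γ l' := by
      intro l'
      rw [ev_append, ev_cons s l']
      simp only [mul_assoc]
    rw [e, side_path]
    · exact side_exit (mul_mem ht h2) h3
    · intro l' hl'
      rw [← e, Subgroup.mul_mem_cancel_left _ ht]
      exact h5 l' hl'

/-- The side of the coset `h A(T)` on which `x` lies. -/
def lside (h : Raag Γ) (T : Set V) (x : Raag Γ) : Option (Cmp Γ T) := side T (h⁻¹ * x)

theorem lside_eq_none {h x : Raag Γ} : lside h T x = none ↔ x ∈ cs Γ h T := side_eq_none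

theorem lside_congr {h h' : Raag Γ} (hh : h' ∈ cs Γ h T) (x : Raag Γ) :
    lside h' T x = lside h T x := by
  have : h⁻¹ * x = (h⁻¹ * h') * (h'⁻¹ * x) := by group
  rw [lside, lside, this, side_mul_left hh]

theorem lside_exit {h t : Raag Γ} (ht : t ∈ cs Γ h T) {s : V × Bool} (hs : s.1 ∉ T) :
    lside h T (t * ev Γ [s]) = some (cmp Γ T s.1) := by
  rw [lside, ← mul_assoc]; exact side_exit ht hs

theorem lside_path {h x : Raag Γ} {l : List (V × Bool)}
    (hl : ∀ l', l' <+: l → x * ev Γ l' ∉ cs Γ h T) : lside h T (x * ev Γ l) = lside h T x := by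
  rw [lside, ← mul_assoc]
  refine side_path fun l' hl' => ?_
  have := hl l' hl'
  rwa [mem_cs, ← mul_assoc] at this

theorem exists_last_exit' {h x : Raag Γ} {l : List (V × Bool)} (hx : x ∈ cs Γ h T)
    (hl : x * ev Γ l ∉ cs Γ h T) : ∃ l₁ s l₂, l = l₁ ++ s :: l₂ ∧ x * ev Γ l₁ ∈ cs Γ h T ∧
      s.1 ∉ T ∧ lside h T (x * ev Γ l) = some (cmp Γ T s.1) ∧
      ∀ l', l' <+: l₂ → x * ev Γ (l₁ ++ s :: l') ∉ cs Γ h T := by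
  simp only [mem_cs, lside, ← mul_assoc] at *
  exact exists_last_exit hx hl

/-- A path changing sides of a coset meets the coset. -/
theorem exists_crossing {h x y : Raag Γ} (hxy : lside h T x ≠ lside h T y) :
    ∃ z ∈ cs Γ h T, nd x z + nd z y ≤ nd x y := by
  obtain ⟨l, h1, rfl⟩ := nd_spec x y
  by_contra! hcon
  apply hxy
  rw [lside_path]
  rintro l' ⟨l'', rfl⟩ hmem
  have h2 := hcon _ hmem
  have h3 := nd_le_length x l'
  have h4 := nd_le_length (x * ev Γ l') l''
  rw [ev_append, ← mul_assoc] at h1 h2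
  rw [List.length_append] at h1
  omega

theorem lside_eq_of_not_mem_nb {h x y : Raag Γ} {r : ℕ} (hx : x ∉ nb r (cs Γ h T))
    (hxy : nd x y ≤ r) : lside h T x = lside h T y := by
  by_contra hne
  obtain ⟨z, hz, hd⟩ := exists_crossing hne
  exact hx ⟨z, hz, by omega⟩

end Side

/-! ### Blocks of a graph -/

section Graph

variable {V : Type} {Γ : SimpleGraph V} {T B : Set V}

theorem cmp_mono {T' : Set V} (h : T ⊆ T') {a b : V} (hab : cmp Γ T' a = cmp Γ T' b) :
    cmp Γ T a = cmp Γ T b := by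
  let F : Cmp Γ T' → Cmp Γ T := Quot.lift (cmp Γ T) fun x y hxy =>
    cmp_eq_of_adj hxy.1 (fun hx => hxy.2.1 (h hx)) (fun hx => hxy.2.2 (h hx))
  exact congrArg F hab

theorem cmp_eq_of_walk {a b : V} (p : Γ.Walk a b) (hp : ∀ x ∈ p.support, x ∉ T) :
    cmp Γ T a = cmp Γ T b := by
  induction p with
  | nil => rfl
  | cons h p ih =>
    simp only [SimpleGraph.Walk.support_cons, List.mem_cons, forall_eq_or_imp] at hp
    exact (cmp_eq_of_adj h hp.1 (hp.2 _ p.start_mem_support)).trans (ih hp.2)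

theorem exists_walk_of_cmp_eq {a b : V} (h : cmp Γ T a = cmp Γ T b) :
    a = b ∨ ∃ p : Γ.Walk a b, ∀ x ∈ p.support, x ∉ T := by
  have := Quot.eqvGen_exact h
  clear h
  induction this with
  | rel x y h =>
    refine Or.inr ⟨.cons h.1 .nil, ?_⟩
    simp [h.2.1, h.2.2]
  | refl x => exact Or.inl rfl
  | symm x y h ih =>
    rcases ih with rfl | ⟨p, hp⟩
    · exact Or.inl rfl
    · exact Or.inr ⟨p.reverse, by simpa using hp⟩
  | trans x y z h h' ih ih' =>
    rcases ih with rfl | ⟨p, hp⟩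
    · exact ih'
    · rcases ih' with rfl | ⟨q, hq⟩
      · exact Or.inr ⟨p, hp⟩
      · refine Or.inr ⟨p.append q, fun x hx => ?_⟩
        rcases (SimpleGraph.Walk.mem_support_append_iff _ _).1 hx with h | h
        · exact hp x h
        · exact hq x h

theorem exists_path_of_cmp_eq {a b : V} (ha : a ∉ T) (h : cmp Γ T a = cmp Γ T b) :
    ∃ p : Γ.Walk a b, p.IsPath ∧ ∀ x ∈ p.support, x ∉ T := by
  classical
  rcases exists_walk_of_cmp_eq h with rfl | ⟨p, hp⟩
  · exact ⟨.nil, by simp, by simpa using ha⟩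
  · exact ⟨p.bypass, p.bypass_isPath, fun x hx => hp x (p.support_bypass_subset_support hx)⟩

theorem preconnected_induce_iff {S : Set V} :
    (Γ.induce S).Preconnected ↔ ∀ a ∈ S, ∀ b ∈ S, cmp Γ Sᶜ a = cmp Γ Sᶜ b := by
  constructor
  · intro h a ha b hb
    obtain ⟨p⟩ := h ⟨a, ha⟩ ⟨b, hb⟩
    refine cmp_eq_of_walk (p.map (SimpleGraph.Embedding.induce S).toHom) fun x hx => ?_
    have hx' := (congrArg (x ∈ ·) (SimpleGraph.Walk.support_map _ p)).mp hx
    obtain ⟨y, -, rfl⟩ := List.mem_map.1 hx'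
    exact fun h => h y.2
  · rintro h ⟨a, ha⟩ ⟨b, hb⟩
    rcases exists_walk_of_cmp_eq (h a ha b hb) with rfl | ⟨p, hp⟩
    · rfl
    · exact ⟨p.induce S fun x hx => by simpa using hp x hx⟩

theorem cutVertex_iff {v : V} :
    CutVertex Γ v ↔ ∃ a b, a ≠ v ∧ b ≠ v ∧ cmp Γ {v} a ≠ cmp Γ {v} b := by
  rw [CutVertex, preconnected_induce_iff]
  have : ({u | u ≠ v} : Set V)ᶜ = {v} := by ext; simp
  rw [this]
  push Not
  simp only [Set.mem_ofPred_eq]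
  grind

theorem biconn_iff {S : Set V} : Biconn Γ S ↔ S.Nonempty ∧
    (∀ a ∈ S, ∀ b ∈ S, cmp Γ Sᶜ a = cmp Γ Sᶜ b) ∧
    ∀ x ∈ S, ∀ a ∈ S, a ≠ x → ∀ b ∈ S, b ≠ x → cmp Γ (S \ {x})ᶜ a = cmp Γ (S \ {x})ᶜ b := by
  rw [Biconn, SimpleGraph.connected_iff, preconnected_induce_iff]
  simp only [preconnected_induce_iff, Set.nonempty_coe_sort]
  simp only [Set.mem_sdiff, Set.mem_singleton_iff]
  grind

theorem _root_.Biconn.cmp_eq {S : Set V} (h : Biconn Γ S) {z a b : V} (ha : a ∈ S) (hb : b ∈ S)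
    (haz : a ≠ z) (hbz : b ≠ z) : cmp Γ (S \ {z})ᶜ a = cmp Γ (S \ {z})ᶜ b := by
  rw [biconn_iff] at h
  by_cases hz : z ∈ S
  · exact h.2.2 z hz a ha haz b hb hbz
  · rw [Set.sdiff_singleton_eq_self hz]
    exact h.2.1 a ha b hb

/-- A block minus a vertex `v` lies in one component of `Γ - v`. -/
theorem _root_.Biconn.cmp_singleton_eq {S : Set V} (h : Biconn Γ S) {z a b : V} (ha : a ∈ S) (hb : b ∈ S)
    (haz : a ≠ z) (hbz : b ≠ z) : cmp Γ {z} a = cmp Γ {z} b :=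
  cmp_mono (by simp) (h.cmp_eq ha hb haz hbz)

theorem _root_.Biconn.of_isClique {S : Set V} (hS : Γ.IsClique S) (hne : S.Nonempty) : Biconn Γ S := by
  have key : ∀ S' ⊆ S, ∀ a ∈ S', ∀ b ∈ S', cmp Γ S'ᶜ a = cmp Γ S'ᶜ b := by
    intro S' h a ha b hb
    by_cases hab : a = b
    · rw [hab]
    · exact cmp_eq_of_adj (hS (h ha) (h hb) hab) (by simpa) (by simpa)
  refine biconn_iff.2 ⟨hne, key S subset_rfl, fun x hx a ha hax b hb hbx => ?_⟩
  exact key _ Set.sdiff_subset a ⟨ha, hax⟩ b ⟨hb, hbx⟩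

theorem _root_.Biconn.exists_maxBiconn [Finite V] {S : Set V} (h : Biconn Γ S) :
    ∃ B, S ⊆ B ∧ MaxBiconn Γ B := by
  obtain ⟨B, hB, hm⟩ := (Set.toFinite {S | Biconn Γ S}).exists_le_maximal h
  exact ⟨B, hB, hm.prop, fun T hT hBT => (hm.eq_of_le hT hBT)⟩

theorem exists_block_of_isClique [Finite V] {S : Set V} (hS : Γ.IsClique S) (hne : S.Nonempty) :
    ∃ B, S ⊆ B ∧ MaxBiconn Γ B :=
  (Biconn.of_isClique hS hne).exists_maxBiconn

theorem isClique_pair {u v : V} (h : Γ.Adj u v) : Γ.IsClique {u, v} := by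
  rintro a (rfl | rfl) b (rfl | rfl) hab
  · exact absurd rfl hab
  · exact h
  · exact h.symm
  · exact absurd rfl hab

theorem exists_block_of_adj [Finite V] {u v : V} (h : Γ.Adj u v) :
    ∃ B, u ∈ B ∧ v ∈ B ∧ MaxBiconn Γ B := by
  obtain ⟨B, h1, h2⟩ := exists_block_of_isClique (isClique_pair h) ⟨u, Or.inl rfl⟩
  exact ⟨B, h1 (Or.inl rfl), h1 (Or.inr rfl), h2⟩

/-- A vertex outside a block is separated from it by some vertex. -/
theorem _root_.MaxBiconn.exists_sep (hB : MaxBiconn Γ B) {s : V} (hs : s ∉ B) :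
    ∃ z, z ≠ s ∧ ∀ b ∈ B, b ≠ z → cmp Γ {z} s ≠ cmp Γ {z} b := by
  classical
  by_contra! hcon
  set T : Set V := {x | ∀ z, z ≠ x → ∃ b ∈ B, b ≠ z ∧ cmp Γ {z} x = cmp Γ {z} b} with hT
  have hBT : B ⊆ T := fun x hx z hz => ⟨x, hx, hz.symm, rfl⟩
  have hsT : s ∈ T := fun z hz => hcon z hz
  have key : ∀ x ∈ T, ∀ z, z ≠ x → ∃ b ∈ B, b ≠ z ∧ cmp Γ (T \ {z})ᶜ x = cmp Γ (T \ {z})ᶜ b := by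
    intro x hx z hz
    obtain ⟨b, hb, hbz, h⟩ := hx z hz
    refine ⟨b, hb, hbz, ?_⟩
    obtain ⟨p, hp, hps⟩ := exists_path_of_cmp_eq (by simpa using hz.symm) h
    refine cmp_eq_of_walk p fun y hy => ?_
    simp only [Set.mem_compl_iff, Set.mem_sdiff, not_not]
    refine ⟨fun w hw => ?_, hps y hy⟩
    by_cases hw2 : w ∈ (p.dropUntil y hy).support
    · have hw1 : w ∉ (p.takeUntil y hy).support := by
        intro hw1
        have hnd := hp.support_nodup
        rw [← p.take_spec hy, SimpleGraph.Walk.support_append] at hnd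
        refine (List.nodup_append'.1 hnd).2.2 hw1 ?_
        rw [← SimpleGraph.Walk.cons_tail_support, List.mem_cons] at hw2
        exact hw2.resolve_left hw
      have e1 : cmp Γ {w} x = cmp Γ {w} y :=
        cmp_eq_of_walk (p.takeUntil y hy) fun u hu => by
          rintro rfl; exact hw1 hu
      obtain ⟨b', h1, h2, h3⟩ := hx w (by
        rintro rfl; exact hw1 (SimpleGraph.Walk.start_mem_support _))
      exact ⟨b', h1, h2, e1.symm.trans h3⟩
    · refine ⟨b, hb, ?_, cmp_eq_of_walk (p.dropUntil y hy) fun u hu => ?_⟩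
      · rintro rfl; exact hw2 (SimpleGraph.Walk.end_mem_support _)
      · rintro rfl; exact hw2 hu
  have key2 : ∀ z, ∀ a ∈ T, a ≠ z → ∀ b ∈ T, b ≠ z → cmp Γ (T \ {z})ᶜ a = cmp Γ (T \ {z})ᶜ b := by
    intro z a ha haz b hb hbz
    obtain ⟨a', h1, h2, h3⟩ := key a ha z haz.symm
    obtain ⟨b', h1', h2', h3'⟩ := key b hb z hbz.symm
    rw [h3, h3']
    exact cmp_mono (by gcongr) (hB.1.cmp_eq h1 h1' h2 h2')
  have hTb : Biconn Γ T := by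
    obtain ⟨b0, hb0⟩ := (biconn_iff.1 hB.1).1
    refine biconn_iff.2 ⟨⟨b0, hBT hb0⟩, ?_, fun x _ a ha hax b hb hbx => key2 x a ha hax b hb hbx⟩
    have h0 : ∀ a ∈ T, cmp Γ Tᶜ a = cmp Γ Tᶜ b0 := by
      intro a ha
      by_cases hab : a = b0
      · rw [hab]
      obtain ⟨b, h1, h2, h3⟩ := key a ha b0 (Ne.symm hab)
      refine (cmp_mono ?_ h3).trans (cmp_mono ?_ ((biconn_iff.1 hB.1).2.1 b h1 b0 hb0))
      · exact Set.compl_subset_compl.2 Set.sdiff_subset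
      · exact Set.compl_subset_compl.2 hBT
    intro a ha b hb
    rw [h0 a ha, h0 b hb]
  exact hs (hB.2 T hTb hBT ▸ hsT)

/-- The gate of a vertex outside a block. -/
theorem _root_.MaxBiconn.exists_gate (hΓ : Γ.Connected) (hB : MaxBiconn Γ B) {s : V} (hs : s ∉ B) :
    ∃ v ∈ B, ∀ b ∈ B, b ≠ v → cmp Γ {v} s ≠ cmp Γ {v} b := by
  obtain ⟨b0, hb0⟩ := (biconn_iff.1 hB.1).1
  obtain ⟨p⟩ := hΓ.preconnected s b0
  induction p with
  | nil => exact absurd hb0 hs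
  | @cons s s' _ h p ih =>
    by_cases hs' : s' ∈ B
    · obtain ⟨z, hz, hsep⟩ := hB.exists_sep hs
      by_cases hzs : s' = z
      · exact ⟨z, hzs ▸ hs', hsep⟩
      · exact absurd (cmp_eq_of_adj h (by simpa using hz.symm) (by simpa using hzs))
          (hsep s' hs' hzs)
    · obtain ⟨v, hv, hsep⟩ := ih hs' hb0
      refine ⟨v, hv, fun b hb hbv => ?_⟩
      rw [cmp_eq_of_adj h (by rintro rfl; exact hs hv) (by rintro rfl; exact hs' hv)]
      exact hsep b hb hbv

/-- Every component of `Γ - v` contains a neighbour of `v`. -/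
theorem exists_adj_cmp_eq (hΓ : Γ.Connected) {v a : V} (ha : a ≠ v) :
    ∃ s, Γ.Adj v s ∧ cmp Γ {v} s = cmp Γ {v} a := by
  obtain ⟨p⟩ := hΓ.preconnected a v
  induction p with
  | nil => exact absurd rfl ha
  | @cons a a' v h p ih =>
    by_cases hv : a' = v
    · subst hv; exact ⟨a, h.symm, rfl⟩
    · obtain ⟨s, h1, h2⟩ := ih hv
      exact ⟨s, h1, h2.trans (cmp_eq_of_adj h (by simpa) (by simpa)).symm⟩

theorem _root_.CutVertex.exists_adj (hΓ : Γ.Connected) {u v : V} (hu : CutVertex Γ u) :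
    ∃ a, Γ.Adj u a ∧ cmp Γ {u} a ≠ cmp Γ {u} v := by
  obtain ⟨a, b, ha, hb, hab⟩ := cutVertex_iff.1 hu
  by_cases h : cmp Γ {u} a = cmp Γ {u} v
  · obtain ⟨s, h1, h2⟩ := exists_adj_cmp_eq hΓ hb
    exact ⟨s, h1, fun h3 => hab (h.trans (h3.symm.trans h2))⟩
  · obtain ⟨s, h1, h2⟩ := exists_adj_cmp_eq hΓ ha
    exact ⟨s, h1, fun h3 => h (h2.symm.trans h3)⟩

theorem _root_.MaxBiconn.adj_mem_of_not_cutVertex (hΓ : Γ.Connected) (hB : MaxBiconn Γ B) {x y s : V}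
    (hx : x ∈ B) (hy : y ∈ B) (hxy : x ≠ y) (hcut : ¬ CutVertex Γ x) (hs : Γ.Adj x s) :
    s ∈ B := by
  by_contra hsB
  obtain ⟨v, hv, hsep⟩ := hB.exists_gate hΓ hsB
  by_cases hxv : x = v
  · subst hxv
    exact hcut (cutVertex_iff.2 ⟨s, y, hs.ne', hxy.symm, hsep y hy hxy.symm⟩)
  · refine hsep x hx hxv (cmp_eq_of_adj hs.symm ?_ (by simpa))
    rintro rfl; exact hsB hv

theorem exists_adj_of_cmp_eq {a b : V} (hab : a ≠ b) (h : cmp Γ T a = cmp Γ T b) :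
    ∃ c, Γ.Adj a c ∧ c ∉ T := by
  rcases exists_walk_of_cmp_eq h with rfl | ⟨p, hp⟩
  · exact absurd rfl hab
  · cases p with
    | nil => exact absurd rfl hab
    | cons h p => exact ⟨_, h, hp _ (by simp)⟩

/-- Vertices of a biconnected set with at least three vertices have two neighbours in the set. -/
theorem _root_.Biconn.exists_two_adj {S : Set V} (hS : Biconn Γ S) (hc : 3 ≤ S.ncard) {x : V}
    (hx : x ∈ S) : ∃ y ∈ S, ∃ z ∈ S, y ≠ z ∧ Γ.Adj x y ∧ Γ.Adj x z := by
  have hf : S.Finite := Set.finite_of_ncard_pos (by omega)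
  have ex : ∀ y, ∃ z ∈ S, z ≠ x ∧ z ≠ y := by
    intro y
    by_contra! h
    have : S ⊆ {x, y} := fun z hz => by
      by_cases hzx : z = x
      · exact Or.inl hzx
      · exact Or.inr (h z hz hzx)
    have h1 := Set.ncard_le_ncard this
    have h2 := Set.ncard_insert_le x {y}
    rw [Set.ncard_singleton] at h2
    omega
  obtain ⟨w, hw, hwx, -⟩ := ex x
  obtain ⟨y, hy, hyS⟩ := exists_adj_of_cmp_eq hwx.symm ((biconn_iff.1 hS).2.1 x hx w hw)
  obtain ⟨w', hw', hwx', hwy'⟩ := ex y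
  obtain ⟨z, hz, hzS⟩ := exists_adj_of_cmp_eq hwx'.symm (hS.cmp_eq hx hw' hy.ne hwy')
  simp only [Set.mem_compl_iff, not_not] at hyS hzS
  exact ⟨y, hyS, z, hzS.1, fun h => hzS.2 h.symm, hy, hz⟩

/-- Three consecutive edges around an edge between cut vertices. -/
theorem three_le_dist (hΓ : Γ.Connected) {a u v b : V} (hau : Γ.Adj u a) (huv : Γ.Adj u v)
    (hvb : Γ.Adj v b) (h1 : cmp Γ {u} a ≠ cmp Γ {u} v) (h2 : cmp Γ {v} b ≠ cmp Γ {v} u) :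
    3 ≤ Γ.dist a b ∧ a ≠ v ∧ b ≠ u ∧ ¬ Γ.Adj a v ∧ ¬ Γ.Adj b u := by
  have hav : a ≠ v := by rintro rfl; exact h1 rfl
  have hbu : b ≠ u := by rintro rfl; exact h2 rfl
  have hb : cmp Γ {u} b = cmp Γ {u} v := cmp_eq_of_adj hvb.symm (by simpa) (by simpa using huv.ne')
  have nbu : ¬ Γ.Adj b u := fun h =>
    h2 (cmp_eq_of_adj h (by simpa using hvb.ne') (by simpa using huv.ne))
  have nav : ¬ Γ.Adj a v := fun h =>
    h1 (cmp_eq_of_adj h (by simpa using hau.ne') (by simpa using huv.ne'))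
  refine ⟨?_, hav, hbu, nav, nbu⟩
  obtain ⟨p, hp⟩ := hΓ.exists_walk_length_eq_dist a b
  rw [← hp]
  by_contra hlt
  cases p with
  | nil => exact h1 hb
  | cons h p =>
    cases p with
    | nil =>
      exact h1 ((cmp_eq_of_adj h (by simpa using hau.ne') (by simpa)).trans hb)
    | @cons _ c _ h' p =>
      cases p with
      | cons _ _ => simp at hlt
      | nil =>
        rename_i c
        by_cases hc : c = u
        · subst hc; exact nbu h'.symm
        · exact h1 (((cmp_eq_of_adj h (by simpa using hau.ne') (by simpa)).trans
            (cmp_eq_of_adj h' (by simpa) (by simpa))).trans hb)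

theorem _root_.NCliqueTreeGraded.exists_edge {n : ℕ} (h : NCliqueTreeGraded Γ n) :
    ∃ u v, Γ.Adj u v ∧ CutVertex Γ u ∧ CutVertex Γ v := by
  obtain ⟨hc, hv, ⟨x, y, hxy⟩, -⟩ := h
  have cut : ∀ a b c, Γ.Adj a b → Γ.Adj a c → b ≠ c → CutVertex Γ a := by
    intro a b c hab hac hbc
    refine (hv a).resolve_right fun ⟨u, _, hu⟩ => hbc ?_
    rw [hu b hab, hu c hac]
  obtain ⟨p, hp⟩ := hc.exists_walk_length_eq_dist x y
  match p, hp with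
  | .cons (v := b) h1 (.cons (v := c) h2 (.cons (v := d) h3 p)), hp =>
    have hpl := hp
    simp only [SimpleGraph.Walk.length_cons] at hpl
    refine ⟨b, c, h2, cut b x c h1.symm h2 ?_, cut c b d h2.symm h3 ?_⟩
    · rintro rfl
      have := SimpleGraph.dist_le (.cons h3 p : Γ.Walk x y)
      simp only [SimpleGraph.Walk.length_cons] at this
      omega
    · rintro rfl
      have := SimpleGraph.dist_le (.cons h1 p : Γ.Walk x y)
      simp only [SimpleGraph.Walk.length_cons] at this
      omega
  | .nil, hp => simp at hxy
  | .cons _ .nil, hp => simp at hp; omega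
  | .cons _ (.cons _ .nil), hp => simp at hp; omega

end Graph

/-! ### Tree-like behaviour of the cosets of blocks -/

section Tree

variable {V : Type} {Γ : SimpleGraph V} {B : Set V}

theorem exists_word {T : Set V} {x : Raag Γ} (hx : x ∈ subRaag Γ T) :
    ∃ l : List (V × Bool), (∀ s ∈ l, s.1 ∈ T) ∧ ev Γ l = x := by
  induction hx using Subgroup.closure_induction_right with
  | one => exact ⟨[], by simp, ev_nil⟩
  | mul_right x _ y hy h =>
    obtain ⟨t, ht, rfl⟩ := hy
    obtain ⟨l, hl, rfl⟩ := h
    refine ⟨l ++ [(t, true)], ?_, by rw [ev_append, ev_true]⟩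
    simpa [or_imp, forall_and, ht] using hl
  | mul_inv_cancel x _ y hy h =>
    obtain ⟨t, ht, rfl⟩ := hy
    obtain ⟨l, hl, rfl⟩ := h
    refine ⟨l ++ [(t, false)], ?_, by rw [ev_append, ev_false]⟩
    simpa [or_imp, forall_and, ht] using hl

theorem cs_subset {h p : Raag Γ} {v : V} (hp : p ∈ cs Γ h B) (hv : v ∈ B) :
    cs Γ p {v} ⊆ cs Γ h B := by
  rw [← cs_eq_of_mem hp]
  exact cs_mono (Set.singleton_subset_iff.2 hv) p

/-- The side of a line on which a block coset meeting it lies. -/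
theorem lside_piece {p q y : Raag Γ} {v : V} (hq : q ∈ cs Γ p {v}) (hy : y ∈ cs Γ q B)
    (hyL : y ∉ cs Γ p {v}) : ∃ b ∈ B, b ≠ v ∧ lside p {v} y = some (cmp Γ {v} b) := by
  obtain ⟨l, hl, hlq⟩ := exists_word hy
  obtain rfl : y = q * ev Γ l := by rw [hlq]; group
  obtain ⟨l₁, s, l₂, rfl, -, hs, h, -⟩ := exists_last_exit' hq hyL
  exact ⟨s.1, hl s (by simp), by simpa using hs, h⟩

theorem lside_eq_of_piece {p q y : Raag Γ} {v b : V} (hB : Biconn Γ B) (hq : q ∈ cs Γ p {v})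
    (hy : y ∈ cs Γ q B) (hyL : y ∉ cs Γ p {v}) (hb : b ∈ B) (hbv : b ≠ v) :
    lside p {v} y = some (cmp Γ {v} b) := by
  obtain ⟨b', hb', hbv', h⟩ := lside_piece hq hy hyL
  rw [h, hB.cmp_singleton_eq hb' hb hbv' hbv]

theorem lside_const {p h x y : Raag Γ} {v : V} (hB : Biconn Γ B) (hx : x ∈ cs Γ h B)
    (hy : y ∈ cs Γ h B) (hxL : x ∉ cs Γ p {v}) (hyL : y ∉ cs Γ p {v}) :
    lside p {v} x = lside p {v} y := by
  by_cases hq : ∃ q ∈ cs Γ p {v}, q ∈ cs Γ h B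
  · obtain ⟨q, hq, hqB⟩ := hq
    rw [← cs_eq_of_mem hqB] at hx hy
    obtain ⟨b, hb, hbv, e⟩ := lside_piece hq hx hxL
    rw [e, lside_eq_of_piece hB hq hy hyL hb hbv]
  · push Not at hq
    rw [← cs_eq_of_mem hx] at hy
    obtain ⟨l, hl, hlq⟩ := exists_word hy
    obtain rfl : y = x * ev Γ l := by rw [hlq]; group
    refine (lside_path fun l' hl' hmem => hq _ hmem ?_).symm
    exact mul_mem_cs hx (ev_mem fun s hs => hl s (hl'.subset hs))

theorem lside_eq_some {p x : Raag Γ} {v : V} (hx : x ∉ cs Γ p {v}) :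
    ∃ s, s ≠ v ∧ lside p {v} x = some (cmp Γ {v} s) := by
  obtain ⟨l, hl⟩ := ev_surjective (p⁻¹ * x)
  obtain rfl : x = p * ev Γ l := by rw [hl]; group
  obtain ⟨l₁, s, l₂, rfl, -, hs, h, -⟩ := exists_last_exit' (self_mem_cs (Γ := Γ) p {v}) hx
  exact ⟨s.1, by simpa using hs, h⟩

theorem _root_.MaxBiconn.exists_ne [Finite V] [Nontrivial V] (hΓ : Γ.Connected)
    (hB : MaxBiconn Γ B) (v : V) : ∃ b ∈ B, b ≠ v := by
  by_contra! h
  obtain ⟨b, hb⟩ := (biconn_iff.1 hB.1).1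
  obtain rfl := h b hb
  obtain ⟨u, hu⟩ := _root_.exists_ne b
  obtain ⟨s, hs, -⟩ := exists_adj_cmp_eq hΓ hu
  obtain ⟨B', h1, h2, h3⟩ := exists_block_of_adj hs
  have := hB.2 B' h3.1 fun z hz => by rwa [h z hz]
  exact hs.ne' (h s (this ▸ h2))

variable [Finite V] [Nontrivial V]

/-- A point outside a block coset is separated from it by a line of the coset. -/
theorem exists_gate_line (hΓ : Γ.Connected) (hB : MaxBiconn Γ B) {h x : Raag Γ}
    (hx : x ∉ cs Γ h B) : ∃ p ∈ cs Γ h B, ∃ v ∈ B, CutVertex Γ v ∧ x ∉ cs Γ p {v} ∧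
      ∀ b ∈ B, b ≠ v → lside p {v} x ≠ some (cmp Γ {v} b) := by
  obtain ⟨l, hl⟩ := ev_surjective (h⁻¹ * x)
  obtain rfl : x = h * ev Γ l := by rw [hl]; group
  obtain ⟨l₁, s, l₂, rfl, hp, hs, -, hl2⟩ := exists_last_exit' (self_mem_cs (Γ := Γ) h B) hx
  obtain ⟨v, hv, hsep⟩ := hB.exists_gate hΓ hs
  obtain ⟨b, hb, hbv⟩ := hB.exists_ne hΓ v
  have hsv : s.1 ≠ v := fun h => hs (h ▸ hv)
  refine ⟨_, hp, v, hv, cutVertex_iff.2 ⟨s.1, b, hsv, hbv, hsep b hb hbv⟩,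
    fun h => hx (cs_subset hp hv h), fun b hb hbv => ?_⟩
  have e : lside (h * ev Γ l₁) {v} (h * ev Γ (l₁ ++ s :: l₂)) = some (cmp Γ {v} s.1) := by
    have e1 : h * ev Γ (l₁ ++ s :: l₂) = h * ev Γ l₁ * ev Γ [s] * ev Γ l₂ := by
      rw [ev_append, ev_cons]; group
    rw [e1, lside_path, lside_exit (self_mem_cs _ _) (by simpa using hsv)]
    intro l' hl' hmem
    apply hl2 l' hl'
    rw [ev_append, ev_cons, ← mul_assoc, ← mul_assoc]
    exact cs_subset hp hv hmem
  rw [e]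
  exact fun h => hsep b hb hbv (Option.some_injective _ h)

/-- The coarse intersection of two block cosets is near a line. -/
theorem exists_line_of_not_subset {B' : Set V} (hΓ : Γ.Connected) (hB : MaxBiconn Γ B)
    (hB' : MaxBiconn Γ B') {h h' : Raag Γ} (hsub : ¬ cs Γ h' B' ⊆ cs Γ h B) :
    ∃ p ∈ cs Γ h B, ∃ v ∈ B, CutVertex Γ v ∧
      ∀ r, ∀ z ∈ cs Γ h B, z ∈ nb r (cs Γ h' B') → z ∈ nb r (cs Γ p {v}) := by
  obtain ⟨x, hx', hx⟩ := Set.not_subset.1 hsub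
  obtain ⟨p, hp, v, hv, hcut, hxL, hside⟩ := exists_gate_line hΓ hB hx
  refine ⟨p, hp, v, hv, hcut, fun r z hz ⟨y, hy, hzy⟩ => ?_⟩
  by_cases hyL : y ∈ cs Γ p {v}
  · exact ⟨y, hyL, hzy⟩
  by_cases hzL : z ∈ cs Γ p {v}
  · exact subset_nb _ _ hzL
  rw [← cs_eq_of_mem hp] at hz
  obtain ⟨b, hb, hbv, e⟩ := lside_piece (self_mem_cs _ _) hz hzL
  have hne : lside p {v} z ≠ lside p {v} y := by
    rw [e, lside_const hB'.1 hy hx' hyL hxL]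
    exact (hside b hb hbv).symm
  obtain ⟨w, hw, hd⟩ := exists_crossing hne
  exact ⟨w, hw, by omega⟩

omit [Finite V] [Nontrivial V] in
theorem cmp_eq_of_cmp_ne (hΓ : Γ.Connected) {s v v' : V} (hv : v ≠ v') (hs : s ≠ v')
    (h : cmp Γ {v'} s ≠ cmp Γ {v'} v) : cmp Γ {v} s = cmp Γ {v} v' := by
  classical
  obtain ⟨t, ht, e⟩ := exists_adj_cmp_eq hΓ hs
  have htv : t ≠ v := by rintro rfl; exact h e.symm
  have h1 : cmp Γ {v} t = cmp Γ {v} v' :=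
    cmp_eq_of_adj ht.symm (by simpa using htv) (by simpa using hv.symm)
  rw [← h1]
  rcases exists_walk_of_cmp_eq e with rfl | ⟨p, hp⟩
  · rfl
  · refine (cmp_eq_of_walk p ?_).symm
    rintro x hx rfl
    refine h (e.symm.trans (cmp_eq_of_walk (p.takeUntil x hx) fun y hy => hp y ?_))
    exact p.support_takeUntil_subset_support hx hy

/-- A set that is not coarsely separated by any line lies near a block coset. -/
theorem exists_piece (hΓ : Γ.Connected) {Y : Set (Raag Γ)} (hY : Y.Nonempty) (R : ℕ)
    (hsep : ∀ (p : Raag Γ) (v : V), ∀ y ∈ Y, ∀ y' ∈ Y, y ∉ nb R (cs Γ p {v}) →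
      y' ∉ nb R (cs Γ p {v}) → lside p {v} y = lside p {v} y') :
    ∃ h B, MaxBiconn Γ B ∧ Y ⊆ nb R (cs Γ h B) := by
  by_contra! hcon
  obtain ⟨y0, hy0⟩ := hY
  have far : ∀ h B, MaxBiconn Γ B → ∃ y ∈ Y, y ∉ nb R (cs Γ h B) := fun h B hB =>
    Set.not_subset.1 (hcon h B hB)
  let 𝒰 : Set (Set (Raag Γ)) := {U | ∃ (p : Raag Γ) (v : V) (c : Cmp Γ {v}),
    U = {x | lside p {v} x = some c} ∧
    (∃ y ∈ Y, y ∉ nb R (cs Γ p {v}) ∧ lside p {v} y = some c) ∧ y0 ∉ U}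
  have hfin : 𝒰.Finite := by
    have : (⋃ q ∈ {q : Raag Γ | nd y0 q ≤ R}, ⋃ v : V, Set.range fun c : Cmp Γ {v} =>
        {x | lside q {v} x = some c}).Finite := by
      refine (ball_finite' y0 R).biUnion fun q _ => Set.finite_iUnion fun v => ?_
      have : Finite (Cmp Γ {v}) := Quot.finite _
      exact Set.finite_range _
    refine this.subset ?_
    rintro U ⟨p, v, c, rfl, ⟨y, hy, hyR, hyc⟩, h0⟩
    have hnear : y0 ∈ nb R (cs Γ p {v}) := by
      by_contra h0R
      exact h0 ((hsep p v y0 hy0 y hy h0R hyR).trans hyc)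
    obtain ⟨q, hq, hd⟩ := hnear
    simp only [Set.mem_iUnion, Set.mem_range]
    refine ⟨q, hd, v, c, ?_⟩
    ext x
    simp only [Set.mem_ofPred_eq, lside_congr hq]
  have hne : 𝒰.Nonempty := by
    obtain ⟨v0⟩ := hΓ.nonempty
    obtain ⟨B, -, hB⟩ := exists_block_of_isClique (Γ := Γ) (S := {v0}) (by simp) (by simp)
    obtain ⟨y, hy, hyR⟩ := far y0 B hB
    obtain ⟨p, hp, v, hv, -, hyL, hside⟩ := exists_gate_line hΓ hB fun h => hyR (subset_nb _ _ h)
    obtain ⟨a, ha, e⟩ := lside_eq_some hyL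
    refine ⟨_, p, v, _, rfl, ⟨y, hy, fun h => hyR (nb_mono_set (cs_subset hp hv) h), e⟩, ?_⟩
    intro (h0 : lside p {v} y0 = _)
    have h0L : y0 ∉ cs Γ p {v} := fun h => by
      rw [lside_eq_none.2 h] at h0; exact absurd h0 (by simp)
    obtain ⟨b, hb, hbv, e'⟩ := lside_piece (self_mem_cs _ _) (mem_cs_symm hp) h0L
    exact hside b hb hbv (by rw [e, ← h0, e'])
  obtain ⟨U, hU, hmin⟩ := hfin.exists_minimal hne
  obtain ⟨p, v, c, rfl, ⟨y, hy, hyR, hyc⟩, h0⟩ := hU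
  obtain ⟨a, hav, ea⟩ := lside_eq_some fun h => hyR (subset_nb _ _ h)
  obtain ⟨b', hadj, hb'c⟩ := exists_adj_cmp_eq hΓ hav
  obtain rfl : cmp Γ {v} b' = c := by
    rw [hb'c]; exact Option.some_injective _ (ea.symm.trans hyc)
  obtain ⟨B', hvB, hbB, hB'⟩ := exists_block_of_adj hadj
  have hbv : b' ≠ v := hadj.ne'
  obtain ⟨y', hy', hyR'⟩ := far p B' hB'
  obtain ⟨p', hp', v', hv', -, hyL', hside⟩ := exists_gate_line hΓ hB' fun h => hyR' (subset_nb _ _ h)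
  obtain ⟨a', hav', ea'⟩ := lside_eq_some hyL'
  have hc : lside p {v} y' = some (cmp Γ {v} b') :=
    (hsep p v y' hy' y hy (fun h => hyR' (nb_mono_set (cs_subset (self_mem_cs _ _) hvB) h))
      hyR).trans hyc
  have hPL : ∀ z ∈ cs Γ p B', z ∉ cs Γ p {v} → lside p {v} z = some (cmp Γ {v} b') :=
    fun z hz hzL => lside_eq_of_piece hB'.1 (self_mem_cs _ _) hz hzL hbB hbv
  have hLL : p' ∈ cs Γ p {v} → v' ≠ v := by
    rintro h rfl
    exact hside b' hbB hbv (by rw [lside_congr h, hc])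
  have hsub : {x | lside p' {v'} x = some (cmp Γ {v'} a')} ⊆
      {x | lside p {v} x = some (cmp Γ {v} b')} := by
    intro x (hx : lside p' {v'} x = _)
    have hxL : x ∉ cs Γ p' {v'} := fun h => by
      rw [lside_eq_none.2 h] at hx; exact absurd hx (by simp)
    obtain ⟨l, hl⟩ := ev_surjective (p'⁻¹ * x)
    obtain rfl : x = p' * ev Γ l := by rw [hl]; group
    obtain ⟨l₁, s, l₂, rfl, hq, hs, hc', hl2⟩ := exists_last_exit' (self_mem_cs _ _) hxL
    set q := p' * ev Γ l₁ with hqdef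
    have hsc : cmp Γ {v'} s.1 = cmp Γ {v'} a' := Option.some_injective _ (hc'.symm.trans hx)
    have hsB : ∀ b ∈ B', b ≠ v' → cmp Γ {v'} s.1 ≠ cmp Γ {v'} b := fun b hb hbv h =>
      hside b hb hbv (by rw [ea', ← hsc, h])
    have hsB' : s.1 ∉ B' := fun h => hsB s.1 h (by simpa using hs) rfl
    have e1 : ∀ l', p' * ev Γ (l₁ ++ s :: l') = q * ev Γ [s] * ev Γ l' := fun l' => by
      rw [hqdef, ev_append, ev_cons]; group
    have hqP : q ∈ cs Γ p B' := cs_subset hp' hv' hq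
    have hmiss : ∀ l', l' <+: l₂ → q * ev Γ [s] * ev Γ l' ∉ cs Γ p {v} := by
      intro l' hl' hmem
      have h1 : q * ev Γ [s] * ev Γ l' ∈ cs Γ p' B' := by
        rw [cs_eq_of_mem hp']
        exact cs_subset (self_mem_cs _ _) hvB hmem
      have h2 := hl2 l' hl'
      rw [e1] at h2
      obtain ⟨b, hb, hbv, e⟩ := lside_piece (self_mem_cs _ _) h1 h2
      have h3 : lside p' {v'} (q * ev Γ [s] * ev Γ l') = some (cmp Γ {v'} s.1) := by
        rw [lside_path, lside_exit hq hs]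
        intro l'' hl''
        have := hl2 l'' (hl''.trans hl')
        rwa [e1] at this
      exact hsB b hb hbv (Option.some_injective _ (h3.symm.trans e))
    change lside p {v} _ = _
    rw [e1, lside_path hmiss]
    have hqs : q * ev Γ [s] ∉ cs Γ p {v} := by simpa [ev_nil] using hmiss [] (List.nil_prefix)
    by_cases hqL : q ∈ cs Γ p {v}
    · have hvv : v' ≠ v := by
        rintro rfl
        refine hLL ?_ rfl
        rw [← cs_eq_of_mem hqL]
        exact mem_cs_symm hq
      have hsv : s.1 ≠ v := fun h => hsB' (h ▸ hvB)
      rw [lside_exit hqL (by simpa using hsv),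
        cmp_eq_of_cmp_ne hΓ hvv.symm (by simpa using hs) (hsB v hvB hvv.symm),
        hB'.1.cmp_singleton_eq hv' hbB hvv hbv]
    · rw [lside_path, hPL q hqP hqL]
      intro l' hl'
      rcases List.prefix_cons_iff.1 hl' with rfl | ⟨t, rfl, ht⟩
      · simpa [ev_nil] using hqL
      · rw [List.prefix_nil.1 ht]
        exact hqs
  have hmem : {x | lside p' {v'} x = some (cmp Γ {v'} a')} ∈ 𝒰 :=
    ⟨p', v', _, rfl, ⟨y', hy', fun h => hyR' (nb_mono_set (cs_subset hp' hv') h), ea'⟩,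
      fun h => h0 (hsub h)⟩
  have hle := hmin hmem hsub
  have hnot : ∀ z ∈ cs Γ p' {v'}, z ∈ cs Γ p {v} := by
    intro z hz
    by_contra hzL
    have h1 : lside p' {v'} z = _ := hle (hPL z (cs_subset hp' hv' hz) hzL)
    rw [lside_eq_none.2 hz] at h1
    exact absurd h1 (by simp)
  have h1 := hnot p' (self_mem_cs _ _)
  have h2 := hnot (p' * raagGen Γ v') (mul_mem_cs (self_mem_cs _ _) (gen_mem rfl))
  rw [← cs_eq_of_mem h1, mem_cs, inv_mul_cancel_left] at h2
  have := ex_eq_zero (b := v') (by simpa using hLL h1) h2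
  rw [ex_gen_self] at this
  exact absurd this (by simp)

end Tree

/-! ### Subsets of linear growth do not separate -/

section Grid

variable {α : Type*}

theorem int_const {f : ℤ → α} (h : ∀ i, f i = f (i + 1)) (i j : ℤ) : f i = f j := by
  have h0 : ∀ i, f i = f 0 := by
    intro i
    induction i with
    | zero => rfl
    | succ n ih => rw [← h, ih]
    | pred n ih => rw [h, sub_add_cancel, ih]
  rw [h0 i, h0 j]

theorem int_const_on {f : ℤ → α} {a b : ℤ} (h : ∀ i, a ≤ i → i < b → f i = f (i + 1)) {i j : ℤ}
    (hi : a ≤ i) (hi' : i ≤ b) (hj : a ≤ j) (hj' : j ≤ b) : f i = f j := by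
  have h0 : ∀ i, a ≤ i → i ≤ b → f i = f a := by
    intro i hi
    induction i, hi using Int.leInduction with
    | base => intro _; rfl
    | succ n hn ih => intro hb; rw [← h n hn (by omega), ih (by omega)]
  rw [h0 i hi hi', h0 j hj hj']

/-- A finite subset of the plane lattice does not coarsely separate it. -/
theorem plane_const {Z : Finset (ℤ × ℤ)} {col : ℤ → ℤ → α}
    (h1 : ∀ a b, (a, b) ∉ Z → col a b = col (a + 1) b)
    (h2 : ∀ a b, (a, b) ∉ Z → col a b = col a (b + 1)) {a b a' b' : ℤ}
    (hab : ∀ i j, (i, j) ∈ Z → (Z.card : ℤ) < |i - a| + |j - b|)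
    (hab' : ∀ i j, (i, j) ∈ Z → (Z.card : ℤ) < |i - a'| + |j - b'|) :
    col a b = col a' b' := by
  classical
  have free : ∀ a : ℤ, ∃ i, a ≤ i ∧ i ≤ a + Z.card ∧ ∀ j, (i, j) ∉ Z := by
    intro a
    by_contra! hcon
    have h : Finset.Icc a (a + Z.card) ⊆ Z.image Prod.fst := by
      intro i hi
      rw [Finset.mem_Icc] at hi
      obtain ⟨j, hj⟩ := hcon i hi.1 hi.2
      exact Finset.mem_image.2 ⟨_, hj, rfl⟩
    have := (Finset.card_le_card h).trans Finset.card_image_le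
    rw [Int.card_Icc] at this
    omega
  have freeRow : ∃ j, ∀ i, (i, j) ∉ Z := by
    obtain ⟨j, hj⟩ := Infinite.exists_notMem_finset (Z.image Prod.snd)
    exact ⟨j, fun i hi => hj (Finset.mem_image.2 ⟨_, hi, rfl⟩)⟩
  obtain ⟨j0, hj0⟩ := freeRow
  have key : ∀ a b, (∀ i j, (i, j) ∈ Z → (Z.card : ℤ) < |i - a| + |j - b|) →
      col a b = col 0 j0 := by
    intro a b hab
    obtain ⟨i, hi, hi', hfree⟩ := free a
    have e1 : col a b = col i b := by
      refine int_const_on (f := fun i => col i b) (a := a) (b := a + Z.card)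
        (fun k hk hk' => h1 k b fun hmem => ?_) le_rfl (by omega) hi hi'
      have := hab k b hmem
      rw [sub_self, abs_zero, add_zero, abs_of_nonneg (by omega)] at this
      omega
    have e2 : col i b = col i j0 := int_const (fun j => h2 i j (hfree j)) _ _
    have e3 : col i j0 = col 0 j0 := int_const (f := fun i => col i j0) (fun i => h1 i j0 (hj0 i)) _ _
    rw [e1, e2, e3]
  rw [key a b hab, key a' b' hab']

/-- A subset of linear growth of the three-dimensional lattice leaves a dominant colour in every
large cube: all points over most pairs `(b, c)` have the same colour. -/
theorem exists_dominant {Z : Set (ℤ × ℤ × ℤ)} {col : ℤ → ℤ → ℤ → α} {C N : ℕ}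
    (h1 : ∀ a b c, (a, b, c) ∉ Z → col a b c = col (a + 1) b c)
    (h2 : ∀ a b c, (a, b, c) ∉ Z → col a b c = col a (b + 1) c)
    (h3 : ∀ a b c, (a, b, c) ∉ Z → col a b c = col a b (c + 1)) (hN : C < N)
    (o1 o2 o3 : ℤ)
    (hcount : ∀ F : Finset (ℤ × ℤ × ℤ), (∀ y ∈ F, y ∈ Z ∧ y.1 ∈ Set.Ico o1 (o1 + N) ∧
      y.2.1 ∈ Set.Ico o2 (o2 + N) ∧ y.2.2 ∈ Set.Ico o3 (o3 + N)) → F.card ≤ C * N) :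
    ∃ k : α, ∃ X : Finset (ℤ × ℤ), X.card ≤ 2 * C * N ∧
      ∀ a ∈ Set.Ico o1 (o1 + N), ∀ b ∈ Set.Ico o2 (o2 + N), ∀ c ∈ Set.Ico o3 (o3 + N),
        (b, c) ∉ X → col a b c = k := by
  classical
  let I1 := Finset.Ico o1 (o1 + N)
  let I2 := Finset.Ico o2 (o2 + N)
  let I3 := Finset.Ico o3 (o3 + N)
  let F : Finset (ℤ × ℤ × ℤ) := (I1 ×ˢ I2 ×ˢ I3).filter (· ∈ Z)
  have hF : F.card ≤ C * N := hcount F fun y hy => by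
    simp only [F, I1, I2, I3, Finset.mem_filter, Finset.mem_product, Finset.mem_Ico] at hy
    simp only [Set.mem_Ico]
    tauto
  have memF : ∀ a ∈ I1, ∀ b ∈ I2, ∀ c ∈ I3, (a, b, c) ∉ F → (a, b, c) ∉ Z := by
    intro a ha b hb c hc h hZ
    exact h (by simp [F, ha, hb, hc, hZ])
  have hI1 : I1.card = N := by simp [I1]
  have hI2 : I2.card = N := by simp [I2]
  obtain ⟨a, ha, hFa⟩ : ∃ a ∈ I1, (F.filter fun y => y.1 = a).card ≤ C := by
    by_contra! hcon
    have hs := Finset.card_eq_sum_card_fiberwise (f := Prod.fst) (s := F) (t := I1) (by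
      intro y hy
      have := (Finset.mem_filter.1 hy).1
      exact (Finset.mem_product.1 this).1)
    have : ∑ _a ∈ I1, (C + 1) ≤ F.card := by
      rw [hs]; exact Finset.sum_le_sum fun a ha => hcon a ha
    rw [Finset.sum_const, smul_eq_mul, hI1] at this
    nlinarith
  set Fa := F.filter fun y => y.1 = a with hFadef
  obtain ⟨b0, hb0, hb0F⟩ : ∃ b ∈ I2, b ∉ Fa.image fun y => y.2.1 := by
    by_contra! hcon
    have := (Finset.card_le_card hcon).trans Finset.card_image_le
    omega
  have hb0Z : ∀ c ∈ I3, (a, b0, c) ∉ Z := fun c hc => memF a ha b0 hb0 c hc fun h =>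
    hb0F (Finset.mem_image.2 ⟨(a, b0, c), Finset.mem_filter.2 ⟨h, rfl⟩, rfl⟩)
  refine ⟨col a b0 o3, F.image (fun y => y.2) ∪ I2 ×ˢ (Fa.image fun y => y.2.2), ?_, ?_⟩
  · refine (Finset.card_union_le _ _).trans ?_
    have e1 : (F.image fun y => y.2).card ≤ C * N := Finset.card_image_le.trans hF
    have e2 : (I2 ×ˢ (Fa.image fun y => y.2.2)).card ≤ N * C := by
      rw [Finset.card_product, hI2]
      exact Nat.mul_le_mul_left _ (Finset.card_image_le.trans hFa)
    nlinarith
  · intro x hx b hb c hc hX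
    rw [Finset.mem_union, not_or, Finset.mem_product, not_and] at hX
    have hb' : b ∈ I2 := by simpa [I2] using hb
    have hc' : c ∈ I3 := by simpa [I3] using hc
    have ha' := Finset.mem_Ico.1 ha
    have hb0' := Finset.mem_Ico.1 hb0
    have e1 : col x b c = col a b c := by
      refine int_const_on (f := fun x => col x b c) (a := o1) (b := o1 + N - 1)
        (fun i hi hi' => h1 _ _ _ ?_) hx.1 (by have := hx.2; omega) ha'.1 (by omega)
      refine memF i (by simp only [I1, Finset.mem_Ico]; omega) b hb' c hc' fun h => ?_
      exact hX.1 (Finset.mem_image.2 ⟨_, h, rfl⟩)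
    have e2 : col a b c = col a b0 c := by
      refine int_const_on (f := fun x => col a x c) (a := o2) (b := o2 + N - 1)
        (fun i hi hi' => h2 _ _ _ ?_) hb.1 (by have := hb.2; omega) hb0'.1 (by omega)
      refine memF a ha i (by simp only [I2, Finset.mem_Ico]; omega) c hc' fun h => ?_
      exact hX.2 hb' (Finset.mem_image.2 ⟨(a, i, c), Finset.mem_filter.2 ⟨h, rfl⟩, rfl⟩)
    have e3 : col a b0 c = col a b0 o3 := by
      refine int_const_on (f := fun x => col a b0 x) (a := o3) (b := o3 + N - 1)
        (fun i hi hi' => h3 _ _ _ (hb0Z i ?_)) hc.1 (by have := hc.2; omega) le_rfl (by omega)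
      simp only [I3, Finset.mem_Ico]; omega
    rw [e1, e2, e3]

/-- A subset of linear growth does not coarsely separate the three-dimensional lattice. -/
theorem space_const {Z : Set (ℤ × ℤ × ℤ)} {col : ℤ → ℤ → ℤ → α} {C N : ℕ}
    (h1 : ∀ a b c, (a, b, c) ∉ Z → col a b c = col (a + 1) b c)
    (h2 : ∀ a b c, (a, b, c) ∉ Z → col a b c = col a (b + 1) c)
    (h3 : ∀ a b c, (a, b, c) ∉ Z → col a b c = col a b (c + 1)) (hN : 4 * C + 2 ≤ N)
    (hcount : ∀ (o1 o2 o3 : ℤ) (F : Finset (ℤ × ℤ × ℤ)), (∀ y ∈ F, y ∈ Z ∧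
      y.1 ∈ Set.Ico o1 (o1 + N) ∧ y.2.1 ∈ Set.Ico o2 (o2 + N) ∧ y.2.2 ∈ Set.Ico o3 (o3 + N)) →
      F.card ≤ C * N) {a b c a' b' c' : ℤ}
    (hd : ∀ i ∈ Set.Ico a (a + N), ∀ j ∈ Set.Ico b (b + N), ∀ k ∈ Set.Ico c (c + N), (i, j, k) ∉ Z)
    (hd' : ∀ i ∈ Set.Ico a' (a' + N), ∀ j ∈ Set.Ico b' (b' + N), ∀ k ∈ Set.Ico c' (c' + N),
      (i, j, k) ∉ Z) :
    col a b c = col a' b' c' := by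
  classical
  choose D X hX hD using fun o : ℤ × ℤ × ℤ =>
    exists_dominant h1 h2 h3 (show C < N by omega) o.1 o.2.1 o.2.2 (hcount o.1 o.2.1 o.2.2)
  have step : ∀ o1 o2 o3 o1' o2' o3', |o1 - o1'| ≤ 1 → |o2 - o2'| ≤ 1 → |o3 - o3'| ≤ 1 →
      D (o1, o2, o3) = D (o1', o2', o3') := by
    intro o1 o2 o3 o1' o2' o3' e1 e2 e3
    rw [abs_le] at e1 e2 e3
    let P := Finset.Ico (max o2 o2') (max o2 o2' + (N - 1 : ℕ)) ×ˢ
      Finset.Ico (max o3 o3') (max o3 o3' + (N - 1 : ℕ))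
    have hP : (X (o1, o2, o3) ∪ X (o1', o2', o3')).card < P.card := by
      refine ((Finset.card_union_le _ _).trans (add_le_add (hX _) (hX _))).trans_lt ?_
      simp only [P, Finset.card_product, Int.card_Ico, add_sub_cancel_left, Int.toNat_natCast]
      obtain ⟨m, rfl⟩ : ∃ m, N = m + (4 * C + 2) := ⟨N - (4 * C + 2), by omega⟩
      have : m + (4 * C + 2) - 1 = m + 4 * C + 1 := by omega
      rw [this]
      nlinarith
    obtain ⟨⟨j, k⟩, hjk, hnot⟩ := Finset.exists_mem_notMem_of_card_lt_card hP
    rw [Finset.mem_union, not_or] at hnot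
    simp only [P, Finset.mem_product, Finset.mem_Ico] at hjk
    rw [← hD (o1, o2, o3) (max o1 o1') ⟨by simp, by dsimp only; omega⟩ j
        ⟨by dsimp only; omega, by dsimp only; omega⟩ k
        ⟨by dsimp only; omega, by dsimp only; omega⟩ hnot.1,
      ← hD (o1', o2', o3') (max o1 o1') ⟨by simp, by dsimp only; omega⟩ j
        ⟨by dsimp only; omega, by dsimp only; omega⟩ k
        ⟨by dsimp only; omega, by dsimp only; omega⟩ hnot.2]
  have hconst : D (a, b, c) = D (a', b', c') := by
    have s1 : D (a, b, c) = D (a', b, c) :=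
      int_const (f := fun i => D (i, b, c)) (fun i => step _ _ _ _ _ _ (by simp) (by simp) (by simp)) _ _
    have s2 : D (a', b, c) = D (a', b', c) :=
      int_const (f := fun i => D (a', i, c)) (fun i => step _ _ _ _ _ _ (by simp) (by simp) (by simp)) _ _
    have s3 : D (a', b', c) = D (a', b', c') :=
      int_const (f := fun i => D (a', b', i)) (fun i => step _ _ _ _ _ _ (by simp) (by simp) (by simp)) _ _
    rw [s1, s2, s3]
  have deep : ∀ a b c : ℤ, (∀ i ∈ Set.Ico a (a + N), ∀ j ∈ Set.Ico b (b + N),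
      ∀ k ∈ Set.Ico c (c + N), (i, j, k) ∉ Z) → col a b c = D (a, b, c) := by
    intro a b c hd
    have hP : (X (a, b, c)).card < (Finset.Ico b (b + N) ×ˢ Finset.Ico c (c + N)).card := by
      refine (hX _).trans_lt ?_
      simp only [Finset.card_product, Int.card_Ico, add_sub_cancel_left, Int.toNat_natCast]
      nlinarith
    obtain ⟨⟨j, k⟩, hjk, hnot⟩ := Finset.exists_mem_notMem_of_card_lt_card hP
    simp only [Finset.mem_product, Finset.mem_Ico] at hjk
    rw [← hD (a, b, c) a ⟨le_rfl, by dsimp only; omega⟩ j hjk.1 k hjk.2 hnot]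
    have s1 : col a b c = col a j c := int_const_on (f := fun i => col a i c) (a := b)
      (b := b + N - 1) (fun i hi hi' => h2 _ _ _ (hd a ⟨le_rfl, by omega⟩ i ⟨hi, by omega⟩ c
        ⟨le_rfl, by omega⟩)) le_rfl (by omega) hjk.1.1 (by omega)
    have s2 : col a j c = col a j k := int_const_on (f := fun i => col a j i) (a := c)
      (b := c + N - 1) (fun i hi hi' => h3 _ _ _ (hd a ⟨le_rfl, by omega⟩ j hjk.1 i
        ⟨hi, by omega⟩)) le_rfl (by omega) hjk.2.1 (by omega)
    rw [s1, s2]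
  rw [deep a b c hd, deep a' b' c' hd', hconst]

end Grid

section Separation

variable {W : Type} {Λ : SimpleGraph W} {α : Type*}

/-- A colouring of `A(Λ)` that only changes along `Z`, where `Z` has linear growth. -/
structure Sep (C : ℕ) (Z : Set (Raag Λ)) (col : Raag Λ → α) : Prop where
  step : ∀ x y, x ∉ Z → nd x y ≤ 1 → col x = col y
  count : ∀ (p : Raag Λ) (ρ : ℕ) (F : Finset (Raag Λ)), (∀ y ∈ F, nd p y ≤ ρ ∧ y ∈ Z) →
    F.card ≤ C * (ρ + 1)

/-- `y` lies at distance more than `R` from `Z`. -/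
def Deep (R : ℕ) (Z : Set (Raag Λ)) (y : Raag Λ) : Prop := ∀ z ∈ Z, R < nd y z

variable {C : ℕ} {Z : Set (Raag Λ)} {col : Raag Λ → α}

theorem Deep.mono {R R' : ℕ} (h : R ≤ R') {y : Raag Λ} (hy : Deep R' Z y) : Deep R Z y :=
  fun z hz => h.trans_lt (hy z hz)

theorem Deep.not_mem {R : ℕ} {y : Raag Λ} (hy : Deep R Z y) : y ∉ Z := fun h => by
  have := hy y h
  simp at this

theorem Sep.path (hS : Sep C Z col) {x : Raag Λ} {l : List (W × Bool)}
    (h : ∀ l', l' <+: l → x * ev Λ l' ∉ Z) : col x = col (x * ev Λ l) := by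
  induction l using List.reverseRecOn with
  | nil => simp
  | append_singleton l s ih =>
    rw [ih fun l' hl' => h l' (hl'.trans (List.prefix_append _ _))]
    refine hS.step _ _ (h l (List.prefix_append _ _)) ?_
    rw [ev_append, ← mul_assoc]
    exact nd_le_length (x * ev Λ l) [s]

theorem Sep.ball (hS : Sep C Z col) {x y : Raag Λ} {r : ℕ} (hx : ∀ z ∈ Z, r < nd x z)
    (hxy : nd x y ≤ r) : col x = col y := by
  obtain ⟨l, hl, rfl⟩ := nd_spec x y
  refine hS.path fun l' hl' hz => ?_
  have h1 := hx _ hz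
  have h2 := nd_le_length x l'
  have h3 := hl'.length_le
  omega

theorem Sep.zpow (hS : Sep C Z col) {x : Raag Λ} {w : W} {k : ℕ}
    (h : ∀ i : ℤ, i.natAbs ≤ k → x * raagGen Λ w ^ i ∉ Z) {i : ℤ} (hi : i.natAbs ≤ k) :
    col x = col (x * raagGen Λ w ^ i) := by
  have := int_const_on (f := fun i : ℤ => col (x * raagGen Λ w ^ i)) (a := -k) (b := k)
    (fun j hj hj' => hS.step _ _ (h j (by omega)) ((nd_gen_zpow_zpow _ _ _ _).trans (by omega)))
    (i := 0) (j := i) (by omega) (by omega) (by omega) (by omega)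
  simpa using this

theorem Sep.const_triangle (hS : Sep C Z col) {u1 u2 u3 : W} (h12 : Λ.Adj u1 u2)
    (h13 : Λ.Adj u1 u3) (h23 : Λ.Adj u2 u3) {x y y' : Raag Λ}
    (hy : y ∈ cs Λ x {u1, u2, u3}) (hy' : y' ∈ cs Λ x {u1, u2, u3})
    (hd : Deep (3 * (16 * C + 2)) Z y) (hd' : Deep (3 * (16 * C + 2)) Z y') : col y = col y' := by
  classical
  set P : ℤ → ℤ → ℤ → Raag Λ := fun a b c =>
    x * (raagGen Λ u3 ^ c * raagGen Λ u2 ^ b * raagGen Λ u1 ^ a) with hP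
  have c12 := gen_comm h12
  have c13 := gen_comm h13
  have c23 := gen_comm h23
  have hrep : ∀ y ∈ cs Λ x {u1, u2, u3}, ∃ a b c, y = P a b c := by
    intro y hy
    obtain ⟨a, y1, hy1, e1⟩ := mem_subRaag_insert (B := {u2, u3}) (by
      rintro t (rfl | rfl) _
      · exact h12
      · exact h13) (mem_cs.1 hy)
    obtain ⟨b, y2, hy2, e2⟩ := mem_subRaag_insert (B := {u3}) (by
      rintro t rfl _
      exact h23) hy1
    obtain ⟨c, e3⟩ := mem_subRaag_singleton hy2
    exact ⟨a, b, c, by simp only [hP]; rw [← e3, ← e2, ← e1]; group⟩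
  have hdist : ∀ a b c a' b' c', nd (P a b c) (P a' b' c') ≤
      (a' - a).natAbs + (b' - b).natAbs + (c' - c).natAbs := by
    intro a b c a' b' c'
    have e : P a' b' c' = P a b c * raagGen Λ u1 ^ (a' - a) * raagGen Λ u2 ^ (b' - b) *
        raagGen Λ u3 ^ (c' - c) := by
      simp only [hP]
      have q1 := c12.zpow_zpow a' (b' - b)
      have q2 := c13.zpow_zpow a' (c' - c)
      have q3 := c23.zpow_zpow b' (c' - c)
      calc _ = x * (raagGen Λ u3 ^ c * raagGen Λ u3 ^ (c' - c) * raagGen Λ u2 ^ b' *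
            raagGen Λ u1 ^ a') := by rw [← zpow_add]; congr 4; omega
        _ = x * (raagGen Λ u3 ^ c * (raagGen Λ u2 ^ b' * raagGen Λ u3 ^ (c' - c)) *
            raagGen Λ u1 ^ a') := by rw [q3.eq]; group
        _ = x * (raagGen Λ u3 ^ c * raagGen Λ u2 ^ b' * (raagGen Λ u1 ^ a' *
            raagGen Λ u3 ^ (c' - c))) := by rw [q2.eq]; group
        _ = x * (raagGen Λ u3 ^ c * (raagGen Λ u2 ^ b * raagGen Λ u2 ^ (b' - b)) *
            (raagGen Λ u1 ^ a' * raagGen Λ u3 ^ (c' - c))) := by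
              rw [← zpow_add]; congr 5; omega
        _ = x * (raagGen Λ u3 ^ c * raagGen Λ u2 ^ b * (raagGen Λ u1 ^ a' *
            raagGen Λ u2 ^ (b' - b)) * raagGen Λ u3 ^ (c' - c)) := by rw [q1.eq]; group
        _ = _ := by
            rw [show a' = a + (a' - a) by ring, zpow_add, show a + (a' - a) - a = a' - a by ring]
            group
    rw [e]
    refine (nd_triangle _ (P a b c * raagGen Λ u1 ^ (a' - a) * raagGen Λ u2 ^ (b' - b)) _).trans
      (Nat.add_le_add ((nd_triangle _ (P a b c * raagGen Λ u1 ^ (a' - a)) _).trans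
        (Nat.add_le_add ?_ ?_)) ?_) <;> exact nd_gen_zpow _ _ _
  have hinj : ∀ a b c a' b' c', P a b c = P a' b' c' → (a, b, c) = (a', b', c') := by
    intro a b c a' b' c' e
    have e' := mul_left_cancel e
    have E1 := congrArg (ex u1) e'
    have E2 := congrArg (ex u2) e'
    have E3 := congrArg (ex u3) e'
    simp only [ex_mul, ex_zpow, ex_gen_self, ex_gen_ne h12.ne, ex_gen_ne h12.ne', ex_gen_ne h13.ne,
      ex_gen_ne h13.ne', ex_gen_ne h23.ne, ex_gen_ne h23.ne'] at E1 E2 E3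
    simp only [Prod.mk.injEq]
    exact ⟨by linarith, by linarith, by linarith⟩
  obtain ⟨a, b, c, rfl⟩ := hrep y hy
  obtain ⟨a', b', c', rfl⟩ := hrep y' hy'
  have hdeep : ∀ a b c, Deep (3 * (16 * C + 2)) Z (P a b c) →
      ∀ i ∈ Set.Ico a (a + ((16 * C + 2 : ℕ) : ℤ)), ∀ j ∈ Set.Ico b (b + ((16 * C + 2 : ℕ) : ℤ)),
      ∀ k ∈ Set.Ico c (c + ((16 * C + 2 : ℕ) : ℤ)),
      (i, j, k) ∉ {q : ℤ × ℤ × ℤ | P q.1 q.2.1 q.2.2 ∈ Z} := by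
    intro a b c hd i hi j hj k hk hz
    have h1 := hd _ hz
    have h2 := hdist a b c i j k
    simp only [Set.mem_Ico] at hi hj hk
    simp only at h1
    omega
  refine space_const (Z := {q : ℤ × ℤ × ℤ | P q.1 q.2.1 q.2.2 ∈ Z}) (C := 4 * C)
    (N := 16 * C + 2) (col := fun a b c => col (P a b c)) ?_ ?_ ?_ (by omega) ?_
    (hdeep a b c hd) (hdeep a' b' c' hd')
  · exact fun a b c h => hS.step _ _ h ((hdist _ _ _ _ _ _).trans (by omega))
  · exact fun a b c h => hS.step _ _ h ((hdist _ _ _ _ _ _).trans (by omega))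
  · exact fun a b c h => hS.step _ _ h ((hdist _ _ _ _ _ _).trans (by omega))
  · intro o1 o2 o3 F hF
    have hi : Set.InjOn (fun q : ℤ × ℤ × ℤ => P q.1 q.2.1 q.2.2) F :=
      fun q _ q' _ e => hinj _ _ _ _ _ _ e
    rw [← Finset.card_image_of_injOn hi]
    refine (hS.count (P o1 o2 o3) (3 * (16 * C + 2)) _ fun y hy => ?_).trans ?_
    · obtain ⟨q, hq, rfl⟩ := Finset.mem_image.1 hy
      obtain ⟨hz, h1, h2, h3⟩ := hF q hq
      refine ⟨(hdist _ _ _ _ _ _).trans ?_, hz⟩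
      simp only [Set.mem_Ico] at h1 h2 h3
      omega
    · nlinarith

/-- Counting the words in a free monoid that avoid `Z`. -/
theorem Sep.exists_branches (hS : Sep C Z col) {u u' : W} (hne : u ≠ u') (hadj : ¬ Λ.Adj u u')
    {p : Raag Λ} {R : ℕ} (hp : Deep R Z p) (hR : 2 * C * (R + 4) + 1 ≤ 2 ^ R) (i : ℕ) :
    ∃ T : Finset (List Bool), (∀ s ∈ T, s.length = R + i ∧ ∀ s', s' <+: s → p * pw Λ u u' s' ∉ Z) ∧
      2 * C * (R + i + 4) + 2 ^ i ≤ T.card := by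
  classical
  have key : ∀ (m : ℕ) (T : Finset (List Bool)),
      (∀ s ∈ T, s.length = m ∧ ∀ s', s' <+: s → p * pw Λ u u' s' ∉ Z) →
      ∃ T' : Finset (List Bool),
        (∀ s ∈ T', s.length = m + 1 ∧ ∀ s', s' <+: s → p * pw Λ u u' s' ∉ Z) ∧
        2 * T.card ≤ T'.card + C * (m + 2) ∧ (m + 1 ≤ R → 2 * T.card ≤ T'.card) := by
    intro m T hT
    set U : Finset (List Bool) := (T ×ˢ Finset.univ).image fun q => q.1 ++ [q.2] with hU
    have hUc : U.card = 2 * T.card := by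
      rw [hU, Finset.card_image_of_injective, Finset.card_product]
      · simp [mul_comm]
      · rintro ⟨a, b⟩ ⟨a', b'⟩ e
        simpa using e
    have hUl : ∀ s ∈ U, s.length = m + 1 := by
      intro s hs
      obtain ⟨q, hq, rfl⟩ := Finset.mem_image.1 hs
      have := (hT q.1 (Finset.mem_product.1 hq).1).1
      simp [this]
    have hsum := Finset.card_filter_add_card_filter_not (s := U)
      (fun s => p * pw Λ u u' s ∈ Z)
    refine ⟨U.filter fun s => ¬ (p * pw Λ u u' s ∈ Z), ?_, ?_, ?_⟩
    · intro s hs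
      obtain ⟨hsU, hsZ⟩ := Finset.mem_filter.1 hs
      refine ⟨hUl s hsU, fun s' hs' => ?_⟩
      obtain ⟨q, hq, rfl⟩ := Finset.mem_image.1 hsU
      rcases List.prefix_concat_iff.1 hs' with rfl | h
      · exact hsZ
      · exact (hT q.1 (Finset.mem_product.1 hq).1).2 s' h
    · have hbad : (U.filter fun s => p * pw Λ u u' s ∈ Z).card ≤ C * (m + 2) := by
        rw [← Finset.card_image_of_injective (f := fun s => p * pw Λ u u' s) _
          ((mul_right_injective p).comp (pw_injective hne hadj))]
        refine hS.count p (m + 1) _ fun y hy => ?_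
        obtain ⟨s, hs, rfl⟩ := Finset.mem_image.1 hy
        obtain ⟨hsU, hsZ⟩ := Finset.mem_filter.1 hs
        exact ⟨(nd_pw u u' p s).trans (hUl s hsU).le, hsZ⟩
      omega
    · intro hm
      have hbad : (U.filter fun s => p * pw Λ u u' s ∈ Z) = ∅ := by
        refine Finset.filter_eq_empty_iff.2 fun s hs hz => ?_
        have h1 := hp _ hz
        have h2 := nd_pw u u' p s
        have h3 := hUl s hs
        omega
      rw [hbad] at hsum
      simp at hsum
      omega
  have h0 : ∀ m ≤ R, ∃ T : Finset (List Bool),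
      (∀ s ∈ T, s.length = m ∧ ∀ s', s' <+: s → p * pw Λ u u' s' ∉ Z) ∧ 2 ^ m ≤ T.card := by
    intro m
    induction m with
    | zero =>
      refine fun _ => ⟨{[]}, ?_, by simp⟩
      intro s hs
      rw [Finset.mem_singleton] at hs
      subst hs
      refine ⟨rfl, fun s' hs' => ?_⟩
      rw [List.prefix_nil.1 hs']
      simpa [pw] using hp.not_mem
    | succ m ih =>
      intro hm
      obtain ⟨T, hT, hc⟩ := ih (by omega)
      obtain ⟨T', hT', -, hc'⟩ := key m T hT
      refine ⟨T', hT', ?_⟩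
      have := hc' hm
      rw [pow_succ]
      omega
  induction i with
  | zero =>
    obtain ⟨T, hT, hc⟩ := h0 R le_rfl
    exact ⟨T, hT, by simpa using hR.trans hc⟩
  | succ i ih =>
    obtain ⟨T, hT, hc⟩ := ih
    obtain ⟨T', hT', hc', -⟩ := key _ T hT
    refine ⟨T', hT', ?_⟩
    rw [pow_succ]
    nlinarith [Nat.zero_le C, Nat.zero_le (C * (R + i))]

theorem ex_pw {u u' w : W} (hu : u ≠ w) (hu' : u' ≠ w) (s : List Bool) : ex w (pw Λ u u' s) = 0 :=
  ex_eq_zero (T := {u, u'}) (by simp [hu.symm, hu'.symm]) (pw_mem (by simp) (by simp) s)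

theorem Sep.exists_good_branch (hS : Sep C Z col) {u u' w : W} (hne : u ≠ u')
    (hadj : ¬ Λ.Adj u u') (hu : u ≠ w) (hu' : u' ≠ w)
    {p : Raag Λ} {R : ℕ} (hp : Deep R Z p) (hR : 2 * C * (R + 4) + 1 ≤ 2 ^ R) {i k : ℕ}
    (hi : C * (R + i + k + 1) < 2 ^ i) :
    ∃ s : List Bool, s.length = R + i ∧ (∀ s', s' <+: s → p * pw Λ u u' s' ∉ Z) ∧
      ∀ j : ℤ, j.natAbs ≤ k → p * pw Λ u u' s * raagGen Λ w ^ j ∉ Z := by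
  classical
  obtain ⟨T, hT, hc⟩ := hS.exists_branches hne hadj hp hR i
  by_contra! hcon
  have hch : ∀ s : List Bool, ∃ j : ℤ, s ∈ T →
      j.natAbs ≤ k ∧ p * pw Λ u u' s * raagGen Λ w ^ j ∈ Z := by
    intro s
    by_cases hs : s ∈ T
    · obtain ⟨j, h1, h2⟩ := hcon s (hT s hs).1 (hT s hs).2
      exact ⟨j, fun _ => ⟨h1, h2⟩⟩
    · exact ⟨0, fun h => absurd h hs⟩
  choose j hj using hch
  have hinj : Function.Injective fun s => p * pw Λ u u' s * raagGen Λ w ^ j s := by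
    intro s s' e
    have E := congrArg (ex w) e
    simp only [ex_mul, ex_zpow, ex_gen_self, ex_pw hu hu'] at E
    have : j s = j s' := by linarith
    dsimp only at e
    rw [this] at e
    exact pw_injective hne hadj (mul_left_cancel (mul_right_cancel e))
  have := hS.count p (R + i + k) (T.image fun s => p * pw Λ u u' s * raagGen Λ w ^ j s) (by
    intro y hy
    obtain ⟨s, hs, rfl⟩ := Finset.mem_image.1 hy
    refine ⟨(nd_triangle _ (p * pw Λ u u' s) _).trans (Nat.add_le_add
      ((nd_pw u u' p s).trans (hT s hs).1.le) ((nd_gen_zpow _ _ _).trans (hj s hs).1)), (hj s hs).2⟩)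
  rw [Finset.card_image_of_injective _ hinj] at this
  omega

theorem pw_append_single_ev (u u' : W) (s : List Bool) :
    pw Λ u u' s = ev Λ (s.map fun b => (cond b u u', true)) := by
  unfold pw ev
  rw [List.map_map]
  congr 2
  ext b
  cases b <;> rfl

theorem Sep.branch (hS : Sep C Z col) {u u' : W} {p : Raag Λ} {s : List Bool}
    (h : ∀ s', s' <+: s → p * pw Λ u u' s' ∉ Z) : col p = col (p * pw Λ u u' s) := by
  rw [pw_append_single_ev]
  refine hS.path fun l' hl' => ?_
  obtain ⟨s', hs', rfl⟩ := List.prefix_map_iff.1 hl'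
  rw [← pw_append_single_ev]
  exact h s' hs'

theorem comm_w {u u' w : W} (hu : Λ.Adj w u) (hu' : Λ.Adj w u') {t : Raag Λ}
    (ht : t ∈ subRaag Λ {u, u'}) (j : ℤ) : t * raagGen Λ w ^ j = raagGen Λ w ^ j * t := by
  refine ((gen_comm_subRaag (s := w) (T := {u, u'}) ?_ ht).zpow_left j).eq.symm
  rintro t (rfl | rfl) _ <;> assumption

theorem Sep.near_of_branch (hS : Sep C Z col) {u u' w : W} (hne : u ≠ u')
    (hadj : ¬ Λ.Adj u u') (hu : Λ.Adj w u) (hu' : Λ.Adj w u')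
    {p : Raag Λ} {R : ℕ} (hR : 2 * C * (R + 4) + 1 ≤ 2 ^ R) (hp : Deep R Z p) {t : Raag Λ}
    (ht : t ∈ subRaag Λ {u, u'}) {j : ℤ} (hq : Deep R Z (p * (t * raagGen Λ w ^ j)))
    (hcol : col p ≠ col (p * (t * raagGen Λ w ^ j))) {i k : ℕ}
    (hi : C * (R + i + (k + j.natAbs) + 1) < 2 ^ i) {h : ℤ} (hh : h.natAbs ≤ k) :
    ∃ z ∈ Z, nd (p * raagGen Λ w ^ h) z ≤ R + i + nd 1 t := by
  by_contra! hcon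
  obtain ⟨s, hsl, hs1, hs2⟩ := hS.exists_good_branch hne hadj hu.ne' hu'.ne' hp hR hi
  obtain ⟨s', hsl', hs1', hs2'⟩ := hS.exists_good_branch hne hadj hu.ne' hu'.ne' hq hR hi
  have hps := pw_mem (Γ := Λ) (T := {u, u'}) (u := u) (u' := u') (by simp) (by simp) s
  have hps' := pw_mem (Γ := Λ) (T := {u, u'}) (u := u) (u' := u') (by simp) (by simp) s'
  have a1 := hS.branch hs1
  have a2 := hS.zpow hs2 (i := h) (by omega)
  have b1 := hS.branch hs1'
  have b2 := hS.zpow hs2' (i := h - j) (by omega)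
  have e1 : p * pw Λ u u' s * raagGen Λ w ^ h = p * raagGen Λ w ^ h * pw Λ u u' s := by
    rw [mul_assoc, comm_w hu hu' hps, mul_assoc]
  have e2 : p * (t * raagGen Λ w ^ j) * pw Λ u u' s' * raagGen Λ w ^ (h - j) =
      p * raagGen Λ w ^ h * t * pw Λ u u' s' := by
    calc _ = p * (t * raagGen Λ w ^ j * (pw Λ u u' s' * raagGen Λ w ^ (h - j))) := by group
      _ = p * (t * raagGen Λ w ^ h) * pw Λ u u' s' := by
        rw [comm_w hu hu' hps']
        rw [show h = j + (h - j) by ring, zpow_add, show j + (h - j) - j = h - j by ring]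
        group
      _ = _ := by rw [comm_w hu hu' ht]; group
  rw [e1] at a2
  rw [e2] at b2
  have c1 : col (p * raagGen Λ w ^ h) = col (p * raagGen Λ w ^ h * pw Λ u u' s) :=
    hS.ball hcon ((nd_pw _ _ _ _).trans (by omega))
  have c2 : col (p * raagGen Λ w ^ h) = col (p * raagGen Λ w ^ h * t * pw Λ u u' s') := by
    refine hS.ball hcon ((nd_triangle _ (p * raagGen Λ w ^ h * t) _).trans ?_)
    have h1 := nd_pw u u' (p * raagGen Λ w ^ h * t) s'
    have h2 : nd (p * raagGen Λ w ^ h) (p * raagGen Λ w ^ h * t) = nd 1 t := by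
      simpa using nd_mul_left (p * raagGen Λ w ^ h) 1 t
    omega
  exact hcol (a1.trans (a2.trans (c1.symm.trans (c2.trans (b2.symm.trans b1.symm)))))

/-- A separating set in `A({u, u'}) × ⟨w⟩` is asymptotic to the line of direction `w`. -/
theorem Sep.asym (hS : Sep C Z col) {u u' w : W} (hne : u ≠ u')
    (hadj : ¬ Λ.Adj u u') (hu : Λ.Adj w u) (hu' : Λ.Adj w u')
    {x p q : Raag Λ} {R : ℕ} (hR : 2 * C * (R + 4) + 1 ≤ 2 ^ R) (hpx : p ∈ cs Λ x {u, w, u'})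
    (hqx : q ∈ cs Λ x {u, w, u'}) (hp : Deep R Z p) (hq : Deep R Z q)
    (hcol : col p ≠ col q) (M : ℕ) :
    ∃ C', ∀ h : ℤ, ∃ z ∈ Z, M * nd (x * raagGen Λ w ^ h) z ≤ h.natAbs + C' := by
  have hset : ({u, w, u'} : Set W) = insert w {u, u'} := Set.insert_comm _ _ _
  have hadjw : ∀ t ∈ ({u, u'} : Set W), t ≠ w → Λ.Adj w t := by
    rintro t (rfl | rfl) _ <;> assumption
  have hq' : q ∈ cs Λ p (insert w {u, u'}) := by
    rw [hset] at hpx hqx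
    rwa [cs_eq_of_mem hpx]
  rw [hset] at hpx
  obtain ⟨j, t, ht, e⟩ := mem_subRaag_insert hadjw (mem_cs.1 hq')
  obtain ⟨j0, t0, ht0, e0⟩ := mem_subRaag_insert hadjw (mem_cs.1 hpx)
  obtain rfl : q = p * (t * raagGen Λ w ^ j) := by rw [← e]; group
  obtain rfl : p = x * (t0 * raagGen Λ w ^ j0) := by rw [← e0]; group
  set A := C * (R + (M + 1) + j.natAbs + (M + 1) + 2) with hA
  obtain ⟨i1, hi1⟩ := exists_mul_pow_lt_two_pow A 1
  rw [pow_one] at hi1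
  refine ⟨(M + 1) * (R + i1 + nd 1 t + nd 1 (t0 * raagGen Λ w ^ j0)), fun h => ?_⟩
  set k := h.natAbs with hk
  set d := k / (M + 1) with hd
  have hdk : k < (M + 1) * (d + 1) := by
    rw [hd]; exact Nat.lt_mul_div_succ k (Nat.succ_pos M)
  have hdk' : (M + 1) * d ≤ k := Nat.mul_div_le k (M + 1)
  have h2d : d + 1 ≤ 2 ^ d := Nat.lt_two_pow_self
  have hi : C * (R + (d + i1) + (k + j.natAbs) + 1) < 2 ^ (d + i1) := by
    calc C * (R + (d + i1) + (k + j.natAbs) + 1) ≤ A * (i1 + 1) * (d + 1) := by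
          rw [hA, mul_assoc, mul_assoc]
          refine Nat.mul_le_mul_left _ ?_
          nlinarith [Nat.zero_le (R * i1), Nat.zero_le (R * d), Nat.zero_le (R * (i1 * d)),
            Nat.zero_le (j.natAbs * i1), Nat.zero_le (j.natAbs * d),
            Nat.zero_le (j.natAbs * (i1 * d)), Nat.zero_le (M * i1), Nat.zero_le (M * d),
            Nat.zero_le (M * (i1 * d)), Nat.zero_le (i1 * d)]
      _ < 2 ^ i1 * (d + 1) := Nat.mul_lt_mul_of_pos_right hi1 (Nat.succ_pos d)
      _ ≤ 2 ^ i1 * 2 ^ d := Nat.mul_le_mul_left _ h2d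
      _ = 2 ^ (d + i1) := by rw [pow_add, mul_comm]
  obtain ⟨z, hz, hzd⟩ := hS.near_of_branch hne hadj hu hu' hR hp ht hq hcol hi (le_refl k)
  refine ⟨z, hz, ?_⟩
  have h1 : nd (x * raagGen Λ w ^ h) (x * (t0 * raagGen Λ w ^ j0) * raagGen Λ w ^ h) =
      nd 1 (t0 * raagGen Λ w ^ j0) := by
    rw [show x * (t0 * raagGen Λ w ^ j0) * raagGen Λ w ^ h =
      x * raagGen Λ w ^ h * (t0 * raagGen Λ w ^ j0) by
        rw [mul_assoc x, mul_assoc t0, ← zpow_add, add_comm, zpow_add, ← mul_assoc t0,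
          comm_w hu hu' ht0]
        group]
    simpa using nd_mul_left (x * raagGen Λ w ^ h) 1 (t0 * raagGen Λ w ^ j0)
  have h2 := nd_triangle (x * raagGen Λ w ^ h) (x * (t0 * raagGen Λ w ^ j0) * raagGen Λ w ^ h) z
  calc M * nd (x * raagGen Λ w ^ h) z ≤ (M + 1) * nd (x * raagGen Λ w ^ h) z :=
        Nat.mul_le_mul_right _ (Nat.le_succ M)
    _ ≤ (M + 1) * (nd 1 (t0 * raagGen Λ w ^ j0) + (R + (d + i1) + nd 1 t)) :=
        Nat.mul_le_mul_left _ (by omega)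
    _ ≤ _ := by nlinarith

end Separation

section Rays

theorem exists_close_of_steps {b : ℕ → ℤ} {N : ℕ} {o t E : ℤ} (h0 : b 0 - o ≤ E)
    (hstep : ∀ i < N, b (i + 1) - b i ≤ E) (hot : o ≤ t) (htN : t ≤ b N) :
    ∃ i ≤ N, |t - b i| ≤ E := by
  classical
  have hex : ∃ i, t ≤ b i := ⟨N, htN⟩
  refine ⟨Nat.find hex, Nat.find_min' hex htN, ?_⟩
  have h1 := Nat.find_spec hex
  have h2 : Nat.find hex ≤ N := Nat.find_min' hex htN
  rcases hn : Nat.find hex with _ | i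
  · rw [hn] at h1
    rw [abs_le]; omega
  · rw [hn] at h1 h2
    have h3 := Nat.find_min hex (m := i) (by omega)
    have h4 := hstep i (by omega)
    rw [abs_le]; omega

theorem exists_close_pair {a b : ℕ → ℤ} {N : ℕ} {o E : ℤ} (ha0 : |a 0 - o| ≤ E)
    (hb0 : |b 0 - o| ≤ E) (ha : ∀ i < N, |a (i + 1) - a i| ≤ E)
    (hb : ∀ i < N, |b (i + 1) - b i| ≤ E) (hside : o ≤ a N ↔ o ≤ b N) :
    ∃ i ≤ N, |a N - b i| ≤ E ∨ |b N - a i| ≤ E := by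
  wlog hpos : o ≤ a N generalizing a b o
  · obtain ⟨i, hi, h⟩ := this (a := fun i => - a i) (b := fun i => - b i) (o := -o)
      (by rw [← abs_neg]; convert ha0 using 2; ring) (by rw [← abs_neg]; convert hb0 using 2; ring)
      (fun i hi => by rw [← abs_neg]; convert ha i hi using 2; ring)
      (fun i hi => by rw [← abs_neg]; convert hb i hi using 2; ring)
      (by have : ¬ o ≤ b N := fun h => hpos (hside.2 h)
          constructor <;> intro <;> omega) (by omega)
    refine ⟨i, hi, h.imp (fun h => ?_) (fun h => ?_)⟩ <;>
    · rw [← abs_neg]; convert h using 2; ring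
  rcases le_total (a N) (b N) with h | h
  · obtain ⟨i, hi, hclose⟩ := exists_close_of_steps (le_of_abs_le hb0)
      (fun i hi => le_of_abs_le (hb i hi)) hpos h
    exact ⟨i, hi, Or.inl hclose⟩
  · obtain ⟨i, hi, hclose⟩ := exists_close_of_steps (le_of_abs_le ha0)
      (fun i hi => le_of_abs_le (ha i hi)) (hside.1 hpos) h
    exact ⟨i, hi, Or.inr hclose⟩

/-- Three coarse rays in `ℤ` with nearby origins cannot diverge pairwise. -/
theorem exists_close_of_three {a : Fin 3 → ℕ → ℤ} {N : ℕ} {o E : ℤ}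
    (h0 : ∀ k, |a k 0 - o| ≤ E) (hstep : ∀ k, ∀ i < N, |a k (i + 1) - a k i| ≤ E) :
    ∃ j k, j ≠ k ∧ ∃ i ≤ N, |a j N - a k i| ≤ E := by
  have hpair : ∃ j k, j ≠ k ∧ (o ≤ a j N ↔ o ≤ a k N) := by
    by_cases h1 : o ≤ a 0 N <;> by_cases h2 : o ≤ a 1 N
    · exact ⟨0, 1, by decide, by simp [h1, h2]⟩
    · by_cases h3 : o ≤ a 2 N
      · exact ⟨0, 2, by decide, by simp [h1, h3]⟩
      · exact ⟨1, 2, by decide, by simp [h2, h3]⟩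
    · by_cases h3 : o ≤ a 2 N
      · exact ⟨1, 2, by decide, by simp [h2, h3]⟩
      · exact ⟨0, 2, by decide, by simp [h1, h3]⟩
    · exact ⟨0, 1, by decide, by simp [h1, h2]⟩
  obtain ⟨j, k, hjk, hs⟩ := hpair
  obtain ⟨i, hi, h | h⟩ := exists_close_pair (h0 j) (h0 k) (hstep j) (hstep k) hs
  · exact ⟨j, k, hjk, i, hi, h⟩
  · exact ⟨k, j, hjk.symm, i, hi, h⟩

end Rays

section Asymptotic

variable {V W : Type} {Γ : SimpleGraph V} {Λ : SimpleGraph W}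

/-- Up to sublinear error, `φ` maps the line `x⟨w⟩` into `L`. -/
def Asym (φ : Raag Λ → Raag Γ) (L : Set (Raag Γ)) (x : Raag Λ) (w : W) : Prop :=
  ∀ M : ℕ, ∃ C : ℕ, ∀ h : ℤ, ∃ q ∈ L, M * nd (φ (x * raagGen Λ w ^ h)) q ≤ h.natAbs + C

theorem nd_line (h : Raag Γ) (l : V) (a b : ℤ) :
    nd (h * raagGen Γ l ^ a) (h * raagGen Γ l ^ b) = (b - a).natAbs := by
  refine le_antisymm (nd_gen_zpow_zpow _ _ _ _) ?_
  have := ex_sub_le l (h * raagGen Γ l ^ a) (h * raagGen Γ l ^ b)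
  simp only [ex_mul, ex_zpow, ex_gen_self, mul_one] at this
  omega

theorem mem_line {h q : Raag Γ} {l : V} (hq : q ∈ cs Γ h {l}) : ∃ a : ℤ, q = h * raagGen Γ l ^ a := by
  obtain ⟨a, e⟩ := mem_subRaag_singleton (mem_cs.1 hq)
  exact ⟨a, by rw [← e]; group⟩

/-- A line of `A(Γ)` determines the direction of the lines of `A(Λ)` asymptotic to it. -/
theorem Asym.unique {φ : Raag Λ → Raag Γ} {K : ℕ} (hφ : QE K φ) {h : Raag Γ} {l : V}
    {x y : Raag Λ} {w v : W} (hw : Asym φ (cs Γ h {l}) x w) (hv : Asym φ (cs Γ h {l}) y v) :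
    w = v := by
  by_contra hne
  set M := 8 * K + 8 with hM
  obtain ⟨C1, hC1⟩ := hw M
  obtain ⟨C2, hC2⟩ := hv M
  set D := nd x y with hD
  set X := D + 3 * K * K + K * K * D + K with hX
  set N := C1 + C2 + 2 * X + 1 with hN
  set e := (N + C1 + C2) / M with he
  have heM : M * e ≤ N + C1 + C2 := Nat.mul_div_le _ _
  set r : Fin 3 → ℕ → Raag Λ := ![fun i => x * raagGen Λ w ^ (i : ℤ),
    fun i => x * raagGen Λ w ^ (-(i : ℤ)), fun i => y * raagGen Λ v ^ (i : ℤ)] with hr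
  have hnear : ∀ k : Fin 3, ∀ i ≤ N, ∃ a : ℤ, nd (φ (r k i)) (h * raagGen Γ l ^ a) ≤ e := by
    intro k i hi
    have : ∃ q ∈ cs Γ h {l}, M * nd (φ (r k i)) q ≤ N + C1 + C2 := by
      fin_cases k
      · obtain ⟨q, hq, hq'⟩ := hC1 i
        exact ⟨q, hq, hq'.trans (by omega)⟩
      · obtain ⟨q, hq, hq'⟩ := hC1 (-i)
        exact ⟨q, hq, hq'.trans (by omega)⟩
      · obtain ⟨q, hq, hq'⟩ := hC2 i
        exact ⟨q, hq, hq'.trans (by omega)⟩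
    obtain ⟨q, hq, hq'⟩ := this
    obtain ⟨a, rfl⟩ := mem_line hq
    exact ⟨a, (Nat.le_div_iff_mul_le (by omega)).2 (by rwa [mul_comm])⟩
  have hch : ∀ k : Fin 3, ∀ i : ℕ, ∃ a : ℤ, i ≤ N → nd (φ (r k i)) (h * raagGen Γ l ^ a) ≤ e := by
    intro k i
    by_cases hi : i ≤ N
    · obtain ⟨a, ha⟩ := hnear k i hi
      exact ⟨a, fun _ => ha⟩
    · exact ⟨0, fun h => absurd h hi⟩
  choose a ha using hch
  have hcoord : ∀ j k : Fin 3, ∀ i i', i ≤ N → i' ≤ N →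
      |a j i - a k i'| ≤ (2 * e + (K * nd (r k i') (r j i) + K) : ℕ) := by
    intro j k i i' hi hi'
    have t1 := nd_triangle (h * raagGen Γ l ^ a k i') (φ (r k i')) (h * raagGen Γ l ^ a j i)
    have t2 := nd_triangle (φ (r k i')) (φ (r j i)) (h * raagGen Γ l ^ a j i)
    rw [nd_line, nd_comm] at t1
    have t3 := ha j i hi
    have t4 := ha k i' hi'
    have t5 := (hφ (r k i') (r j i)).1
    rw [Int.abs_eq_natAbs]
    exact_mod_cast (by omega)
  have hr0 : ∀ k, nd (r 0 0) (r k 0) ≤ D := by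
    intro k
    fin_cases k <;> simp [hr, hD]
  have hrstep : ∀ k i, nd (r k i) (r k (i + 1)) ≤ 1 := by
    intro k i
    fin_cases k <;> refine (nd_gen_zpow_zpow _ _ _ _).trans ?_ <;> push_cast <;> omega
  obtain ⟨j, k, hjk, i, hi, hclose⟩ := exists_close_of_three (a := a) (N := N) (o := a 0 0)
    (E := (2 * e + (2 * K + K * D + K) : ℕ)) (fun k => (hcoord k 0 0 0 (by omega) (by omega)).trans (by
      have := Nat.mul_le_mul_left K (hr0 k)
      exact_mod_cast (by omega))) (fun k i hi => (hcoord k k _ _ (by omega) (by omega)).trans (by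
      have := Nat.mul_le_mul_left K (hrstep k i)
      exact_mod_cast (by omega)))
  have hfar : N ≤ nd (r j N) (r k i) + D := by
    have hxy : ∀ u, (ex u y - ex u x).natAbs ≤ D := fun u => ex_sub_le u x y
    have w1 := hxy w
    have w2 := hxy v
    have z1 := ex_sub_le w (r j N) (r k i)
    have z2 := ex_sub_le v (r j N) (r k i)
    fin_cases j <;> fin_cases k <;> first | exact absurd rfl hjk | skip
    all_goals
      simp [hr, ex_mul, ex_gen_self, ex_gen_ne hne, ex_gen_ne (Ne.symm hne)] at z1 z2 ⊢
      omega
  have hnd : nd (φ (r j N)) (φ (r k i)) ≤ 4 * e + (2 * K + K * D + K) := by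
    have t1 := nd_triangle (φ (r j N)) (h * raagGen Γ l ^ a j N) (φ (r k i))
    have t2 := nd_triangle (h * raagGen Γ l ^ a j N) (h * raagGen Γ l ^ a k i) (φ (r k i))
    rw [nd_line, nd_comm (h * raagGen Γ l ^ a k i)] at t2
    have t3 := ha j N le_rfl
    have t4 := ha k i hi
    rw [abs_sub_comm, Int.abs_eq_natAbs] at hclose
    have := Int.ofNat_le.1 hclose
    omega
  have hfin := (hφ (r j N) (r k i)).2
  have h1 : K * nd (φ (r j N)) (φ (r k i)) ≤ K * (4 * e + (2 * K + K * D + K)) :=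
    Nat.mul_le_mul_left _ hnd
  have h2 : 2 * (K * (4 * e + (2 * K + K * D + K))) + 2 * K + 2 * D ≤ M * e + 2 * X := by
    rw [hM, hX]; nlinarith [Nat.zero_le e]
  omega

end Asymptotic

section Separation

variable {V W : Type} {Γ : SimpleGraph V} {Λ : SimpleGraph W}

theorem exists_sep [Fintype V] [Finite W] {φ : Raag Λ → Raag Γ} {K : ℕ} (hφ : QE K φ) :
    ∃ C, ∀ (h : Raag Γ) (l : V), Sep C {y | φ y ∈ nb (2 * K) (cs Γ h {l})}
      (fun y => lside h {l} (φ y)) := by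
  choose C hC using fun l : V =>
    card_le_of_near hφ (B := ({l} : Set V)) (SimpleGraph.isClique_singleton _) (2 * K)
  refine ⟨∑ l, C l, fun h l => ⟨fun x y hx hxy => ?_, fun p ρ F hF => ?_⟩⟩
  · refine lside_eq_of_not_mem_nb hx ((hφ x y).1.trans ?_)
    have := Nat.mul_le_mul_left K hxy
    omega
  · refine (hC l h p ρ F hF).trans ?_
    rw [Set.ncard_singleton, pow_one]
    exact Nat.mul_le_mul_right _ (Finset.single_le_sum (f := C) (fun _ _ => Nat.zero_le _)
      (Finset.mem_univ l))

/-- Flat pieces of `A(Λ)` of dimension three, and products of a line with a free group in directions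
other than the asymptotic one, are not coarsely separated by lines of `A(Γ)`. -/
theorem exists_radius [Fintype V] [Finite W] {φ : Raag Λ → Raag Γ} {K : ℕ} (hφ : QE K φ) :
    ∃ R, ∀ (h : Raag Γ) (l : V) (x p q : Raag Λ), φ p ∉ nb R (cs Γ h {l}) →
      φ q ∉ nb R (cs Γ h {l}) →
      (∀ u1 u2 u3, Λ.Adj u1 u2 → Λ.Adj u1 u3 → Λ.Adj u2 u3 → p ∈ cs Λ x {u1, u2, u3} →
        q ∈ cs Λ x {u1, u2, u3} → lside h {l} (φ p) = lside h {l} (φ q)) ∧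
      (∀ u w u', u ≠ u' → ¬ Λ.Adj u u' → Λ.Adj w u → Λ.Adj w u' → p ∈ cs Λ x {u, w, u'} →
        q ∈ cs Λ x {u, w, u'} → lside h {l} (φ p) ≠ lside h {l} (φ q) →
        Asym φ (cs Γ h {l}) x w) := by
  obtain ⟨C, hC⟩ := exists_sep hφ
  obtain ⟨R, hR⟩ := exists_mul_pow_lt_two_pow (8 * C + 1) 1
  have hR' : 2 * C * (R + 4) + 1 ≤ 2 ^ R := by nlinarith [Nat.zero_le (C * R)]
  refine ⟨2 * K + (K * (3 * (16 * C + 2) + R) + K), fun h l x p q hp hq => ?_⟩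
  have hdeep : ∀ y, φ y ∉ nb (2 * K + (K * (3 * (16 * C + 2) + R) + K)) (cs Γ h {l}) →
      Deep (3 * (16 * C + 2) + R) {y | φ y ∈ nb (2 * K) (cs Γ h {l})} y := by
    intro y hy z hz
    by_contra! hcon
    refine hy (mem_nb_of_nd hz ((hφ z y).1.trans ?_))
    rw [nd_comm]
    exact Nat.add_le_add_right (Nat.mul_le_mul_left _ hcon) _
  refine ⟨fun u1 u2 u3 h12 h13 h23 hpx hqx => ?_, fun u w u' hne hadj hu hu' hpx hqx hcol M => ?_⟩
  · exact (hC h l).const_triangle h12 h13 h23 hpx hqx ((hdeep p hp).mono (by omega))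
      ((hdeep q hq).mono (by omega))
  · obtain ⟨C', hC'⟩ := (hC h l).asym hne hadj hu hu' hR' hpx hqx ((hdeep p hp).mono (by omega))
      ((hdeep q hq).mono (by omega)) hcol (M * K)
    refine ⟨C' + M * (3 * K), fun j => ?_⟩
    obtain ⟨z, ⟨y, hy, hzy⟩, hz⟩ := hC' j
    refine ⟨y, hy, ?_⟩
    have h1 := nd_triangle (φ (x * raagGen Λ w ^ j)) (φ z) y
    have h2 := (hφ (x * raagGen Λ w ^ j) z).1
    calc M * nd (φ (x * raagGen Λ w ^ j)) y
        ≤ M * (K * nd (x * raagGen Λ w ^ j) z + 3 * K) := Nat.mul_le_mul_left _ (by omega)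
      _ = M * K * nd (x * raagGen Λ w ^ j) z + M * (3 * K) := by ring
      _ ≤ _ := by omega

end Separation

section Blocks

variable {V W : Type} {Γ : SimpleGraph V} {Λ : SimpleGraph W} {α : Type*}

theorem color_eq_of_biconn [Finite W] {S : Set W} (hS : Biconn Λ S) (h3 : 3 ≤ S.ncard)
    {D : Set (Raag Λ)} {col : Raag Λ → α} {v : W} (hv : v ∈ S)
    (F1 : ∀ x u1 u2 u3, Λ.Adj u1 u2 → Λ.Adj u1 u3 → Λ.Adj u2 u3 → ∀ p ∈ cs Λ x {u1, u2, u3},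
      ∀ q ∈ cs Λ x {u1, u2, u3}, p ∈ D → q ∈ D → col p = col q)
    (F2 : ∀ x u w u', w ∈ S → w ≠ v → u ≠ u' → ¬ Λ.Adj u u' → Λ.Adj w u → Λ.Adj w u' →
      ∀ p ∈ cs Λ x {u, w, u'}, ∀ q ∈ cs Λ x {u, w, u'}, p ∈ D → q ∈ D → col p = col q)
    (F3 : ∀ x u u', Λ.Adj u u' → ∃ p ∈ cs Λ x {u, u'}, p ∈ D) {g y y' : Raag Λ}
    (hy : y ∈ cs Λ g S) (hy' : y' ∈ cs Λ g S) (hyD : y ∈ D) (hyD' : y' ∈ D) :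
    col y = col y' := by
  have F12 : ∀ x w u u', w ∈ S → w ≠ v → u ≠ u' → Λ.Adj w u → Λ.Adj w u' →
      ∀ p ∈ cs Λ x {w, u}, ∀ q ∈ cs Λ x {w, u'}, p ∈ D → q ∈ D → col p = col q := by
    intro x w u u' hw hwv hne hu hu' p hp q hq hpD hqD
    by_cases hadj : Λ.Adj u u'
    · exact F1 x w u u' hu hu' hadj p (cs_mono (by simp [Set.insert_subset_iff]) x hp) q
        (cs_mono (by simp [Set.insert_subset_iff]) x hq) hpD hqD
    · exact F2 x u w u' hw hwv hne hadj hu hu' p (cs_mono (by simp [Set.insert_subset_iff]) x hp) q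
        (cs_mono (by simp) x hq) hpD hqD
  have F12' : ∀ x w u u', w ∈ S → w ≠ v → Λ.Adj w u → Λ.Adj w u' →
      ∀ p ∈ cs Λ x {w, u}, ∀ q ∈ cs Λ x {w, u'}, p ∈ D → q ∈ D → col p = col q := by
    intro x w u u' hw hwv hu hu' p hp q hq hpD hqD
    by_cases hne : u = u'
    · subst hne
      obtain ⟨a, -, b, -, hab, ha, hb⟩ := hS.exists_two_adj h3 hw
      obtain ⟨c, hc, hcu⟩ : ∃ c, Λ.Adj w c ∧ c ≠ u := by
        by_cases h : a = u
        · exact ⟨b, hb, fun h' => hab (h.trans h'.symm)⟩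
        · exact ⟨a, ha, h⟩
      obtain ⟨r, hr, hrD⟩ := F3 x w c hc
      rw [F12 x w u c hw hwv hcu.symm hu hc p hp r hr hpD hrD,
        F12 x w u c hw hwv hcu.symm hu hc q hq r hr hqD hrD]
    · exact F12 x w u u' hw hwv hne hu hu' p hp q hq hpD hqD
  set Good : Raag Λ → α → Prop := fun x c => ∀ w ∈ S, w ≠ v → ∀ u, Λ.Adj w u →
    ∀ p ∈ cs Λ x {w, u}, p ∈ D → col p = c with hGood
  obtain ⟨w0, hw0, -, -, -, hvw0, -⟩ := hS.exists_two_adj h3 hv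
  have hgood : ∀ x, ∃ c, Good x c := by
    intro x
    obtain ⟨p0, hp0, hp0D⟩ := F3 x w0 v hvw0.symm
    refine ⟨col p0, ?_⟩
    have hpre := hS.2 v hv
    have hind : ∀ a b : ↥(S \ {v}), (Λ.induce (S \ {v})).Reachable a b →
        (∀ u, Λ.Adj a u → ∀ p ∈ cs Λ x {a.1, u}, p ∈ D → col p = col p0) →
        (∀ u, Λ.Adj b u → ∀ p ∈ cs Λ x {b.1, u}, p ∈ D → col p = col p0) := by
      rintro a b ⟨wk⟩ ha
      induction wk with
      | nil => exact ha
      | @cons a b c hab _ ih =>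
        refine ih fun u hu p hp hpD => ?_
        have hab' : Λ.Adj a.1 b.1 := hab
        obtain ⟨q, hq, hqD⟩ := F3 x a.1 b.1 hab'
        rw [← ha b.1 hab' q hq hqD]
        exact F12' x b.1 u a.1 b.2.1 b.2.2 hu hab'.symm p hp q (by rwa [Set.pair_comm]) hpD hqD
    intro w hw hwv
    exact hind ⟨w0, hw0, hvw0.ne'⟩ ⟨w, hw, hwv⟩ (hpre _ _) fun u hu p hp hpD =>
      F12' x w0 u v hw0 hvw0.ne' hu hvw0.symm p hp p0 hp0 hpD hp0D
  have hshift : ∀ x x' c w u, w ∈ S → w ≠ v → Λ.Adj w u → x' ∈ cs Λ x {w, u} → Good x c →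
      Good x' c := by
    intro x x' c w u hw hwv hu hx' hx
    obtain ⟨c', hc'⟩ := hgood x'
    obtain ⟨p, hp, hpD⟩ := F3 x w u hu
    have e1 := hx w hw hwv u hu p hp hpD
    have e2 := hc' w hw hwv u hu p (by rwa [cs_eq_of_mem hx']) hpD
    rwa [← e1, e2]
  have hletter : ∀ x c s b, s ∈ S → Good x c → Good (x * ev Λ [(s, b)]) c := by
    intro x c s b hs hx
    have key : ∃ w u, w ∈ S ∧ w ≠ v ∧ Λ.Adj w u ∧ s ∈ ({w, u} : Set W) := by
      by_cases hsv : s = v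
      · exact ⟨w0, v, hw0, hvw0.ne', hvw0.symm, by simp [hsv]⟩
      · obtain ⟨u, -, -, -, -, hu, -⟩ := hS.exists_two_adj h3 hs
        exact ⟨s, u, hs, hsv, hu, by simp⟩
    obtain ⟨w, u, hw, hwv, hu, hsw⟩ := key
    exact hshift x _ c w u hw hwv hu (mul_mem_cs (self_mem_cs _ _) (ev_mem (by simpa using hsw))) hx
  have hword : ∀ l : List (W × Bool), (∀ s ∈ l, s.1 ∈ S) → ∀ x c, Good x c →
      Good (x * ev Λ l) c := by
    intro l
    induction l with
    | nil => intro _ x c hx; simpa using hx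
    | cons s l ih =>
      intro hl x c hx
      rw [ev_cons, ← mul_assoc]
      exact ih (fun t ht => hl t (List.mem_cons_of_mem _ ht)) _ _
        (hletter x c s.1 s.2 (hl s List.mem_cons_self) hx)
  obtain ⟨c, hc⟩ := hgood g
  have hfin : ∀ y ∈ cs Λ g S, y ∈ D → col y = c := by
    intro y hy hyD
    obtain ⟨l, hl, e⟩ := exists_word (mem_cs.1 hy)
    have := hword l hl g c hc
    rw [e, mul_inv_cancel_left] at this
    exact this w0 hw0 hvw0.ne' v hvw0.symm y (self_mem_cs _ _) hyD
  rw [hfin y hy hyD, hfin y' hy' hyD']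

theorem exists_far_in_flat [Finite V] [Finite W] {φ : Raag Λ → Raag Γ} {K : ℕ} (hφ : QE K φ)
    (R : ℕ) (h : Raag Γ) (l : V) (x : Raag Λ) {u u' : W} (hu : Λ.Adj u u') :
    ∃ p ∈ cs Λ x {u, u'}, φ p ∉ nb R (cs Γ h {l}) := by
  have := not_subset_of_card_lt hφ (B := {l}) (SimpleGraph.isClique_singleton _) (S := {u, u'})
    (isClique_pair hu) (by rw [Set.ncard_singleton, Set.ncard_pair hu.ne]; omega) R h x
  rw [Set.not_subset] at this
  obtain ⟨_, ⟨p, hp, rfl⟩, h⟩ := this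
  exact ⟨p, hp, h⟩

/-- Blocks of `Λ` with at least three vertices are mapped near pieces of `A(Γ)`. -/
theorem exists_piece_of_biconn [Fintype V] [Fintype W] [Nontrivial V] (hΓ : Γ.Connected)
    {φ : Raag Λ → Raag Γ} {K : ℕ} (hφ : QE K φ) :
    ∃ R, ∀ (S : Set W), Biconn Λ S → 3 ≤ S.ncard → ∀ g : Raag Λ, ∃ h B, MaxBiconn Γ B ∧
      φ '' cs Λ g S ⊆ nb R (cs Γ h B) := by
  classical
  obtain ⟨R, hR⟩ := exists_radius hφ
  refine ⟨R, fun S hS h3 g => exists_piece hΓ (Y := φ '' cs Λ g S) ⟨φ g, g, self_mem_cs _ _, rfl⟩ R ?_⟩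
  rintro h l _ ⟨y, hy, rfl⟩ _ ⟨y', hy', rfl⟩ hd hd'
  have hv : ∃ v ∈ S, ∀ w ∈ S, ∀ x, Asym φ (cs Γ h {l}) x w → w = v := by
    by_cases hex : ∃ w ∈ S, ∃ x, Asym φ (cs Γ h {l}) x w
    · obtain ⟨w, hw, x, hx⟩ := hex
      exact ⟨w, hw, fun w' _ x' hx' => hx'.unique hφ hx⟩
    · obtain ⟨w, hw⟩ := Set.nonempty_of_ncard_ne_zero (by omega : S.ncard ≠ 0)
      exact ⟨w, hw, fun w' hw' x hx => absurd ⟨w', hw', x, hx⟩ hex⟩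
  obtain ⟨v, hvS, hv⟩ := hv
  refine color_eq_of_biconn (col := fun y => lside h {l} (φ y)) hS h3
    (D := {y | φ y ∉ nb R (cs Γ h {l})}) hvS ?_ ?_ ?_ hy hy' hd hd'
  · intro x u1 u2 u3 h12 h13 h23 p hp q hq hpD hqD
    exact (hR h l x p q hpD hqD).1 u1 u2 u3 h12 h13 h23 hp hq
  · intro x u w u' hw hwv hne hadj hu hu' p hp q hq hpD hqD
    by_contra hcol
    exact hwv (hv w hw x ((hR h l x p q hpD hqD).2 u w u' hne hadj hu hu' hp hq hcol))
  · exact fun x u u' huu' => exists_far_in_flat hφ R h l x huu'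

end Blocks

section Pair

variable {V W : Type} {Γ : SimpleGraph V} {Λ : SimpleGraph W}

/-- A pair of coarsely inverse quasi-isometries with a single natural constant. -/
structure QIPair (K : ℕ) (f : Raag Λ → Raag Γ) (g : Raag Γ → Raag Λ) : Prop where
  left : QE K f
  right : QE K g
  apply_right : ∀ y, nd (f (g y)) y ≤ K
  apply_left : ∀ x, nd (g (f x)) x ≤ K

theorem QIPair.symm {K : ℕ} {f : Raag Λ → Raag Γ} {g : Raag Γ → Raag Λ} (h : QIPair K f g) :
    QIPair K g f := ⟨h.right, h.left, h.apply_left, h.apply_right⟩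

theorem exists_pair [Finite V] [Finite W] (h : RaagQI Λ Γ) :
    ∃ (K : ℕ) (f : Raag Λ → Raag Γ) (g : Raag Γ → Raag Λ), QIPair K f g := by
  obtain ⟨f, K, A, hK, hA, hf, hs⟩ := h
  simp only [raagDist_eq_nd] at hf hs
  set k := ⌈K⌉₊ + ⌈A⌉₊ + ⌈K * A⌉₊ with hk
  have k1 : K ≤ ⌈K⌉₊ := Nat.le_ceil _
  have k2 : A ≤ ⌈A⌉₊ := Nat.le_ceil _
  have k3 : K * A ≤ ⌈K * A⌉₊ := Nat.le_ceil _
  have kk : (k : ℝ) = ⌈K⌉₊ + ⌈A⌉₊ + ⌈K * A⌉₊ := by rw [hk]; push_cast; ring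
  have hKA : 0 ≤ K * A := by positivity
  have hQ : QE k f := by
    refine fun x y => ⟨?_, ?_⟩
    · have h1 := (hf x y).2
      have h2 : K * (nd x y : ℝ) ≤ k * nd x y := mul_le_mul_of_nonneg_right (by linarith) (by positivity)
      have : (nd (f x) (f y) : ℝ) ≤ k * nd x y + k := by linarith
      exact_mod_cast this
    · have h1 := (hf x y).1
      have h3 : (nd x y : ℝ) ≤ K * (nd (f x) (f y) + A) := by
        rw [mul_comm, ← div_le_iff₀ (by linarith)]; linarith
      have h2 : K * (nd (f x) (f y) : ℝ) ≤ k * nd (f x) (f y) :=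
        mul_le_mul_of_nonneg_right (by linarith) (by positivity)
      have : (nd x y : ℝ) ≤ k * nd (f x) (f y) + k := by linarith
      exact_mod_cast this
  have hS : ∀ y, ∃ x, nd (f x) y ≤ k := by
    intro y
    obtain ⟨x, hx⟩ := hs y
    exact ⟨x, by have : (nd (f x) y : ℝ) ≤ k := by linarith
                 exact_mod_cast this⟩
  choose g hg using hS
  refine ⟨2 * k * k + 3 * k, f, g, ⟨fun x y => ⟨?_, ?_⟩, fun y y' => ⟨?_, ?_⟩, fun y => ?_, fun x => ?_⟩⟩
  · nlinarith [(hQ x y).1, Nat.zero_le (k * k * nd x y), Nat.zero_le (k * nd x y)]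
  · nlinarith [(hQ x y).2, Nat.zero_le (k * k * nd (f x) (f y)), Nat.zero_le (k * nd (f x) (f y))]
  · have h1 := (hQ (g y) (g y')).2
    have h2 := nd_triangle (f (g y)) y (f (g y'))
    have h3 := nd_triangle y y' (f (g y'))
    rw [nd_comm y'] at h3
    have h4 := hg y
    have h5 := hg y'
    have h6 : k * nd (f (g y)) (f (g y')) ≤ k * (nd y y' + 2 * k) :=
      Nat.mul_le_mul_left _ (by omega)
    nlinarith [Nat.zero_le (k * k * nd y y'), Nat.zero_le (k * nd y y')]
  · have h1 := (hQ (g y) (g y')).1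
    have h2 := nd_triangle y (f (g y)) y'
    have h3 := nd_triangle (f (g y)) (f (g y')) y'
    rw [nd_comm y (f (g y))] at h2
    have h4 := hg y
    have h5 := hg y'
    nlinarith [Nat.zero_le (k * k * nd (g y) (g y')), Nat.zero_le (k * nd (g y) (g y'))]
  · nlinarith [hg y]
  · have h1 := (hQ (g (f x)) x).2
    have h2 : k * nd (f (g (f x))) (f x) ≤ k * k := Nat.mul_le_mul_left _ (hg _)
    nlinarith

theorem mem_cs_univ (h x : Raag Γ) : x ∈ cs Γ h Set.univ := by
  obtain ⟨l, e⟩ := ev_surjective (h⁻¹ * x)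
  rw [mem_cs, ← e]
  exact ev_mem fun _ _ => Set.mem_univ _

end Pair

section Connectivity

variable {V W : Type} {Γ : SimpleGraph V} {Λ : SimpleGraph W} {α : Type*}

theorem lside_gen_pow {T : Set V} {w : V} (hw : w ∉ T) (k : ℕ) :
    lside 1 T (raagGen Γ w ^ (k + 1)) = some (cmp Γ T w) := by
  have hev : ∀ j : ℕ, ev Γ (List.replicate j (w, true)) = raagGen Γ w ^ j := by
    intro j
    induction j with
    | zero => simp [ev_nil]
    | succ j ih => rw [List.replicate_succ, ev_cons, ih, ev_true, pow_succ']
  have e : raagGen Γ w ^ (k + 1) = 1 * ev Γ [(w, true)] * ev Γ (List.replicate k (w, true)) := by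
    rw [hev, ev_true, pow_succ', one_mul]
  rw [e, lside_path, lside_exit (self_mem_cs _ _) hw]
  intro l' hl' hmem
  obtain ⟨j, rfl⟩ : ∃ j, l' = List.replicate j (w, true) := by
    exact ⟨_, (List.prefix_replicate_iff.1 hl').2⟩
  have := ex_eq_zero hw (mem_cs.1 hmem)
  rw [hev, ev_true] at this
  simp only [inv_one, ex_mul, ex_one, ex_gen_self, ex_pow] at this
  have : (1 : ℤ) + j = 0 := by simpa using this
  omega

theorem color_eq_of_connected (hΛ : Λ.Connected) [Nontrivial W]
    {D : Set (Raag Λ)} {col : Raag Λ → α}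
    (F1 : ∀ x u u', Λ.Adj u u' → ∀ p ∈ cs Λ x {u, u'},
      ∀ q ∈ cs Λ x {u, u'}, p ∈ D → q ∈ D → col p = col q)
    (F3 : ∀ x u, ∃ p ∈ cs Λ x {u}, p ∈ D) {y y' : Raag Λ} (hyD : y ∈ D) (hyD' : y' ∈ D) :
    col y = col y' := by
  set Good : Raag Λ → α → Prop := fun x c => ∀ u, ∀ p ∈ cs Λ x {u}, p ∈ D → col p = c with hGood
  have hadj : ∀ u, ∃ u', Λ.Adj u u' := fun u => hΛ.preconnected.exists_adj_of_nontrivial u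
  have hsub1 : ∀ x (u u' : W), cs Λ x {u} ⊆ cs Λ x {u, u'} := fun x u u' =>
    cs_mono (by simp) x
  have hsub2 : ∀ x (u u' : W), cs Λ x {u'} ⊆ cs Λ x {u, u'} := fun x u u' =>
    cs_mono (by simp) x
  obtain ⟨w0⟩ := hΛ.nonempty
  have hgood : ∀ x, ∃ c, Good x c := by
    intro x
    obtain ⟨p0, hp0, hp0D⟩ := F3 x w0
    refine ⟨col p0, fun u => ?_⟩
    have hind : ∀ a b : W, Λ.Reachable a b → (∀ p ∈ cs Λ x {a}, p ∈ D → col p = col p0) →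
        (∀ p ∈ cs Λ x {b}, p ∈ D → col p = col p0) := by
      rintro a b ⟨wk⟩ ha
      induction wk with
      | nil => exact ha
      | @cons a b c hab _ ih =>
        refine ih fun p hp hpD => ?_
        obtain ⟨q, hq, hqD⟩ := F3 x a
        rw [← ha q hq hqD]
        exact F1 x a b hab p (hsub2 _ _ _ hp) q (hsub1 _ _ _ hq) hpD hqD
    refine hind w0 u (hΛ.preconnected _ _) fun p hp hpD => ?_
    obtain ⟨u', hu'⟩ := hadj w0
    exact F1 x w0 u' hu' p (hsub1 _ _ _ hp) p0 (hsub1 _ _ _ hp0) hpD hp0D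
  have hletter : ∀ x c (s : W × Bool), Good x c → Good (x * ev Λ [s]) c := by
    intro x c s hx
    obtain ⟨c', hc'⟩ := hgood (x * ev Λ [s])
    obtain ⟨p, hp, hpD⟩ := F3 x s.1
    have hx' : x * ev Λ [s] ∈ cs Λ x {s.1} := mul_mem_cs (self_mem_cs _ _) (ev_mem (by simp))
    have e2 := hc' s.1 p (by rwa [cs_eq_of_mem hx']) hpD
    rwa [← hx s.1 p hp hpD, e2]
  have hword : ∀ l : List (W × Bool), ∀ x c, Good x c → Good (x * ev Λ l) c := by
    intro l
    induction l with
    | nil => intro x c hx; simpa using hx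
    | cons s l ih =>
      intro x c hx
      rw [ev_cons, ← mul_assoc]
      exact ih _ _ (hletter x c s hx)
  obtain ⟨c, hc⟩ := hgood 1
  have hfin : ∀ y, y ∈ D → col y = c := by
    intro y hyD
    obtain ⟨l, e⟩ := ev_surjective y
    have := hword l 1 c hc
    rw [one_mul, e] at this
    exact this w0 y (self_mem_cs _ _) hyD
  rw [hfin y hyD, hfin y' hyD']

theorem color_eq_of_flat {C : ℕ} {Z : Set (Raag Λ)} {col : Raag Λ → α}
    (step : ∀ x y, x ∉ Z → nd x y ≤ 1 → col x = col y)
    (count : ∀ F : Finset (Raag Λ), (∀ y ∈ F, y ∈ Z) → F.card ≤ C)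
    {x p q : Raag Λ} {u u' : W} (hu : Λ.Adj u u') (hp : p ∈ cs Λ x {u, u'})
    (hq : q ∈ cs Λ x {u, u'}) (hpD : Deep C Z p) (hqD : Deep C Z q) : col p = col q := by
  classical
  set P : ℤ → ℤ → Raag Λ := fun a b => x * (raagGen Λ u' ^ b * raagGen Λ u ^ a) with hP
  have hc := gen_comm hu
  have hrep : ∀ y ∈ cs Λ x {u, u'}, ∃ a b, y = P a b := by
    intro y hy
    obtain ⟨a, y1, hy1, e1⟩ := mem_subRaag_insert (B := {u'}) (by
      rintro t rfl _
      exact hu) (mem_cs.1 hy)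
    obtain ⟨b, e2⟩ := mem_subRaag_singleton hy1
    exact ⟨a, b, by simp only [hP]; rw [← e2, ← e1]; group⟩
  have hdist : ∀ a b a' b', nd (P a b) (P a' b') ≤ (a' - a).natAbs + (b' - b).natAbs := by
    intro a b a' b'
    have e : P a' b' = P a b * raagGen Λ u ^ (a' - a) * raagGen Λ u' ^ (b' - b) := by
      have h1 : Commute (raagGen Λ u ^ a') (raagGen Λ u' ^ (b' - b)) := (hc.zpow_zpow _ _)
      simp only [hP]
      calc x * (raagGen Λ u' ^ b' * raagGen Λ u ^ a')
          = x * (raagGen Λ u' ^ b * (raagGen Λ u' ^ (b' - b) * raagGen Λ u ^ a')) := by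
            rw [← mul_assoc (raagGen Λ u' ^ b), ← zpow_add]; congr 4; ring
        _ = x * (raagGen Λ u' ^ b * (raagGen Λ u ^ a' * raagGen Λ u' ^ (b' - b))) := by rw [h1.eq]
        _ = _ := by
            have : raagGen Λ u ^ a' = raagGen Λ u ^ a * raagGen Λ u ^ (a' - a) := by
              rw [← zpow_add]; congr 1; ring
            rw [this]; simp only [mul_assoc]
    rw [e]
    refine (nd_triangle _ (P a b * raagGen Λ u ^ (a' - a)) _).trans ?_
    exact Nat.add_le_add (nd_gen_zpow _ _ _) (nd_gen_zpow _ _ _)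
  have hinj : ∀ a b a' b', P a b = P a' b' → a = a' ∧ b = b' := by
    intro a b a' b' e
    have e' : raagGen Λ u' ^ b * raagGen Λ u ^ a = raagGen Λ u' ^ b' * raagGen Λ u ^ a' :=
      mul_left_cancel e
    have e1 := congrArg (ex u) e'
    have e2 := congrArg (ex u') e'
    simp only [ex_mul, ex_zpow, ex_gen_self, ex_gen_ne hu.ne, ex_gen_ne hu.ne'] at e1 e2
    constructor <;> linarith
  have hcard : ∀ G : Finset (ℤ × ℤ), (∀ z ∈ G, P z.1 z.2 ∈ Z) → G.card ≤ C := by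
    intro G hG
    rw [← Finset.card_image_of_injective G (f := fun z : ℤ × ℤ => P z.1 z.2)
      (fun z z' e => by obtain ⟨h1, h2⟩ := hinj _ _ _ _ e; exact Prod.ext h1 h2)]
    refine count _ fun y hy => ?_
    obtain ⟨z, hz, rfl⟩ := Finset.mem_image.1 hy
    exact hG z hz
  have hfin : {z : ℤ × ℤ | P z.1 z.2 ∈ Z}.Finite := by
    by_contra hinf
    obtain ⟨G, hG, hGc⟩ := Set.Infinite.exists_subset_card_eq hinf (C + 1)
    have := hcard G fun z hz => hG hz
    omega
  have hmem : ∀ a b, (a, b) ∈ hfin.toFinset ↔ P a b ∈ Z := fun a b => by simp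
  have hZc : hfin.toFinset.card ≤ C := hcard _ fun z hz => (hmem _ _).1 hz
  obtain ⟨a, b, rfl⟩ := hrep p hp
  obtain ⟨a', b', rfl⟩ := hrep q hq
  refine plane_const (col := fun a b => col (P a b)) (Z := hfin.toFinset) ?_ ?_ ?_ ?_
  · intro a b h
    refine step _ _ (fun h' => h ((hmem _ _).2 h')) ((hdist _ _ _ _).trans ?_)
    simp
  · intro a b h
    refine step _ _ (fun h' => h ((hmem _ _).2 h')) ((hdist _ _ _ _).trans ?_)
    simp
  · intro i j hij
    have h1 := hpD _ ((hmem _ _).1 hij)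
    have h2 := hdist a b i j
    rw [Int.abs_eq_natAbs, Int.abs_eq_natAbs]
    omega
  · intro i j hij
    have h1 := hqD _ ((hmem _ _).1 hij)
    have h2 := hdist a' b' i j
    rw [Int.abs_eq_natAbs, Int.abs_eq_natAbs]
    omega

/-- Connectivity of the defining graph is a quasi-isometry invariant. -/
theorem QIPair.connected [Finite V] [Finite W] [Nonempty V] [Nontrivial W] (hΛ : Λ.Connected)
    {φ : Raag Λ → Raag Γ} {ψ : Raag Γ → Raag Λ} {K : ℕ} (h : QIPair K φ ψ) : Γ.Connected := by
  rw [SimpleGraph.connected_iff]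
  refine ⟨?_, ‹_›⟩
  have hpre : (Γ.induce Set.univ).Preconnected := by
    rw [preconnected_induce_iff, Set.compl_univ]
    by_contra! hcon
    obtain ⟨w1, -, w2, -, hne⟩ := hcon
    have hφ := h.left
    have hcl : Γ.IsClique (∅ : Set V) := by simp
    obtain ⟨C, hC⟩ := card_le_of_near hφ hcl (2 * K)
    set Z : Set (Raag Λ) := {y | φ y ∈ nb (2 * K) (cs Γ 1 ∅)} with hZ
    set r := 2 * K + (K * C + K) with hr
    have hdeep : ∀ y, φ y ∉ nb r (cs Γ 1 ∅) → Deep C Z y := by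
      intro y hy z hz
      by_contra! hcon
      refine hy (mem_nb_of_nd hz ((hφ z y).1.trans ?_))
      rw [nd_comm]
      exact Nat.add_le_add_right (Nat.mul_le_mul_left _ hcon) _
    have hcount : ∀ F : Finset (Raag Λ), (∀ y ∈ F, y ∈ Z) → F.card ≤ C := by
      intro F hF
      have := hC 1 1 (F.sup (nd 1)) F fun y hy => ⟨Finset.le_sup (f := nd 1) hy, hF y hy⟩
      simpa using this
    have hstep : ∀ x y, x ∉ Z → nd x y ≤ 1 → lside 1 ∅ (φ x) = lside 1 ∅ (φ y) := by
      intro x y hx hxy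
      refine lside_eq_of_not_mem_nb hx ((hφ x y).1.trans ?_)
      have := Nat.mul_le_mul_left K hxy
      omega
    have hall : ∀ y y', φ y ∉ nb r (cs Γ 1 ∅) → φ y' ∉ nb r (cs Γ 1 ∅) →
        lside 1 ∅ (φ y) = lside 1 ∅ (φ y') := by
      intro y y' hy hy'
      refine color_eq_of_connected hΛ (D := {y | φ y ∉ nb r (cs Γ 1 ∅)})
        (col := fun y => lside 1 ∅ (φ y)) ?_ ?_ hy hy'
      · exact fun x u u' hu p hp q hq hpD hqD =>
          color_eq_of_flat hstep hcount hu hp hq (hdeep p hpD) (hdeep q hqD)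
      · intro x u
        have := not_subset_of_card_lt hφ hcl (S := {u}) (SimpleGraph.isClique_singleton _)
          (by simp) r 1 x
        rw [Set.not_subset] at this
        obtain ⟨_, ⟨p, hp, rfl⟩, h⟩ := this
        exact ⟨p, hp, h⟩
    have hpt : ∀ w, ∃ y, φ y ∉ nb r (cs Γ 1 ∅) ∧ lside 1 ∅ (φ y) = some (cmp Γ ∅ w) := by
      intro w
      set a := raagGen Γ w ^ (r + K + 1) with ha
      have hnb : ∀ r', r' ≤ r + K → a ∉ nb r' (cs Γ 1 ∅) := by
        rintro r' hr' ⟨q, hq, hd⟩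
        have hq1 : q = 1 := by simpa using mem_subRaag_empty (mem_cs.1 hq)
        have := ex_sub_le w q a
        rw [nd_comm] at this
        simp only [hq1, ha, ex_one, ex_pow, ex_gen_self] at this hd
        simp at this
        omega
      refine ⟨ψ a, fun hmem => ?_, ?_⟩
      · exact hnb _ le_rfl (mem_nb_of_nd hmem (h.apply_right a))
      · rw [← lside_eq_of_not_mem_nb (hnb K (by omega)) (by rw [nd_comm]; exact h.apply_right a)]
        exact lside_gen_pow (by simp) _
    obtain ⟨y1, hy1, e1⟩ := hpt w1
    obtain ⟨y2, hy2, e2⟩ := hpt w2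
    have := hall y1 y2 hy1 hy2
    rw [e1, e2] at this
    exact hne (Option.some.inj this)
  exact (SimpleGraph.Iso.preconnected_iff (SimpleGraph.induceUnivIso Γ)).1 hpre

end Connectivity

section Near

variable {V W : Type} {Γ : SimpleGraph V} {Λ : SimpleGraph W}

theorem qe_id : QE (Λ := Γ) 1 (id : Raag Γ → Raag Γ) := fun x y => by
  simp only [id]; constructor <;> omega

theorem QIPair.near_comp {K : ℕ} {f : Raag Λ → Raag Γ} {g : Raag Γ → Raag Λ} (h : QIPair K f g)
    {A Q : Set (Raag Λ)} {P : Set (Raag Γ)} {R R' : ℕ} (hA : f '' A ⊆ nb R P)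
    (hP : g '' P ⊆ nb R' Q) : A ⊆ nb (R' + (K * R + K) + K) Q := by
  intro a ha
  obtain ⟨p, hp, hd⟩ := hA ⟨a, ha, rfl⟩
  have h1 := (h.right p (f a)).1
  rw [nd_comm] at hd
  have h2 := Nat.mul_le_mul_left K hd
  exact mem_nb_of_nd (mem_nb_of_nd (hP ⟨p, hp, rfl⟩) (h1.trans (by omega))) (h.apply_left a)

theorem not_near_line [Finite V] [Finite W] {φ : Raag Λ → Raag Γ} {K : ℕ} (hφ : QE K φ)
    {T : Set W} (hT : 2 ≤ T.ncard) (r : ℕ) (x : Raag Λ) (p : Raag Γ) (l : V) :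
    ¬ φ '' cs Λ x T ⊆ nb r (cs Γ p {l}) := by
  by_cases hc : Λ.IsClique T
  · exact not_subset_of_card_lt hφ (SimpleGraph.isClique_singleton _) hc
      (by rw [Set.ncard_singleton]; omega) r p x
  · exact not_subset_of_not_clique hφ (SimpleGraph.isClique_singleton _) hc r p x

theorem _root_.MaxBiconn.two_le_ncard [Finite V] [Nontrivial V] (hΓ : Γ.Connected) {S : Set V}
    (hS : MaxBiconn Γ S) : 2 ≤ S.ncard := by
  obtain ⟨⟨a, ha⟩⟩ := hS.1.1.nonempty
  obtain ⟨b, hb, hne⟩ := hS.exists_ne hΓ a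
  exact (Set.one_lt_ncard (Set.toFinite S)).2 ⟨a, ha, b, hb, hne.symm⟩

/-- A block coset that stays near another block coset contains it. -/
theorem subset_of_near [Finite V] [Nontrivial V] (hΓ : Γ.Connected) {S S' : Set V}
    (hS : MaxBiconn Γ S) (hS' : MaxBiconn Γ S') {g h' : Raag Γ} {r : ℕ}
    (h : cs Γ g S ⊆ nb r (cs Γ h' S')) : cs Γ h' S' ⊆ cs Γ g S := by
  by_contra hcon
  obtain ⟨p, -, v, -, -, hz⟩ := exists_line_of_not_subset hΓ hS hS' hcon
  refine not_near_line qe_id (hS.two_le_ncard hΓ) r g p v ?_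
  rintro _ ⟨z, hzS, rfl⟩
  exact hz r z hzS (h hzS)

/-- A set of lines in a flat spans a flat. -/
theorem near_of_near_lines [Finite V] [Finite W] {ψ : Raag Γ → Raag Λ} {B : Set V}
    (hB : Γ.IsClique B) {S C : Set W} (hS : Λ.IsClique S) (hCS : C ⊆ S) {h0 : Raag Γ}
    {g0 : Raag Λ} {r0 r3 : ℕ} (hnear : ψ '' cs Γ h0 B ⊆ nb r0 (cs Λ g0 S))
    (hline : ∀ v ∈ B, ∀ x ∈ cs Γ h0 B, ∃ m ∈ cs Λ g0 S, ∃ w ∈ C,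
      ψ '' cs Γ x {v} ⊆ nb r3 (cs Λ m {w})) :
    ∃ r, ∃ m, ψ '' cs Γ h0 B ⊆ nb r (cs Λ m C) := by
  classical
  have key : ∀ T : Set V, T ⊆ B → ∃ r, ∀ x ∈ cs Γ h0 B, ∃ m ∈ cs Λ g0 S,
      ψ '' cs Γ x T ⊆ nb r (cs Λ m C) := by
    intro T
    induction T, Set.toFinite T using Set.Finite.induction_on with
    | empty =>
      intro _
      refine ⟨r0, fun x hx => ?_⟩
      obtain ⟨m, hm, hd⟩ := hnear ⟨x, hx, rfl⟩
      refine ⟨m, hm, ?_⟩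
      rintro _ ⟨y, hy, rfl⟩
      have hyx : x⁻¹ * y = 1 := mem_subRaag_empty (mem_cs.1 hy)
      obtain rfl : x = y := (inv_mul_eq_one.1 hyx)
      exact ⟨m, self_mem_cs _ _, hd⟩
    | @insert v T hv _ ih =>
      intro hT
      have hvB : v ∈ B := hT (Set.mem_insert _ _)
      have hTB : T ⊆ B := fun t ht => hT (Set.mem_insert_of_mem _ ht)
      obtain ⟨r, hr⟩ := ih hTB
      refine ⟨r3 + (r + r3), fun x hx => ?_⟩
      obtain ⟨m, hm, hmr⟩ := hr x hx
      refine ⟨m, hm, ?_⟩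
      rintro _ ⟨y, hy, rfl⟩
      obtain ⟨k, a, ha, e⟩ := mem_subRaag_insert (B := T)
        (fun t ht htv => hB hvB (hTB ht) htv.symm) (mem_cs.1 hy)
      have ey : y = x * a * raagGen Γ v ^ k := by rw [mul_assoc, ← e]; group
      have hxa : x * a ∈ cs Γ h0 B := mul_mem_cs hx (subRaag_mono hTB ha)
      obtain ⟨m', hm', w, hw, hl⟩ := hline v hvB (x * a) hxa
      obtain ⟨c, hc, hcd⟩ := hmr (Set.mem_image_of_mem ψ (mul_mem_cs (self_mem_cs x T) ha))
      obtain ⟨q, hq, hqd⟩ := hl (Set.mem_image_of_mem ψ (self_mem_cs (x * a) {v}))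
      have hyl : y ∈ cs Γ (x * a) {v} := by
        rw [ey]; exact mul_mem_cs (self_mem_cs _ _) (gen_zpow_mem (Set.mem_singleton v) k)
      obtain ⟨q', hq', hqd'⟩ := hl (Set.mem_image_of_mem ψ hyl)
      rw [← cs_eq_of_mem hq] at hq'
      obtain ⟨t, rfl⟩ := mem_line hq'
      refine ⟨c * raagGen Λ w ^ t, mul_mem_cs hc (gen_zpow_mem hw t), ?_⟩
      have hcS : c ∈ cs Λ g0 S := by
        rw [← cs_eq_of_mem hm]; exact cs_mono hCS _ hc
      have hqS : q ∈ cs Λ c S := by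
        rw [cs_eq_of_mem hcS, ← cs_eq_of_mem hm']
        exact cs_mono (Set.singleton_subset_iff.2 (hCS hw)) _ hq
      have hcomm : Commute (raagGen Λ w ^ t) (c⁻¹ * q) :=
        (gen_comm_subRaag (fun s hs hsw => hS (hCS hw) hs hsw.symm) (mem_cs.1 hqS)).zpow_left t
      have eq' : q * raagGen Λ w ^ t = c * raagGen Λ w ^ t * (c⁻¹ * q) := by
        rw [mul_assoc c, hcomm.eq, ← mul_assoc c, mul_inv_cancel_left]
      have h1 : nd (q * raagGen Λ w ^ t) (c * raagGen Λ w ^ t) = nd q c := by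
        rw [eq']
        calc nd (c * raagGen Λ w ^ t * (c⁻¹ * q)) (c * raagGen Λ w ^ t)
            = nd (c * raagGen Λ w ^ t * (c⁻¹ * q)) (c * raagGen Λ w ^ t * 1) := by rw [mul_one]
          _ = nd (c * (c⁻¹ * q)) (c * 1) := by rw [nd_mul_left, nd_mul_left]
          _ = nd q c := by rw [mul_inv_cancel_left, mul_one]
      have h2 := nd_triangle (ψ y) (q * raagGen Λ w ^ t) (c * raagGen Λ w ^ t)
      have h3 := nd_triangle q (ψ (x * a)) c
      rw [nd_comm q (ψ (x * a))] at h3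
      omega
  obtain ⟨r, hr⟩ := key B subset_rfl
  obtain ⟨m, -, hm⟩ := hr h0 (self_mem_cs _ _)
  exact ⟨r, m, hm⟩

end Near

section LargeBlocks

variable {V W : Type} {Γ : SimpleGraph V} {Λ : SimpleGraph W} {n K : ℕ}

theorem exists_image_block [Fintype V] [Fintype W] [Nontrivial V] (hΓ : NCliqueTreeGraded Γ n)
    {f : Raag Λ → Raag Γ} (hf : QE K f) {S : Set W} (hS : Biconn Λ S) (h3 : 3 ≤ S.ncard)
    (g0 : Raag Λ) :
    ∃ R h0 B, MaxBiconn Γ B ∧ f '' cs Λ g0 S ⊆ nb R (cs Γ h0 B) ∧ Γ.IsClique B ∧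
      B.ncard = n ∧ (∀ x ∈ B, CutVertex Γ x) ∧ Λ.IsClique S ∧ S.ncard ≤ n := by
  obtain ⟨R, hR⟩ := exists_piece_of_biconn hΓ.1 hf
  obtain ⟨h0, B, hB, hsub⟩ := hR S hS h3 g0
  have hBc : Γ.IsClique B := (hΓ.2.2.2 B hB).elim (·.1) (·.1)
  have hSc : Λ.IsClique S := by
    by_contra hSc
    exact not_subset_of_not_clique hf hBc hSc R h0 g0 hsub
  have hcard : S.ncard ≤ B.ncard := by
    by_contra! hlt
    exact not_subset_of_card_lt hf hBc hSc hlt R h0 g0 hsub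
  rcases hΓ.2.2.2 B hB with ⟨-, hn, hcut⟩ | ⟨-, h2, -⟩
  · exact ⟨R, h0, B, hB, hsub, hBc, hn, hcut, hSc, hcard.trans hn.le⟩
  · omega

/-- Blocks of `Λ` with at least three vertices are `n`-cliques of cut vertices. -/
theorem QIPair.large_block [Fintype V] [Fintype W] [Nontrivial V] [Nontrivial W]
    (hΓ : NCliqueTreeGraded Γ n) (hΛ : Λ.Connected) {f : Raag Λ → Raag Γ} {g : Raag Γ → Raag Λ}
    (h : QIPair K f g) {S : Set W} (hS : MaxBiconn Λ S) (h3 : 3 ≤ S.ncard) :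
    Λ.IsClique S ∧ S.ncard = n ∧ ∀ x ∈ S, CutVertex Λ x := by
  obtain ⟨R, h0, B, hB, hsub, hBc, hBn, hBcut, hSc, hSn⟩ := exists_image_block hΓ h.left hS.1 h3 1
  obtain ⟨R', hR'⟩ := exists_piece_of_biconn hΛ h.right
  have hB3 : 3 ≤ B.ncard := by omega
  have hback : g '' cs Γ h0 B ⊆ nb R' (cs Λ 1 S) := by
    obtain ⟨h', S', hS', hsub'⟩ := hR' B hB.1 hB3 h0
    exact hsub'.trans (nb_mono_set (subset_of_near hΛ hS hS' (h.near_comp hsub hsub')))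
  have hle : B.ncard ≤ S.ncard := by
    by_contra! hlt
    exact not_subset_of_card_lt h.right hSc hBc hlt R' 1 h0 hback
  refine ⟨hSc, by omega, ?_⟩
  set C : Set W := {w ∈ S | CutVertex Λ w} with hC
  have hCS : C ⊆ S := fun w hw => hw.1
  have hline : ∀ v ∈ B, ∀ x ∈ cs Γ h0 B, ∃ m ∈ cs Λ 1 S, ∃ w ∈ C,
      g '' cs Γ x {v} ⊆ nb (R' + (2 * K) + R' + R') (cs Λ m {w}) := by
    intro v hv x hx
    obtain ⟨b, hb, hbv⟩ := hB.exists_ne hΓ.1 v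
    obtain ⟨a, hva, hab⟩ := (hBcut v hv).exists_adj hΓ.1 (v := b)
    have haB : a ∉ B := fun ha => hab (hB.1.cmp_singleton_eq ha hb hva.ne' hbv)
    obtain ⟨h'', S'', hS'', hsub''⟩ := hR' B hB.1 hB3 (x * raagGen Γ a)
    have hnot : ¬ cs Λ h'' S'' ⊆ cs Λ 1 S := by
      intro hin
      have h1 := subset_of_near hΓ.1 hB hB
        (h.symm.near_comp (hsub''.trans (nb_mono_set hin)) hsub)
      have h2 := ex_eq_zero haB (mem_cs.1 (h1 hx))
      simp at h2
    obtain ⟨p, hp, w, hw, hwc, hz⟩ := exists_line_of_not_subset hΛ hS hS'' hnot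
    refine ⟨p, hp, w, ⟨hw, hwc⟩, ?_⟩
    rintro _ ⟨y, hy, rfl⟩
    obtain ⟨z, hzS, hzd⟩ := hback ⟨y, cs_subset hx hv hy, rfl⟩
    have hmem : g (y * raagGen Γ a) ∈ nb R' (cs Λ h'' S'') := by
      refine hsub'' ⟨_, ?_, rfl⟩
      obtain ⟨k, rfl⟩ := mem_line hy
      have : x * raagGen Γ v ^ k * raagGen Γ a = x * raagGen Γ a * raagGen Γ v ^ k := by
        rw [mul_assoc, mul_assoc, ((gen_comm hva).zpow_left k).eq]
      rw [this]
      exact mul_mem_cs (self_mem_cs _ _) (gen_zpow_mem hv k)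
    have hd1 : nd (g (y * raagGen Γ a)) (g y) ≤ 2 * K := by
      rw [nd_comm]
      refine (h.right _ _).1.trans ?_
      have := Nat.mul_le_mul_left K (nd_mul_gen y a)
      omega
    have := hz _ z hzS (mem_nb_of_nd (mem_nb_of_nd hmem hd1) hzd)
    exact mem_nb_of_nd this (by rwa [nd_comm])
  obtain ⟨r, m, hm⟩ := near_of_near_lines hBc hSc hCS hback hline
  have hCc : Λ.IsClique C := hSc.subset hCS
  have hBC : B.ncard ≤ C.ncard := by
    by_contra! hlt
    exact not_subset_of_card_lt h.right hCc hBc hlt r m h0 hm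
  have : C = S := Set.eq_of_subset_of_ncard_le hCS (by omega) (Set.toFinite S)
  intro x hx
  rw [← this] at hx
  exact hx.2

end LargeBlocks

section Asymptotic

variable {V W : Type} {Γ : SimpleGraph V} {Λ : SimpleGraph W} {K : ℕ}

theorem Asym.of_subset_nb {φ : Raag Λ → Raag Γ} {L L' : Set (Raag Γ)} {x : Raag Λ} {w : W} {r : ℕ}
    (h : Asym φ L x w) (hL : L ⊆ nb r L') : Asym φ L' x w := by
  intro M
  obtain ⟨C, hC⟩ := h M
  refine ⟨C + M * r, fun j => ?_⟩
  obtain ⟨q, hq, hd⟩ := hC j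
  obtain ⟨q', hq', hd'⟩ := hL hq
  refine ⟨q', hq', ?_⟩
  have := Nat.mul_le_mul_left M ((nd_triangle (φ (x * raagGen Λ w ^ j)) q q').trans
    (Nat.add_le_add_left hd' _))
  rw [mul_add] at this
  omega

theorem Asym.of_near_pair {φ : Raag Λ → Raag Γ} {h h1 : Raag Γ} {l p b : V} {x : Raag Λ} {w : W}
    {R : ℕ} (hA : Asym φ (cs Γ h1 {l}) x w) (hlb : l ≠ b) (hbp : Γ.Adj b p)
    (hnear : ∀ j : ℤ, φ (x * raagGen Λ w ^ j) ∈ nb R (cs Γ h {b, p})) :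
    Asym φ (cs Γ h {p}) x w := by
  intro M
  obtain ⟨C, hC⟩ := hA M
  set c0 := (ex b h - ex b h1).natAbs with hc0
  refine ⟨C + M * (2 * R + c0), fun j => ?_⟩
  obtain ⟨q, hq, hd⟩ := hC j
  obtain ⟨i, rfl⟩ := mem_line hq
  obtain ⟨y, hy, hyd⟩ := hnear j
  obtain ⟨k, a', ha', e⟩ := mem_subRaag_insert (B := {p})
    (fun t ht _ => by rw [Set.mem_singleton_iff.1 ht]; exact hbp) (mem_cs.1 hy)
  have ey : y = h * a' * raagGen Γ b ^ k := by rw [mul_assoc, ← e]; group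
  refine ⟨h * a', mul_mem_cs (self_mem_cs _ _) ha', ?_⟩
  have ha0 : ex b a' = 0 := ex_eq_zero (by simpa using hbp.ne) ha'
  set z := φ (x * raagGen Λ w ^ j) with hz
  have h2 := ex_sub_le b (h1 * raagGen Γ l ^ i) y
  rw [ey] at h2
  simp only [ex_mul, ex_zpow, ex_gen_self, ex_gen_ne hlb, ha0] at h2
  rw [← ey] at h2
  have h3 := nd_triangle (h1 * raagGen Γ l ^ i) z y
  rw [nd_comm (h1 * raagGen Γ l ^ i) z] at h3
  have h4 := nd_triangle z y (h * a')
  have h5 : nd y (h * a') ≤ k.natAbs := by rw [nd_comm, ey]; exact nd_gen_zpow _ _ _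
  have h6 : nd z (h * a') ≤ nd z (h1 * raagGen Γ l ^ i) + (2 * R + c0) := by omega
  have := Nat.mul_le_mul_left M h6
  rw [mul_add] at this
  omega

variable [Fintype V] [Fintype W] [Nontrivial V]

/-- A line whose label has two nonadjacent neighbours is asymptotic to a line with a cut vertex
as label. -/
theorem exists_asym (hΓ : Γ.Connected) (hcl : ∀ B, MaxBiconn Γ B → Γ.IsClique B)
    {φ : Raag Λ → Raag Γ} (hφ : QE K φ) {a c c' : W} (hne : a ≠ c') (hnadj : ¬ Λ.Adj a c')
    (hca : Λ.Adj c a) (hcc' : Λ.Adj c c') :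
    ∃ h l, CutVertex Γ l ∧ Asym φ (cs Γ h {l}) 1 c := by
  by_contra! hcon
  obtain ⟨R, hR⟩ := exists_radius hφ
  obtain ⟨h, B, hB, hsub⟩ := exists_piece hΓ (Y := φ '' cs Λ 1 {a, c, c'})
    ⟨_, Set.mem_image_of_mem φ (self_mem_cs 1 _)⟩ R (by
    rintro p v _ ⟨y, hy, rfl⟩ _ ⟨y', hy', rfl⟩ hd hd'
    by_contra hside
    refine hcon p v ?_ ((hR p v 1 y y' hd hd').2 a c c' hne hnadj hca hcc' hy hy' hside)
    obtain ⟨s, hs, e⟩ := lside_eq_some (fun hm => hd (subset_nb R _ hm))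
    obtain ⟨s', hs', e'⟩ := lside_eq_some (fun hm => hd' (subset_nb R _ hm))
    rw [e, e'] at hside
    exact cutVertex_iff.2 ⟨s, s', hs, hs', fun h => hside (congrArg some h)⟩)
  refine not_subset_of_not_clique hφ (hcl B hB) (fun hc => ?_) R h 1 hsub
  exact hnadj (hc (by simp) (by simp) hne)

/-- The image of the flat spanned by an edge joining two branching vertices lies near a piece. -/
theorem exists_piece_of_edge (hΓ : Γ.Connected) {φ : Raag Λ → Raag Γ} (hφ : QE K φ)
    {a u v b : W} (huv : Λ.Adj u v) (hua : Λ.Adj u a) (hvb : Λ.Adj v b) (hav : a ≠ v)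
    (hbu : b ≠ u) (hav' : ¬ Λ.Adj a v) (hbu' : ¬ Λ.Adj b u) :
    ∃ R h B, MaxBiconn Γ B ∧ φ '' cs Λ 1 {u, v} ⊆ nb R (cs Γ h B) := by
  obtain ⟨R, hR⟩ := exists_radius hφ
  refine ⟨R, exists_piece hΓ (Y := φ '' cs Λ 1 {u, v})
    ⟨_, Set.mem_image_of_mem φ (self_mem_cs 1 _)⟩ R ?_⟩
  rintro p l _ ⟨y, hy, rfl⟩ _ ⟨y', hy', rfl⟩ hd hd'
  by_contra hside
  have s1 : cs Λ 1 {u, v} ⊆ cs Λ 1 {a, u, v} := cs_mono (by simp) 1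
  have s2 : cs Λ 1 {u, v} ⊆ cs Λ 1 {u, v, b} :=
    cs_mono (Set.insert_subset_insert (by simp)) 1
  have h1 := (hR p l 1 y y' hd hd').2 a u v hav hav' hua huv (s1 hy) (s1 hy') hside
  have h2 := (hR p l 1 y y' hd hd').2 u v b hbu.symm (fun h => hbu' h.symm) huv.symm hvb
    (s2 hy) (s2 hy') hside
  exact huv.ne (h1.unique hφ h2)

end Asymptotic

section Graph

variable {V : Type} {Γ : SimpleGraph V}

theorem _root_.Biconn.isClique_of_ncard_le_two [Finite V] {S : Set V} (hS : Biconn Γ S)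
    (h2 : S.ncard ≤ 2) : Γ.IsClique S := by
  intro a ha b hb hab
  have h := preconnected_induce_iff.1 hS.1.preconnected a ha b hb
  obtain ⟨c, hac, hc⟩ := exists_adj_of_cmp_eq hab h
  have hSab : ({a, b} : Set V) = S := Set.eq_of_subset_of_ncard_le
    (Set.insert_subset ha (Set.singleton_subset_iff.2 hb)) (by rw [Set.ncard_pair hab]; exact h2)
    (Set.toFinite S)
  rw [Set.notMem_compl_iff, ← hSab] at hc
  rcases hc with rfl | rfl
  · exact absurd rfl hac.ne
  · exact hac

theorem _root_.SimpleGraph.Connected.mem_of_adj_closed (hΓ : Γ.Connected) {S : Set V}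
    {x : V} (hx : x ∈ S) (hS : ∀ a ∈ S, ∀ b, Γ.Adj a b → b ∈ S) (y : V) : y ∈ S := by
  obtain ⟨p⟩ := hΓ.preconnected x y
  induction p with
  | nil => exact hx
  | cons h _ ih => exact ih (hS _ hx _ h)

theorem _root_.NCliqueTreeGraded.not_isClique {n : ℕ} (h : NCliqueTreeGraded Γ n) :
    ¬ Γ.IsClique Set.univ := by
  intro hc
  obtain ⟨x, y, hxy⟩ := h.2.2.1
  have hne : x ≠ y := by
    rintro rfl
    simp at hxy
  have := SimpleGraph.dist_eq_one_iff_adj.2 (hc (Set.mem_univ x) (Set.mem_univ y) hne)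
  omega

theorem nontrivial_of_not_isClique (h : ¬ Γ.IsClique Set.univ) : Nontrivial V := by
  by_contra hn
  rw [not_nontrivial_iff_subsingleton] at hn
  exact h fun a _ b _ hab => absurd (Subsingleton.elim a b) hab

end Graph

section Main

variable {V W : Type} [Fintype V] [Fintype W] {Γ : SimpleGraph V} {Λ : SimpleGraph W}
  {n K : ℕ} {f : Raag Λ → Raag Γ} {g : Raag Γ → Raag Λ}

theorem QIPair.not_isClique (h : QIPair K f g) (hΓ : ¬ Γ.IsClique Set.univ) :
    ¬ Λ.IsClique Set.univ := fun hc =>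
  not_subset_of_not_clique h.right hc hΓ 0 1 1 fun _ _ => subset_nb _ _ (mem_cs_univ _ _)

/-- Two adjacent cut vertices spanning a block force `n = 2`. -/
theorem QIPair.eq_two_of_edge [Nontrivial V] [Nontrivial W] (hΓ : NCliqueTreeGraded Γ n)
    (hn : 2 ≤ n) (hΛ : Λ.Connected) (h : QIPair K f g) {u v : W} (hS : MaxBiconn Λ {u, v})
    (huv : Λ.Adj u v) (hu : CutVertex Λ u) (hv : CutVertex Λ v) : n = 2 := by
  by_contra hn2
  obtain ⟨a, hua, ha⟩ := hu.exists_adj hΛ (v := v)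
  obtain ⟨b, hvb, hb⟩ := hv.exists_adj hΛ (v := u)
  obtain ⟨-, hav, hbu, hav', hbu'⟩ := three_le_dist hΛ hua huv hvb ha hb
  obtain ⟨R, h0, B, hB, hsub⟩ :=
    exists_piece_of_edge hΓ.1 h.left huv hua hvb hav hbu hav' hbu'
  have hclq : ∀ B, MaxBiconn Γ B → Γ.IsClique B := fun B hB =>
    (hΓ.2.2.2 B hB).elim (·.1) (·.1)
  rcases hΓ.2.2.2 B hB with ⟨hBc, hBn, -⟩ | ⟨hBc, hB2, p, ⟨hpB, hp⟩, huniq⟩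
  · obtain ⟨R', hR'⟩ := exists_piece_of_biconn hΛ h.right
    obtain ⟨h', S', hS', hsub'⟩ := hR' B hB.1 (by omega) h0
    have hback := hsub'.trans
      (nb_mono_set (r := R') (subset_of_near hΛ hS hS' (h.near_comp hsub hsub')))
    refine not_subset_of_card_lt h.right (isClique_pair huv) hBc ?_ R' 1 h0 hback
    rw [Set.ncard_pair huv.ne]
    omega
  · obtain ⟨b', hb'B, hb'p⟩ := hB.exists_ne hΓ.1 p
    have hb'c : ¬ CutVertex Γ b' := fun hc => hb'p (huniq b' ⟨hb'B, hc⟩)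
    have hbp : Γ.Adj b' p := hBc hb'B hpB hb'p
    have hBeq : ({b', p} : Set V) = B := Set.eq_of_subset_of_ncard_le
      (Set.insert_subset hb'B (Set.singleton_subset_iff.2 hpB))
      (by rw [Set.ncard_pair hb'p]; omega) (Set.toFinite B)
    rw [← hBeq] at hsub
    obtain ⟨h1, l1, hl1, hA1⟩ := exists_asym hΓ.1 hclq h.left hav hav' hua huv
    obtain ⟨h2, l2, hl2, hA2⟩ := exists_asym hΓ.1 hclq h.left hbu hbu' hvb huv.symm
    have hmem : ∀ s ∈ ({u, v} : Set W), ∀ j : ℤ,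
        f (1 * raagGen Λ s ^ j) ∈ nb R (cs Γ h0 {b', p}) := fun s hs j =>
      hsub (Set.mem_image_of_mem f (mul_mem_cs (self_mem_cs _ _) (gen_zpow_mem hs j)))
    have e1 := hA1.of_near_pair (fun e : l1 = b' => hb'c (e ▸ hl1)) hbp (hmem u (by simp))
    have e2 := hA2.of_near_pair (fun e : l2 = b' => hb'c (e ▸ hl2)) hbp (hmem v (by simp))
    exact huv.ne (e1.unique h.left e2)

theorem QIPair.block [Nontrivial V] [Nontrivial W] (hΓ : NCliqueTreeGraded Γ n)
    (hn : 2 ≤ n) (hΛ : Λ.Connected) (h : QIPair K f g) {S : Set W} (hS : MaxBiconn Λ S) :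
    (Λ.IsClique S ∧ S.ncard = n ∧ ∀ x ∈ S, CutVertex Λ x) ∨
      (Λ.IsClique S ∧ S.ncard = 2 ∧ ∃! x : W, x ∈ S ∧ CutVertex Λ x) := by
  rcases Nat.lt_or_ge S.ncard 3 with h3 | h3
  · have h2 : S.ncard = 2 := le_antisymm (by omega) (hS.two_le_ncard hΛ)
    have hcl := hS.1.isClique_of_ncard_le_two h2.le
    obtain ⟨u, v, huv, rfl⟩ := Set.ncard_eq_two.1 h2
    have hadj : Λ.Adj u v := hcl (by simp) (by simp) huv
    by_cases hu : CutVertex Λ u <;> by_cases hv : CutVertex Λ v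
    · refine Or.inl ⟨hcl, h2.trans (h.eq_two_of_edge hΓ hn hΛ hS hadj hu hv).symm, ?_⟩
      rintro x (rfl | rfl) <;> assumption
    · refine Or.inr ⟨hcl, h2, u, ⟨by simp, hu⟩, ?_⟩
      rintro x ⟨rfl | rfl, hx⟩
      · rfl
      · exact absurd hx hv
    · refine Or.inr ⟨hcl, h2, v, ⟨by simp, hv⟩, ?_⟩
      rintro x ⟨rfl | rfl, hx⟩
      · exact absurd hx hu
      · rfl
    · refine absurd (fun a _ b _ hab => ?_) (h.not_isClique hΓ.not_isClique)
      have huniv : ∀ y, y ∈ ({u, v} : Set W) := by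
        refine hΛ.mem_of_adj_closed (x := u) (by simp) ?_
        rintro a (rfl | rfl) b hab
        · exact hS.adj_mem_of_not_cutVertex hΛ (by simp) (y := v) (by simp) huv hu hab
        · exact hS.adj_mem_of_not_cutVertex hΛ (by simp) (y := u) (by simp) huv.symm hv hab
      exact hcl (huniv a) (huniv b) hab
  · exact Or.inl (h.large_block hΓ hΛ hS h3)

theorem QIPair.exists_three_le_dist [Nontrivial V] [Nontrivial W] (hΓ : NCliqueTreeGraded Γ n)
    (hΛ : Λ.Connected) (h : QIPair K f g) (hcl : ∀ S, MaxBiconn Λ S → Λ.IsClique S)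
    (hval : ∀ x : W, CutVertex Λ x ∨ (∃! u : W, Λ.Adj x u)) : ∃ x y : W, 3 ≤ Λ.dist x y := by
  by_cases hedge : ∃ u v, Λ.Adj u v ∧ CutVertex Λ u ∧ CutVertex Λ v
  · obtain ⟨u, v, huv, hu, hv⟩ := hedge
    obtain ⟨a, hua, ha⟩ := hu.exists_adj hΛ (v := v)
    obtain ⟨b, hvb, hb⟩ := hv.exists_adj hΛ (v := u)
    exact ⟨a, b, (three_le_dist hΛ hua huv hvb ha hb).1⟩
  · exfalso
    obtain ⟨u, v, huv, hu, hv⟩ := hΓ.exists_edge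
    obtain ⟨a, hua, ha⟩ := hu.exists_adj hΓ.1 (v := v)
    obtain ⟨b, hvb, hb⟩ := hv.exists_adj hΓ.1 (v := u)
    obtain ⟨-, hav, hbu, hav', hbu'⟩ := three_le_dist hΓ.1 hua huv hvb ha hb
    obtain ⟨h1, w, hw, hA1⟩ := exists_asym hΛ hcl h.right hav hav' hua huv
    obtain ⟨h2, w', hw', hA2⟩ := exists_asym hΛ hcl h.right hbu hbu' hvb huv.symm
    have hstar : ∀ y, y ∈ insert w {t | Λ.Adj w t} := by
      refine hΛ.mem_of_adj_closed (x := w) (by simp) ?_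
      rintro t (rfl | ht) s hts
      · exact Or.inr hts
      · rcases hval t with hc | ⟨z, -, hz⟩
        · exact absurd ⟨w, t, ht, hw, hc⟩ hedge
        · left
          rw [hz s hts, hz w (show Λ.Adj w t from ht).symm]
    obtain rfl : w' = w := by
      rcases hstar w' with e | e
      · exact e
      · exact absurd ⟨w, w', e, hw, hw'⟩ hedge
    have hcentral : ∀ x : Raag Λ, Commute (raagGen Λ w') x := fun x => by
      have hx : x ∈ subRaag Λ Set.univ := by
        have := mem_cs.1 (mem_cs_univ 1 x)
        simpa using this
      refine gen_comm_subRaag (fun t _ ht => ?_) hx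
      exact (hstar t).resolve_left ht
    have hsub : cs Λ h2 {w'} ⊆ nb (nd h2 h1) (cs Λ h1 {w'}) := by
      intro q hq
      obtain ⟨k, rfl⟩ := mem_line hq
      refine ⟨h1 * raagGen Λ w' ^ k, mul_mem_cs (self_mem_cs _ _)
        (gen_zpow_mem (Set.mem_singleton _) k), ?_⟩
      rw [← ((hcentral h2).zpow_left k).eq, ← ((hcentral h1).zpow_left k).eq, nd_mul_left]
    exact huv.ne (hA1.unique h.right (hA2.of_subset_nb hsub))

end Main

end CliqueTree

/-- Any RAAG quasi-isometric to an `n`-clique tree-graded RAAG is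
itself an `n`-clique tree-graded RAAG. -/
theorem stmt1 {n : ℕ} (hn : 2 ≤ n) {V W : Type} [Fintype V] [Fintype W]
    (Γ : SimpleGraph V) (Λ : SimpleGraph W)
    (hΓ : NCliqueTreeGraded Γ n) (hqi : RaagQI Λ Γ) :
    NCliqueTreeGraded Λ n := by
  obtain ⟨K, f, g, h⟩ := CliqueTree.exists_pair hqi
  have hVn : Nontrivial V := CliqueTree.nontrivial_of_not_isClique hΓ.not_isClique
  have hWn : Nontrivial W := CliqueTree.nontrivial_of_not_isClique (h.not_isClique hΓ.not_isClique)
  have hΛ : Λ.Connected := h.symm.connected hΓ.1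
  have hblock : ∀ S, MaxBiconn Λ S → _ := fun S hS => h.block hΓ hn hΛ hS
  have hval : ∀ x : W, CutVertex Λ x ∨ (∃! u : W, Λ.Adj x u) := by
    intro x
    by_cases hx : CutVertex Λ x
    · exact Or.inl hx
    · right
      obtain ⟨u, hu⟩ := hΛ.preconnected.exists_adj_of_nontrivial x
      obtain ⟨S, hxS, huS, hS⟩ := CliqueTree.exists_block_of_adj hu
      refine ⟨u, hu, fun t ht => ?_⟩
      have htS := hS.adj_mem_of_not_cutVertex hΛ hxS huS hu.ne hx ht
      rcases hblock S hS with ⟨-, -, hc⟩ | ⟨-, h2, -⟩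
      · exact absurd (hc x hxS) hx
      · have hSeq : ({x, u} : Set W) = S := Set.eq_of_subset_of_ncard_le
          (Set.insert_subset hxS (Set.singleton_subset_iff.2 huS))
          (by rw [Set.ncard_pair hu.ne, h2]) (Set.toFinite S)
        rw [← hSeq] at htS
        rcases htS with rfl | rfl
        · exact absurd ht (SimpleGraph.irrefl Λ)
        · rfl
  exact ⟨hΛ, hval, h.exists_three_le_dist hΓ hΛ
    (fun S hS => (hblock S hS).elim (·.1) (·.1)) hval, hblock⟩

end
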